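/- (Bombieri–Vinogradov theorem) For every A > 0 there exist B = B(A) > 0 and a constant C_A > 0 such that, with Q = x^{1/2} (log x)^{−B}, for all sufficiently large x one has ∑_{q ≤ Q} max_{a : gcd(a,q)=1} |θ(x; q, a) − x/φ(q)| ≤ C_A · x/(log x)^A. -/

import Mathlib

open Real Filter

/-- `chebyTheta x q a = ∑_{p ≤ x, p prime, p ≡ a (mod q)} log p`. -/
noncomputable def chebyTheta (x : ℝ) (q a : ℕ) : ℝ :=
  ∑ p ∈ (Finset.Iic ⌊x⌋₊).filter (fun p => p.Prime ∧ p % q = a % q), Real.log p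

open MeasureTheory (Integrable integral_const_mul IntegrableOn integral_indicator integral_finset_sum)
open Complex (I continuous_re continuous_ofReal norm_cpow_eq_rpow_re_of_pos norm_real abs_im_le_norm abs_re_le_norm sub_re sub_im differentiableOn_dslope ofReal_re conj_ofReal re_ofReal_mul add_re ofReal_im mem_reProdIm norm_I mul_conj')
open Set (Ioi indicator_of_notMem indicator_of_mem)
open Finset (Icc sum_congr mem_Icc range sum_eq_zero sum_union sum_le_sum mul_sum sum_sub_distrib sum_ite_eq' sum_mul sum_add_distrib sum_nonneg mem_univ sum_mul_sum sum_comm mem_filter sum_le_sum_of_subset_of_nonneg sum_filter Ioc mem_Ioc sum_const card_map sum_Icc_succ_top abs_sum_le_sum_abs sum_subset Icc_subset_Icc_right sum_le_card_nsmul single_le_sum mem_erase)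
open DirichletCharacter (LFunctionTrivChar₁ LFunctionTrivChar LFunction_eq_LSeries differentiable_LFunction LFunction_modOne_eq changeLevel changeLevel_eq_cast_of_dvd')
open ArithmeticFunction (vonMangoldt pmul_apply vonMangoldt_nonneg)


lemma bv_kernel_int {σ : ℝ} (hσ : 0 < σ) :
    Integrable (fun t : ℝ => 1 / ((σ : ℂ) + t * I) ^ 2) := by
  have h1 : Integrable (fun t : ℝ => (1 + (t / σ) ^ 2)⁻¹) :=
    integrable_inv_one_add_sq.comp_div hσ.ne'
  refine (h1.const_mul (1 / σ ^ 2)).mono' ?_ ?_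
  · apply Continuous.aestronglyMeasurable
    apply Continuous.div continuous_const (by fun_prop)
    intro t
    apply pow_ne_zero
    intro h
    have := congrArg Complex.re h
    simp at this
    exact hσ.ne' this
  · refine Eventually.of_forall fun t => le_of_eq ?_
    rw [norm_div, norm_pow, norm_one, Complex.sq_norm, Complex.normSq_apply]
    simp
    field_simp

lemma bv_kernel_norm {σ : ℝ} (_hσ : 0 < σ) (t : ℝ) :
    ‖1 / ((σ : ℂ) + t * I) ^ 2‖ = 1 / (σ ^ 2 + t ^ 2) := by
  rw [norm_div, norm_pow, norm_one, Complex.sq_norm, Complex.normSq_apply]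
  simp
  ring

lemma bv_kernel_int_norm {σ : ℝ} (hσ : 0 < σ) :
    ∫ t : ℝ, 1 / (σ ^ 2 + t ^ 2) = π / σ := by
  have h : ∀ t : ℝ, 1 / (σ ^ 2 + t ^ 2) = (1 / σ ^ 2) * (1 + (t / σ) ^ 2)⁻¹ := by
    intro t; field_simp
  simp_rw [h]
  rw [integral_const_mul,
    MeasureTheory.Measure.integral_comp_div (fun t => (1 + t ^ 2)⁻¹) σ, integral_univ_inv_one_add_sq,
    abs_of_pos hσ]
  simp
  field_simp

lemma bv_mellin_log {s : ℂ} (hs : 0 < s.re) :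
    HasMellin (fun u : ℝ => ((max (-log u) 0 : ℝ) : ℂ)) s (1 / s ^ 2) := by
  set f : ℝ → ℂ := Set.indicator (Set.Ioc 0 1) (fun _ => 1) with hf
  have hfl : MeasureTheory.LocallyIntegrableOn f (Ioi 0) := by
    apply Integrable.locallyIntegrable _ |>.locallyIntegrableOn
    rw [hf, MeasureTheory.integrable_indicator_iff measurableSet_Ioc]
    simp
  have h := mellin_hasDerivAt_of_isBigO_rpow (f := f) (a := s.re + 1) (b := 0) (s := s) hfl
    (by
      apply Asymptotics.IsBigO.of_bound 1
      filter_upwards [eventually_gt_atTop 1] with u hu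
      rw [hf, indicator_of_notMem (by simp [hu])]
      simp) (by linarith)
    (by
      apply Asymptotics.IsBigO.of_bound 1
      refine Eventually.of_forall fun u => ?_
      rw [hf]
      by_cases hu : u ∈ Set.Ioc (0:ℝ) 1
      · simp [indicator_of_mem hu]
      · simp [indicator_of_notMem hu]) hs
  have h2 : HasDerivAt (fun s : ℂ => 1 / s) (mellin (fun t => log t • f t) s) s := by
    refine h.2.congr_of_eventuallyEq ?_
    have : {z : ℂ | 0 < z.re} ∈ nhds s := (isOpen_lt continuous_const continuous_re).mem_nhds hs
    filter_upwards [this] with z hz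
    exact (hasMellin_one_Ioc hz).2.symm
  have hs0 : s ≠ 0 := by rintro rfl; simp at hs
  have h3 : HasDerivAt (fun s : ℂ => 1 / s) (-(s ^ 2)⁻¹) s := by
    simpa using hasDerivAt_inv hs0
  have h4 := h2.unique h3
  have e : Set.EqOn (fun u : ℝ => ((max (-log u) 0 : ℝ) : ℂ)) (fun t => -(log t • f t)) (Ioi 0) := by
    intro u hu
    have hu : 0 < u := hu
    simp only [hf]
    by_cases h1 : u ≤ 1
    · rw [indicator_of_mem (show u ∈ Set.Ioc (0:ℝ) 1 from ⟨hu, h1⟩), max_eq_left (by simpa using log_nonpos hu.le h1)]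
      simp
    · rw [indicator_of_notMem (by simp; intro _; linarith), max_eq_right (by simpa using log_nonneg (by linarith))]
      simp
  constructor
  · have := h.1.const_smul (-1 : ℂ)
    unfold MellinConvergent at *
    refine IntegrableOn.congr_fun this ?_ measurableSet_Ioi
    intro u hu
    simp only [e hu]
    simp
  · have : mellin (fun u : ℝ => ((max (-log u) 0 : ℝ) : ℂ)) s = mellin (fun t => (-1 : ℂ) • (log t • f t)) s := by
      unfold mellin
      apply MeasureTheory.setIntegral_congr_fun measurableSet_Ioi
      intro u hu
      simp only [e hu]
      simp
    rw [this, mellin_const_smul, h4]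
    simp

lemma bv_perron {σ : ℝ} (hσ : 0 < σ) {y : ℝ} (hy : 0 < y) :
    ∫ t : ℝ, (y : ℂ) ^ ((σ : ℂ) + t * I) * (1 / ((σ : ℂ) + t * I) ^ 2)
      = 2 * π * ((max (log y) 0 : ℝ) : ℂ) := by
  have hm : ∀ t : ℝ, mellin (fun u : ℝ => ((max (-log u) 0 : ℝ) : ℂ)) ((σ : ℂ) + t * I)
      = 1 / ((σ : ℂ) + t * I) ^ 2 := fun t => (bv_mellin_log (by simpa using hσ)).2
  have h := mellinInv_mellin_eq σ (fun u : ℝ => ((max (-log u) 0 : ℝ) : ℂ)) (x := y⁻¹) (by positivity)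
    (bv_mellin_log (by simpa using hσ)).1 ?_ ?_
  · unfold mellinInv at h
    simp only [hm, smul_eq_mul] at h
    have h5 : ∀ t : ℝ, ((y⁻¹ : ℝ) : ℂ) ^ (-((σ : ℂ) + t * I)) = (y : ℂ) ^ ((σ : ℂ) + t * I) := by
      intro t
      rw [Complex.ofReal_inv, Complex.inv_cpow, Complex.cpow_neg, inv_inv]
      rw [Complex.arg_ofReal_of_nonneg hy.le]; exact pi_pos.ne
    simp only [h5, log_inv, neg_neg] at h
    have : (π : ℂ) ≠ 0 := by exact_mod_cast pi_pos.ne'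
    rw [← h, Complex.real_smul, ← mul_assoc]
    push_cast
    rw [mul_one_div_cancel (by simp [this]), one_mul]
  · unfold Complex.VerticalIntegrable
    simp only [hm]
    exact bv_kernel_int hσ
  · refine continuous_ofReal.continuousAt.comp (Filter.Tendsto.max ?_ tendsto_const_nhds)
    exact (continuousAt_log (by positivity)).neg

/-- Perron-type formula with kernel `1/s^2`. -/
lemma bv_perron_sum (a : ℕ → ℂ) {σ : ℝ} (hσ : 0 < σ) (ha : LSeriesSummable a σ) {x : ℝ} (hx : 0 < x) :
    ∫ t : ℝ, LSeries a ((σ : ℂ) + t * I) * (x : ℂ) ^ ((σ : ℂ) + t * I) *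
      (1 / ((σ : ℂ) + t * I) ^ 2)
      = 2 * π * ∑ n ∈ Icc 1 ⌊x⌋₊, a n * (log (x / n) : ℂ) := by
  set F : ℕ → ℝ → ℂ := fun n t => LSeries.term a ((σ : ℂ) + t * I) n * (x : ℂ) ^ ((σ : ℂ) + t * I) *
      (1 / ((σ : ℂ) + t * I) ^ 2) with hF
  have hne : ∀ t : ℝ, ((σ : ℂ) + t * I) ≠ 0 := by
    intro t h
    have := congrArg Complex.re h
    simp at this; exact hσ.ne' this
  have hxn : ∀ t : ℝ, ‖(x : ℂ) ^ ((σ : ℂ) + t * I)‖ = x ^ σ := by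
    intro t; rw [norm_cpow_eq_rpow_re_of_pos hx]; simp
  have hterm : ∀ n (t : ℝ), ‖LSeries.term a ((σ : ℂ) + t * I) n‖ = ‖LSeries.term a σ n‖ := by
    intro n t
    rw [LSeries.norm_term_eq, LSeries.norm_term_eq]; simp
  have hnorm : ∀ n t, ‖F n t‖ = ‖LSeries.term a σ n‖ * x ^ σ * (1 / (σ ^ 2 + t ^ 2)) := by
    intro n t
    simp only [hF]
    rw [norm_mul, norm_mul, hterm, hxn, bv_kernel_norm hσ]
  have hcont : ∀ n, Continuous (F n) := by
    intro n
    simp only [hF]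
    refine Continuous.mul (Continuous.mul ?_ ?_) ?_
    · rcases eq_or_ne n 0 with rfl | hn
      · simp; exact continuous_const
      · simp only [LSeries.term_of_ne_zero hn]
        apply Continuous.div continuous_const
        · exact Continuous.const_cpow (by fun_prop) (Or.inl (by exact_mod_cast hn))
        · intro t; simp [Complex.cpow_eq_zero_iff, hn]
    · exact Continuous.const_cpow (by fun_prop) (Or.inl (by exact_mod_cast hx.ne'))
    · exact Continuous.div continuous_const (by fun_prop) (fun t => pow_ne_zero _ (hne t))
  have hkint : Integrable (fun t : ℝ => 1 / (σ ^ 2 + t ^ 2)) := by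
    refine (bv_kernel_int hσ).norm.congr (Eventually.of_forall fun t => bv_kernel_norm hσ t)
  have hint : ∀ n, Integrable (F n) := by
    intro n
    refine (hkint.const_mul (‖LSeries.term a σ n‖ * x ^ σ)).mono' (hcont n).aestronglyMeasurable ?_
    exact Eventually.of_forall fun t => (hnorm n t).le
  have hsum : Summable (fun n => ∫ t, ‖F n t‖) := by
    simp_rw [hnorm, integral_const_mul]
    exact ((ha.norm.mul_right _).mul_right _)
  have h := MeasureTheory.hasSum_integral_of_summable_integral_norm hint hsum
  have h1 : ∀ n, ∫ t, F n t = 2 * π * (if n = 0 then 0 else a n * ((max (log (x / n)) 0 : ℝ) : ℂ)) := by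
    intro n
    rcases eq_or_ne n 0 with rfl | hn
    · simp [hF]
    · have hn' : (0 : ℝ) < n := by positivity
      rw [if_neg hn]
      have := bv_perron hσ (y := x / n) (by positivity)
      calc ∫ t, F n t = ∫ t : ℝ, a n * (((x / n : ℝ) : ℂ) ^ ((σ : ℂ) + t * I) * (1 / ((σ : ℂ) + t * I) ^ 2)) := by
            congr 1; ext t
            simp only [hF]
            rw [LSeries.term_of_ne_zero hn, Complex.ofReal_div, Complex.div_cpow_ofReal_nonneg hx.le hn'.le]
            push_cast; ring
        _ = _ := by
            rw [integral_const_mul, this]; ring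
  have h2 : ∀ t, ∑' n, F n t = LSeries a ((σ : ℂ) + t * I) * (x : ℂ) ^ ((σ : ℂ) + t * I) *
      (1 / ((σ : ℂ) + t * I) ^ 2) := by
    intro t
    simp only [hF]
    rw [tsum_mul_right, tsum_mul_right]; rfl
  simp_rw [h2, h1] at h
  rw [← h.tsum_eq, tsum_mul_left]
  congr 1
  rw [tsum_eq_sum (s := Icc 1 ⌊x⌋₊)]
  · apply sum_congr rfl
    intro n hn
    rw [mem_Icc] at hn
    have hn' : (0 : ℝ) < n := by exact_mod_cast hn.1
    rw [if_neg (by omega), max_eq_left]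
    apply log_nonneg
    rw [one_le_div hn']
    exact (Nat.le_floor_iff hx.le).mp hn.2
  · intro n hn
    split_ifs with h0
    · rfl
    · have hn' : (0 : ℝ) < n := by positivity
      rw [max_eq_right]; · simp
      apply log_nonpos (by positivity)
      rw [div_le_one hn']
      by_contra! hc
      exact hn (mem_Icc.mpr ⟨by omega, Nat.le_floor hc.le⟩)

/-- centred remainder of the partial sums after `N` -/
noncomputable def bvE (a : ℕ → ℂ) (c : ℂ) (N : ℕ) (u : ℝ) : ℂ :=
  ∑ n ∈ Icc 1 ⌊u⌋₊, a n - ∑ n ∈ Icc 1 N, a n - c * ((u : ℂ) - N)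

lemma bvE_meas (a : ℕ → ℂ) (c : ℂ) (N : ℕ) : Measurable (bvE a c N) := by
  unfold bvE
  refine Measurable.sub (Measurable.sub ?_ measurable_const) (by fun_prop)
  exact (measurable_from_nat (f := fun k => ∑ n ∈ Icc 1 k, a n)).comp Nat.measurable_floor

lemma bvE_bound {a : ℕ → ℂ} {c : ℂ} {K : ℝ} (h : ∀ n : ℕ, ‖∑ k ∈ Icc 1 n, a k - c * n‖ ≤ K)
    (N : ℕ) {u : ℝ} (hu : 0 ≤ u) : ‖bvE a c N u‖ ≤ 2 * K + ‖c‖ := by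
  have e : bvE a c N u = (∑ k ∈ Icc 1 ⌊u⌋₊, a k - c * ⌊u⌋₊) - (∑ k ∈ Icc 1 N, a k - c * N)
      - c * ((u - ⌊u⌋₊ : ℝ) : ℂ) := by
    unfold bvE; push_cast; ring
  rw [e]
  refine (norm_sub_le _ _).trans (add_le_add ((norm_sub_le _ _).trans ?_) ?_)
  · linarith [h ⌊u⌋₊, h N]
  · rw [norm_mul, norm_real]
    have h1 := Nat.floor_le hu
    have h2 := Nat.lt_floor_add_one u
    have : ‖u - ⌊u⌋₊‖ ≤ 1 := by rw [norm_eq_abs, abs_le]; constructor <;> linarith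
    nlinarith [norm_nonneg c]

lemma bv_tail_diff {a : ℕ → ℂ} {c : ℂ} {K : ℝ} (h : ∀ n : ℕ, ‖∑ k ∈ Icc 1 n, a k - c * n‖ ≤ K)
    {N : ℕ} (hN : 1 ≤ N) {s : ℂ} (hs : 0 < s.re) :
    DifferentiableAt ℂ (fun s : ℂ => ∫ u in Ioi (N : ℝ), bvE a c N u * (u : ℂ) ^ (-(s + 1))) s := by
  have hN0 : (1 : ℝ) ≤ N := by exact_mod_cast hN
  set f : ℝ → ℂ := (Ioi (N : ℝ)).indicator (bvE a c N) with hf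
  have e : (fun s : ℂ => ∫ u in Ioi (N : ℝ), bvE a c N u * (u : ℂ) ^ (-(s + 1))) = fun s => mellin f (-s) := by
    ext z
    unfold mellin
    rw [← integral_indicator measurableSet_Ioi, ← integral_indicator measurableSet_Ioi]
    congr 1; ext u
    by_cases hu : u ∈ Ioi (N : ℝ)
    · have hu' : u ∈ Ioi (0 : ℝ) := by
        have : (N : ℝ) < u := hu
        show 0 < u; linarith
      rw [indicator_of_mem hu, indicator_of_mem hu', hf, indicator_of_mem hu, smul_eq_mul, mul_comm]
      congr 2; ring
    · rw [indicator_of_notMem hu]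
      by_cases hu' : u ∈ Ioi (0 : ℝ)
      · rw [indicator_of_mem hu', hf, indicator_of_notMem hu, smul_zero]
      · rw [indicator_of_notMem hu']
  rw [e]
  have hb : ∀ u, ‖f u‖ ≤ 2 * K + ‖c‖ := by
    intro u
    by_cases hu : u ∈ Ioi (N : ℝ)
    · rw [hf, indicator_of_mem hu]
      have : (N : ℝ) < u := hu
      exact bvE_bound h N (by linarith)
    · rw [hf, indicator_of_notMem hu, norm_zero]
      have := (norm_nonneg _).trans (h 0)
      positivity
  have hm : Measurable f := (bvE_meas a c N).indicator measurableSet_Ioi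
  have := mellin_differentiableAt_of_isBigO_rpow (f := f) (a := 0) (b := -s.re - 1) (s := -s)
    (by
      apply MeasureTheory.LocallyIntegrable.locallyIntegrableOn
      refine (MeasureTheory.locallyIntegrable_const (2 * K + ‖c‖)).mono hm.aestronglyMeasurable ?_
      exact Eventually.of_forall fun u => (hb u).trans (le_norm_self _))
    (by
      apply Asymptotics.IsBigO.of_bound (2 * K + ‖c‖)
      exact Eventually.of_forall fun u => by simpa using hb u) (by simpa using hs)
    (by
      apply Asymptotics.IsBigO.of_bound 1
      have : Set.Iio (1 : ℝ) ∈ nhds (0 : ℝ) := Iio_mem_nhds one_pos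
      filter_upwards [mem_nhdsWithin_of_mem_nhds this] with u hu
      have hu : u < 1 := hu
      rw [hf, indicator_of_notMem (by simp; linarith)]
      simp) (by simp)
  exact this.comp s differentiableAt_id.neg

lemma bv_tail_int {a : ℕ → ℂ} {c : ℂ} {K : ℝ} (h : ∀ n : ℕ, ‖∑ k ∈ Icc 1 n, a k - c * n‖ ≤ K)
    {N : ℕ} (hN : 1 ≤ N) {s : ℂ} (hs : 0 < s.re) :
    IntegrableOn (fun u : ℝ => bvE a c N u * (u : ℂ) ^ (-(s + 1))) (Ioi (N : ℝ)) := by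
  have hN0 : (0 : ℝ) < N := by exact_mod_cast hN
  refine Integrable.bdd_mul (c := 2 * K + ‖c‖) ?_ (bvE_meas a c N).aestronglyMeasurable ?_
  · exact integrableOn_Ioi_cpow_of_lt (by simpa using hs) hN0
  · rw [MeasureTheory.ae_restrict_iff' measurableSet_Ioi]
    refine Eventually.of_forall fun u hu => bvE_bound h N (hN0.trans hu).le

lemma bv_tail_bound {a : ℕ → ℂ} {c : ℂ} {K : ℝ} (h : ∀ n : ℕ, ‖∑ k ∈ Icc 1 n, a k - c * n‖ ≤ K)
    {N : ℕ} (hN : 1 ≤ N) {s : ℂ} (hs : 0 < s.re) :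
    ‖∫ u in Ioi (N : ℝ), bvE a c N u * (u : ℂ) ^ (-(s + 1))‖ ≤ (2 * K + ‖c‖) * ((N : ℝ) ^ (-s.re) / s.re) := by
  have hN0 : (0 : ℝ) < N := by exact_mod_cast hN
  have hlt : -(s.re + 1) < -1 := by linarith
  calc _ ≤ ∫ u in Ioi (N : ℝ), (2 * K + ‖c‖) * u ^ (-(s.re + 1)) := by
        refine MeasureTheory.norm_integral_le_of_norm_le ((integrableOn_Ioi_rpow_of_lt hlt hN0).const_mul _) ?_
        rw [MeasureTheory.ae_restrict_iff' measurableSet_Ioi]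
        refine Eventually.of_forall fun u hu => ?_
        have hu : (N : ℝ) < u := hu
        rw [norm_mul, norm_cpow_eq_rpow_re_of_pos (hN0.trans hu)]
        have : (-(s + 1)).re = -(s.re + 1) := by simp
        rw [this]
        exact mul_le_mul_of_nonneg_right (bvE_bound h N (hN0.trans hu).le) (by have := hN0.trans hu; positivity)
    _ = _ := by
        rw [integral_const_mul, integral_Ioi_rpow_of_lt hlt hN0]
        congr 1
        rw [show -(s.re + 1) + 1 = -s.re by ring, neg_div_neg_eq]

lemma bv_rep_re {a : ℕ → ℂ} {c : ℂ} {K : ℝ} (h : ∀ n : ℕ, ‖∑ k ∈ Icc 1 n, a k - c * n‖ ≤ K)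
    {N : ℕ} (hN : 1 ≤ N) {s : ℂ} (hs : 1 < s.re) (hsum : LSeriesSummable a s) :
    (s - 1) * LSeries a s = (s - 1) * ∑ n ∈ Icc 1 N, a n * (n : ℂ) ^ (-s) + c * (N : ℂ) ^ (1 - s)
      + (s - 1) * (s * ∫ u in Ioi (N : ℝ), bvE a c N u * (u : ℂ) ^ (-(s + 1))) := by
  have hN0 : (0 : ℝ) < N := by exact_mod_cast hN
  have hN1 : (1 : ℝ) ≤ N := by exact_mod_cast hN
  have hNc : (N : ℂ) ≠ 0 := by exact_mod_cast hN0.ne'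
  have hs0 : s ≠ 0 := by rintro rfl; simp at hs; linarith
  have hs1 : s - 1 ≠ 0 := by
    intro h; rw [sub_eq_zero] at h; rw [h] at hs; simp at hs
  set b : ℕ → ℂ := fun n => if n ≤ N then 0 else a n with hb
  -- LSeries split
  have hsplit : LSeries a s = ∑ n ∈ Icc 1 N, a n * (n : ℂ) ^ (-s) + LSeries b s := by
    have hsum' : Summable (LSeries.term a s) := hsum
    unfold LSeries
    rw [← hsum'.sum_add_tsum_compl (s := range (N+1))]
    congr 1
    · rw [Finset.sum_range_eq_add_Ico _ (by omega)]
      rw [LSeries.term_zero, zero_add]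
      apply sum_congr (by ext; simp)
      intro n hn
      rw [mem_Icc] at hn
      rw [LSeries.term_of_ne_zero (by omega), Complex.cpow_neg, div_eq_mul_inv]
    · rw [tsum_subtype (s := ((range (N+1) : Finset ℕ) : Set ℕ)ᶜ) (f := LSeries.term a s)]
      congr 1; ext n
      by_cases hn : n ≤ N
      · rw [indicator_of_notMem (by simp; omega)]
        by_cases h0 : n = 0
        · simp [h0]
        · rw [LSeries.term_of_ne_zero h0]; simp [hb, hn]
      · rw [indicator_of_mem (by simp; omega)]
        rw [LSeries.term_of_ne_zero (by omega), LSeries.term_of_ne_zero (by omega)]; simp [hb, hn]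
  have hbsum : LSeriesSummable b s := by
    refine Summable.of_norm_bounded hsum.norm fun n => ?_
    by_cases h0 : n = 0
    · simp [h0]
    · rw [LSeries.term_of_ne_zero h0, LSeries.term_of_ne_zero h0]
      by_cases hn : n ≤ N
      · simp [hb, hn]; positivity
      · simp [hb, hn]
  have hbS : ∀ m : ℕ, ∑ k ∈ Icc 1 m, b k = if m ≤ N then 0 else ∑ k ∈ Icc 1 m, a k - ∑ k ∈ Icc 1 N, a k := by
    intro m
    split_ifs with hm
    · apply sum_eq_zero
      intro k hk; rw [mem_Icc] at hk
      simp [hb, hk.2.trans hm]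
    · push Not at hm
      rw [eq_sub_iff_add_eq]
      have : Icc 1 m = Icc 1 N ∪ Icc (N+1) m := by ext; simp; omega
      rw [this, sum_union, sum_union]
      · have h1 : ∑ k ∈ Icc 1 N, b k = 0 := sum_eq_zero fun k hk => by
          rw [mem_Icc] at hk; simp [hb, hk.2]
        have h2 : ∑ k ∈ Icc (N+1) m, b k = ∑ k ∈ Icc (N+1) m, a k := sum_congr rfl fun k hk => by
          rw [mem_Icc] at hk; simp [hb]; omega
        rw [h1, h2]; ring
      all_goals
        rw [Finset.disjoint_left]; intro k; simp; omega
  have hK : 0 ≤ K := (norm_nonneg _).trans (h 0)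
  have hO : (fun n : ℕ => ∑ k ∈ Icc 1 n, b k) =O[atTop] fun n => (n : ℝ) ^ (1 : ℝ) := by
    apply Asymptotics.IsBigO.of_bound (2 * K + 2 * ‖c‖)
    filter_upwards [eventually_ge_atTop 1] with n hn
    have hn1 : (1 : ℝ) ≤ n := by exact_mod_cast hn
    rw [hbS]
    simp only [rpow_one, Real.norm_natCast]
    split_ifs with hm
    · rw [norm_zero]; positivity
    · have e : ∑ k ∈ Icc 1 n, a k - ∑ k ∈ Icc 1 N, a k = (∑ k ∈ Icc 1 n, a k - c * n) -
        (∑ k ∈ Icc 1 N, a k - c * N) + c * ((n - N : ℝ) : ℂ) := by push_cast; ring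
      rw [e]
      have hNn : (N : ℝ) ≤ n := by exact_mod_cast (by omega)
      have h3 : ‖c * ((n - N : ℝ) : ℂ)‖ ≤ ‖c‖ * n := by
        rw [norm_mul, norm_real, norm_eq_abs, abs_of_nonneg (by linarith)]
        exact mul_le_mul_of_nonneg_left (by linarith) (norm_nonneg _)
      refine (norm_add_le _ _).trans ?_
      have h4 := norm_sub_le (∑ k ∈ Icc 1 n, a k - c * n) (∑ k ∈ Icc 1 N, a k - c * N)
      have := h n
      have := h N
      nlinarith [norm_nonneg c]
  have hrep := LSeries_eq_mul_integral b (r := 1) zero_le_one hs hbsum hO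
  have hint : ∫ t in Ioi (1 : ℝ), (∑ k ∈ Icc 1 ⌊t⌋₊, b k) * (t : ℂ) ^ (-(s + 1))
      = ∫ t in Ioi (N : ℝ), (c * ((t : ℂ) ^ (-s) - N * (t : ℂ) ^ (-(s + 1))) + bvE a c N t * (t : ℂ) ^ (-(s + 1))) := by
    rw [← integral_indicator measurableSet_Ioi, ← integral_indicator measurableSet_Ioi]
    apply MeasureTheory.integral_congr_ae
    have hne : ∀ᵐ t : ℝ, t ≠ N := by simp [MeasureTheory.ae_iff]
    filter_upwards [hne] with t hne
    by_cases ht : t ∈ Ioi (N : ℝ)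
    · have ht' : (N : ℝ) < t := ht
      have ht1 : t ∈ Ioi (1 : ℝ) := lt_of_le_of_lt hN1 ht'
      have ht0 : (t : ℂ) ≠ 0 := by exact_mod_cast (hN0.trans ht').ne'
      rw [indicator_of_mem ht, indicator_of_mem ht1, hbS]
      have e1 : (t : ℂ) ^ (-s) = t * (t : ℂ) ^ (-(s + 1)) := by
        rw [show -s = 1 + -(s + 1) by ring, Complex.cpow_add _ _ ht0, Complex.cpow_one]
      have hfl : N ≤ ⌊t⌋₊ := Nat.le_floor ht'.le
      rw [e1]
      unfold bvE
      split_ifs with hm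
      · have : ⌊t⌋₊ = N := le_antisymm hm hfl
        rw [this]; ring
      · ring
    · rw [indicator_of_notMem ht]
      have ht' : t < N := lt_of_le_of_ne (not_lt.mp ht) hne
      have hfl : ⌊t⌋₊ ≤ N := by
        rcases le_or_gt 0 t with h0 | h0
        · exact_mod_cast (Nat.floor_le h0).trans ht'.le
        · rw [Nat.floor_of_nonpos h0.le]; omega
      by_cases ht1 : t ∈ Ioi (1 : ℝ)
      · rw [indicator_of_mem ht1, hbS, if_pos hfl, zero_mul]
      · rw [indicator_of_notMem ht1]
  have i1 : IntegrableOn (fun t : ℝ => (t : ℂ) ^ (-s)) (Ioi (N : ℝ)) :=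
    integrableOn_Ioi_cpow_of_lt (by simpa using hs) hN0
  have i2 : IntegrableOn (fun t : ℝ => (t : ℂ) ^ (-(s+1))) (Ioi (N : ℝ)) :=
    integrableOn_Ioi_cpow_of_lt (by simp; linarith) hN0
  have v1 : ∫ t in Ioi (N : ℝ), (t : ℂ) ^ (-s) = (N : ℂ) ^ (1 - s) / (s - 1) := by
    rw [integral_Ioi_cpow_of_lt (by simpa using hs) hN0]
    rw [show -s + 1 = -(s - 1) by ring, neg_div_neg_eq, show -(s-1) = 1 - s by ring]; simp
  have v2 : ∫ t in Ioi (N : ℝ), (t : ℂ) ^ (-(s+1)) = (N : ℂ) ^ (-s) / s := by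
    rw [integral_Ioi_cpow_of_lt (by simp; linarith) hN0]
    rw [show -(s + 1) + 1 = -s by ring, neg_div_neg_eq]; simp
  have i3 : IntegrableOn (fun t : ℝ => c * ((t : ℂ) ^ (-s) - N * (t : ℂ) ^ (-(s + 1)))) (Ioi (N : ℝ)) :=
    (i1.sub (i2.const_mul _)).const_mul _
  rw [hsplit, hrep, hint, MeasureTheory.integral_add i3 (bv_tail_int h hN (by linarith)),
    integral_const_mul, MeasureTheory.integral_sub i1 (i2.const_mul _), integral_const_mul, v1, v2]
  have e3 : (N : ℂ) ^ (1 - s) = N * (N : ℂ) ^ (-s) := by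
    rw [sub_eq_add_neg, Complex.cpow_add _ _ hNc, Complex.cpow_one]
  rw [e3]
  field_simp
  ring

/-- representation in `Re s > 0` -/
lemma bv_rep {a : ℕ → ℂ} {c : ℂ} {K : ℝ} (h : ∀ n : ℕ, ‖∑ k ∈ Icc 1 n, a k - c * n‖ ≤ K)
    (hsum : ∀ s : ℂ, 1 < s.re → LSeriesSummable a s)
    {J : ℂ → ℂ} (hJ : Differentiable ℂ J) (hJL : ∀ s : ℂ, 1 < s.re → J s = (s - 1) * LSeries a s)
    {N : ℕ} (hN : 1 ≤ N) {s : ℂ} (hs : 0 < s.re) :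
    J s = (s - 1) * ∑ n ∈ Icc 1 N, a n * (n : ℂ) ^ (-s) + c * (N : ℂ) ^ (1 - s)
      + (s - 1) * (s * ∫ u in Ioi (N : ℝ), bvE a c N u * (u : ℂ) ^ (-(s + 1))) := by
  have hNc : (N : ℂ) ≠ 0 := by exact_mod_cast (by omega : N ≠ 0)
  have hU : IsOpen {z : ℂ | 0 < z.re} := isOpen_lt continuous_const continuous_re
  have hd : DifferentiableOn ℂ (fun s : ℂ => (s - 1) * ∑ n ∈ Icc 1 N, a n * (n : ℂ) ^ (-s) + c * (N : ℂ) ^ (1 - s)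
      + (s - 1) * (s * ∫ u in Ioi (N : ℝ), bvE a c N u * (u : ℂ) ^ (-(s + 1)))) {z : ℂ | 0 < z.re} := by
    intro z hz
    apply DifferentiableAt.differentiableWithinAt
    have h1 := bv_tail_diff h hN hz
    have h2 : ∀ n ∈ Icc 1 N, DifferentiableAt ℂ (fun s : ℂ => a n * (n : ℂ) ^ (-s)) z := by
      intro n hn
      have : (n : ℂ) ≠ 0 := by
        rw [mem_Icc] at hn; exact_mod_cast (by omega : n ≠ 0)
      exact ((differentiableAt_id.neg).const_cpow (Or.inl this)).const_mul _
    have h3 : DifferentiableAt ℂ (fun s : ℂ => ∑ n ∈ Icc 1 N, a n * (n : ℂ) ^ (-s)) z :=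
      DifferentiableAt.fun_sum h2
    have h4 : DifferentiableAt ℂ (fun s : ℂ => (N : ℂ) ^ (1 - s)) z :=
      DifferentiableAt.const_cpow (by fun_prop) (Or.inl hNc)
    fun_prop
  have hpre : IsPreconnected {z : ℂ | 0 < z.re} := (convex_halfSpace_re_gt 0).isPreconnected
  refine AnalyticOnNhd.eqOn_of_preconnected_of_eventuallyEq (f := J) (𝕜 := ℂ) (hJ.differentiableOn.analyticOnNhd hU)
    (hd.analyticOnNhd hU) hpre (z₀ := 2) (by simp) ?_ hs
  have : {z : ℂ | 1 < z.re} ∈ nhds (2 : ℂ) :=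
    (isOpen_lt continuous_const continuous_re).mem_nhds (by simp)
  filter_upwards [this] with z hz
  rw [hJL z hz, bv_rep_re h hN hz (hsum z hz)]

lemma bv_periodic_shift {f : ℕ → ℂ} {q : ℕ} (hf : ∀ n, f (n + q) = f n) (m : ℕ) :
    ∑ k ∈ range q, f (k + m) = ∑ k ∈ range q, f k := by
  induction m with
  | zero => simp
  | succ m ih =>
    rw [← ih]
    have h1 := Finset.sum_range_succ (fun k => f (k + m)) q
    have h2 := Finset.sum_range_succ' (fun k => f (k + m)) q
    rw [h1] at h2
    have : f (q + m) = f (0 + m) := by rw [add_comm, hf, zero_add]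
    rw [this] at h2
    have h3 := add_right_cancel h2
    rw [h3]
    apply sum_congr rfl; intro k _; congr 1; ring

lemma bv_periodic_sum {f : ℕ → ℂ} {q : ℕ} (hq : 0 < q) (hf : ∀ n, f (n + q) = f n) (hb : ∀ n, ‖f n‖ ≤ 1) (n : ℕ) :
    ‖∑ k ∈ Icc 1 n, f k - (∑ k ∈ range q, f k) / q * n‖ ≤ 2 * q := by
  have hq' : (q : ℂ) ≠ 0 := by exact_mod_cast hq.ne'
  have hS : ‖(∑ k ∈ range q, f k) / q‖ ≤ 1 := by
    rw [norm_div, Complex.norm_natCast]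
    apply div_le_one_of_le₀ _ (by positivity)
    refine (norm_sum_le _ _).trans ((sum_le_sum fun k _ => hb k).trans (by simp))
  induction n using Nat.strong_induction_on with
  | _ n ih =>
    by_cases hn : n < q
    · refine (norm_sub_le _ _).trans ?_
      have h1 : ‖∑ k ∈ Icc 1 n, f k‖ ≤ n :=
        (norm_sum_le _ _).trans ((sum_le_sum fun k _ => hb k).trans (by simp))
      rw [norm_mul, Complex.norm_natCast]
      have h2 : (n : ℝ) ≤ q := by exact_mod_cast hn.le
      nlinarith [norm_nonneg ((∑ k ∈ range q, f k) / (q : ℂ))]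
    · obtain ⟨m, rfl⟩ : ∃ m, n = m + q := ⟨n - q, by omega⟩
      have e : ∑ k ∈ Icc 1 (m + q), f k = ∑ k ∈ Icc 1 m, f k + ∑ k ∈ range q, f k := by
        rw [← bv_periodic_shift hf (m + 1)]
        have e1 : Icc 1 (m + q) = Icc 1 m ∪ Finset.Ico (m + 1) (m + 1 + q) := by
          ext; simp; omega
        rw [e1, sum_union, Finset.sum_Ico_eq_sum_range]
        · congr 1
          rw [Nat.add_sub_cancel_left]
          apply sum_congr rfl; intro k _; rw [add_comm]
        · rw [Finset.disjoint_left]; intro k; simp; omega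
      have := ih m (by omega)
      rw [e]
      convert this using 2
      push_cast
      field_simp
      ring

/-- mean value of a character -/
noncomputable def bvc {q : ℕ} (χ : DirichletCharacter ℂ q) : ℂ := (∑ k ∈ range q, χ (k : ZMod q)) / q

lemma bvc_norm {q : ℕ} (χ : DirichletCharacter ℂ q) : ‖bvc χ‖ ≤ 1 := by
  unfold bvc
  rw [norm_div, Complex.norm_natCast]
  apply div_le_one_of_le₀ _ (by positivity)
  refine (norm_sum_le _ _).trans ?_
  calc _ ≤ ∑ k ∈ range q, (1 : ℝ) := sum_le_sum fun k _ => χ.norm_le_one _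
    _ = q := by simp

lemma bv_sum_range_zmod {q : ℕ} [NeZero q] (f : ZMod q → ℂ) : ∑ k ∈ range q, f (k : ZMod q) = ∑ k : ZMod q, f k := by
  obtain ⟨n, rfl⟩ : ∃ n, q = n + 1 := ⟨q - 1, by have := NeZero.ne q; omega⟩
  rw [← Fin.sum_univ_eq_sum_range (fun k => f (k : ZMod (n+1)))]
  apply sum_congr rfl
  intro k _
  congr 1
  exact Fin.cast_val_eq_self k

lemma bvc_ne {q : ℕ} [NeZero q] {χ : DirichletCharacter ℂ q} (h : χ ≠ 1) : bvc χ = 0 := by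
  unfold bvc
  rw [bv_sum_range_zmod (fun k => χ k), MulChar.sum_eq_zero_of_ne_one h, zero_div]

lemma bv_char_partial {q : ℕ} [NeZero q] (χ : DirichletCharacter ℂ q) (n : ℕ) :
    ‖∑ k ∈ Icc 1 n, χ (k : ZMod q) - bvc χ * n‖ ≤ 2 * q :=
  bv_periodic_sum (f := fun k => χ (k : ZMod q)) (Nat.pos_of_ne_zero (NeZero.ne q)) (by simp) (fun n => χ.norm_le_one _) n

lemma bv_char_rep_one {q : ℕ} [NeZero q] (χ : DirichletCharacter ℂ q) {N : ℕ} (hN : 1 ≤ N) {s : ℂ} (hs : 0 < s.re) (hs1 : s ≠ 1) :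
    (s - 1) * χ.LFunction s = (s - 1) * ∑ n ∈ Icc 1 N, χ (n : ZMod q) * (n : ℂ) ^ (-s) + bvc χ * (N : ℂ) ^ (1 - s)
      + (s - 1) * (s * ∫ u in Ioi (N : ℝ), bvE (fun n => χ (n : ZMod q)) (bvc χ) N u * (u : ℂ) ^ (-(s + 1))) := by
  have hsum : ∀ s : ℂ, 1 < s.re → LSeriesSummable (fun n => χ (n : ZMod q)) s := fun s hs => χ.LSeriesSummable_of_one_lt_re hs
  by_cases h1 : χ = 1
  · subst h1
    have := bv_rep (bv_char_partial (1 : DirichletCharacter ℂ q)) hsum (DirichletCharacter.differentiable_LFunctionTrivChar₁ q) ?_ hN hs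
    · rw [← this, LFunctionTrivChar₁, Function.update_of_ne hs1]
    · intro z hz
      have hz1 : z ≠ 1 := by rintro rfl; simp at hz
      rw [LFunctionTrivChar₁, Function.update_of_ne hz1]
      rw [LFunctionTrivChar, LFunction_eq_LSeries _ hz]
  · exact bv_rep (J := fun s => (s - 1) * χ.LFunction s) (bv_char_partial χ) hsum
      (by have := differentiable_LFunction h1; fun_prop)
      (fun z hz => by rw [LFunction_eq_LSeries _ hz]) hN hs

lemma bv_char_rep {q : ℕ} [NeZero q] {χ : DirichletCharacter ℂ q} (h1 : χ ≠ 1) {N : ℕ} (hN : 1 ≤ N) {s : ℂ} (hs : 0 < s.re) :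
    χ.LFunction s = ∑ n ∈ Icc 1 N, χ (n : ZMod q) * (n : ℂ) ^ (-s)
      + s * ∫ u in Ioi (N : ℝ), bvE (fun n => χ (n : ZMod q)) 0 N u * (u : ℂ) ^ (-(s + 1)) := by
  have key : ∀ z : ℂ, 0 < z.re → z ≠ 1 → χ.LFunction z = ∑ n ∈ Icc 1 N, χ (n : ZMod q) * (n : ℂ) ^ (-z)
      + z * ∫ u in Ioi (N : ℝ), bvE (fun n => χ (n : ZMod q)) 0 N u * (u : ℂ) ^ (-(z + 1)) := by
    intro z hz hz1
    have := bv_char_rep_one χ hN hz hz1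
    rw [bvc_ne h1] at this
    apply mul_left_cancel₀ (sub_ne_zero.mpr hz1)
    rw [this]; ring
  by_cases hs1 : s = 1
  · subst hs1
    have hp := bv_char_partial χ
    rw [bvc_ne h1] at hp
    have hd := bv_tail_diff hp hN hs
    have h2 : ∀ n ∈ Icc 1 N, DifferentiableAt ℂ (fun s : ℂ => χ (n : ZMod q) * (n : ℂ) ^ (-s)) 1 := by
      intro n hn
      have : (n : ℂ) ≠ 0 := by
        rw [mem_Icc] at hn; exact_mod_cast (by omega : n ≠ 0)
      exact ((differentiableAt_id.neg).const_cpow (Or.inl this)).const_mul _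
    have h3 : DifferentiableAt ℂ (fun s : ℂ => ∑ n ∈ Icc 1 N, χ (n : ZMod q) * (n : ℂ) ^ (-s)) 1 :=
      DifferentiableAt.fun_sum h2
    have c1 : ContinuousAt (fun z : ℂ => ∑ n ∈ Icc 1 N, χ (n : ZMod q) * (n : ℂ) ^ (-z)
      + z * ∫ u in Ioi (N : ℝ), bvE (fun n => χ (n : ZMod q)) 0 N u * (u : ℂ) ^ (-(z + 1))) 1 :=
      (h3.add (differentiableAt_id.mul hd)).continuousAt
    have c2 : ContinuousAt χ.LFunction 1 := (differentiable_LFunction h1 1).continuousAt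
    refine ((ContinuousAt.eventuallyEq_nhds_iff_eventuallyEq_nhdsNE c2 c1).mp ?_).eq_of_nhds
    have hU : {z : ℂ | 0 < z.re} ∈ nhds (1 : ℂ) := (isOpen_lt continuous_const continuous_re).mem_nhds (by simp)
    filter_upwards [self_mem_nhdsWithin, mem_nhdsWithin_of_mem_nhds hU] with z hz hz'
    exact key z hz' hz
  · exact key s hs hs1

lemma bv_sum_rpow_le {N : ℕ} (hN : 1 ≤ N) {σ η : ℝ} (hη : 0 ≤ η) (hσ : 1 - η ≤ σ) :
    ∑ n ∈ Icc 1 N, (n : ℝ) ^ (-σ) ≤ (N : ℝ) ^ η * (1 + log N) := by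
  have h1 : ∑ n ∈ Icc 1 N, (n : ℝ) ^ (-σ) ≤ ∑ n ∈ Icc 1 N, (N : ℝ) ^ η * (n : ℝ)⁻¹ := by
    apply sum_le_sum
    intro n hn
    rw [mem_Icc] at hn
    have hn1 : (1 : ℝ) ≤ n := by exact_mod_cast hn.1
    have hnN : (n : ℝ) ≤ N := by exact_mod_cast hn.2
    calc (n : ℝ) ^ (-σ) ≤ (n : ℝ) ^ (η + -1) := rpow_le_rpow_of_exponent_le hn1 (by linarith)
      _ = (n : ℝ) ^ η * (n : ℝ)⁻¹ := by rw [rpow_add (by linarith), rpow_neg_one]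
      _ ≤ _ := by gcongr
  refine h1.trans ?_
  rw [← mul_sum]
  gcongr
  have := harmonic_le_one_add_log N
  rw [harmonic_eq_sum_Icc] at this
  push_cast at this
  exact this

/-- basic bound -/
lemma bv_L_basic {q : ℕ} [NeZero q] (χ : DirichletCharacter ℂ q) {η : ℝ} (hη : 0 < η) (hη2 : η ≤ 1 / 2) {s : ℂ}
    (hs : 1 - η ≤ s.re) (hs3 : s.re ≤ 3) (N : ℕ) (hN : q * (|s.im| + 2) ≤ N) :
    ‖∑ n ∈ Icc 1 N, χ (n : ZMod q) * (n : ℂ) ^ (-s)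
      + s * ∫ u in Ioi (N : ℝ), bvE (fun n => χ (n : ZMod q)) (bvc χ) N u * (u : ℂ) ^ (-(s + 1))‖
      ≤ (N : ℝ) ^ η * (16 + log N) ∧ ‖bvc χ * (N : ℂ) ^ (1 - s)‖ ≤ (N : ℝ) ^ η := by
  have hq : (1 : ℝ) ≤ q := by exact_mod_cast Nat.pos_of_ne_zero (NeZero.ne q)
  have ha := abs_nonneg s.im
  have hN2 : (2 : ℝ) ≤ N := by nlinarith
  have hN1 : 1 ≤ N := by exact_mod_cast (by linarith : (1 : ℝ) ≤ N)
  have hs0 : 0 < s.re := by linarith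
  constructor
  · have h1 : ‖∑ n ∈ Icc 1 N, χ (n : ZMod q) * (n : ℂ) ^ (-s)‖ ≤ (N : ℝ) ^ η * (1 + log N) := by
      refine (norm_sum_le _ _).trans (le_trans ?_ (bv_sum_rpow_le hN1 hη.le hs))
      apply sum_le_sum
      intro n hn
      rw [mem_Icc] at hn
      rw [norm_mul, Complex.norm_natCast_cpow_of_pos (by omega)]
      have : (-s).re = -s.re := by simp
      rw [this]
      exact mul_le_of_le_one_left (by positivity) (χ.norm_le_one _)
    have h2 := bv_tail_bound (bv_char_partial χ) hN1 hs0
    have hns : ‖s‖ ≤ |s.im| + 3 := by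
      refine (Complex.norm_le_abs_re_add_abs_im s).trans ?_
      rw [abs_of_pos hs0]; linarith
    have hNe : (N : ℝ) ^ (-s.re) ≤ (N : ℝ) ^ η * (N : ℝ)⁻¹ := by
      rw [← rpow_neg_one, ← rpow_add (by linarith)]
      exact rpow_le_rpow_of_exponent_le (by linarith) (by linarith)
    have hdiv : (N : ℝ) ^ (-s.re) / s.re ≤ 2 * ((N : ℝ) ^ η * (N : ℝ)⁻¹) := by
      rw [div_le_iff₀ hs0]
      have : 0 ≤ (N : ℝ) ^ η * (N : ℝ)⁻¹ := by positivity
      nlinarith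
    have h3 : ‖s * ∫ u in Ioi (N : ℝ), bvE (fun n => χ (n : ZMod q)) (bvc χ) N u * (u : ℂ) ^ (-(s + 1))‖ ≤ 15 * (N : ℝ) ^ η := by
      rw [norm_mul]
      have hc := bvc_norm χ
      calc _ ≤ (|s.im| + 3) * ((2 * (2 * q) + ‖bvc χ‖) * ((N : ℝ) ^ (-s.re) / s.re)) := by gcongr
        _ ≤ (|s.im| + 3) * ((5 * q) * (2 * ((N : ℝ) ^ η * (N : ℝ)⁻¹))) := by gcongr; linarith
        _ = (10 * (q * (|s.im| + 3)) * (N : ℝ)⁻¹) * (N : ℝ) ^ η := by ring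
        _ ≤ 15 * (N : ℝ) ^ η := by
          gcongr
          rw [mul_inv_le_iff₀ (by linarith)]
          nlinarith
    refine (norm_add_le _ _).trans ?_
    linarith
  · rw [norm_mul, Complex.norm_natCast_cpow_of_pos (by omega)]
    have : (1 - s).re = 1 - s.re := by simp
    rw [this]
    refine (mul_le_of_le_one_left (by positivity) (bvc_norm _)).trans ?_
    exact rpow_le_rpow_of_exponent_le (by linarith) (by linarith)

lemma bv_N_bound {η X : ℝ} (hη : 0 < η) (hη2 : η ≤ 1 / 2) (hX : 2 ≤ X) :
    ((⌈X⌉₊ : ℕ) : ℝ) ^ η * (16 + log (⌈X⌉₊ : ℕ)) ≤ (32 + 2 / η) * X ^ (2 * η) := by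
  set N := ((⌈X⌉₊ : ℕ) : ℝ) with hN
  have hN1 : N ≤ 2 * X := by have := Nat.ceil_lt_add_one (by linarith : 0 ≤ X); linarith
  have hN2 : X ≤ N := Nat.le_ceil X
  have hlog := log_le_rpow_div (by linarith : 0 ≤ N) hη
  have hp : 1 ≤ N ^ η := one_le_rpow (by linarith) hη.le
  calc N ^ η * (16 + log N) ≤ N ^ η * (16 * N ^ η + N ^ η / η) := by gcongr; linarith
    _ = (16 + 1 / η) * N ^ (2 * η) := by rw [two_mul, rpow_add (by linarith)]; ring
    _ ≤ (16 + 1 / η) * (2 * X) ^ (2 * η) := by gcongr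
    _ = (16 + 1 / η) * (2 ^ (2 * η) * X ^ (2 * η)) := by rw [mul_rpow (by norm_num) (by linarith)]
    _ ≤ (16 + 1 / η) * (2 ^ (1 : ℝ) * X ^ (2 * η)) := by gcongr <;> linarith
    _ = _ := by rw [rpow_one]; ring

lemma bv_L_bound {q : ℕ} [NeZero q] {χ : DirichletCharacter ℂ q} (hχ : χ ≠ 1) {η : ℝ} (hη : 0 < η) (hη2 : η ≤ 1 / 2) {s : ℂ}
    (hs : 1 - η ≤ s.re) (hs3 : s.re ≤ 3) :
    ‖χ.LFunction s‖ ≤ (32 + 2 / η) * (q * (|s.im| + 2)) ^ (2 * η) := by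
  have hq : (1 : ℝ) ≤ q := by exact_mod_cast Nat.pos_of_ne_zero (NeZero.ne q)
  have ha := abs_nonneg s.im
  have hX : 2 ≤ q * (|s.im| + 2) := by nlinarith
  have hN := Nat.le_ceil (q * (|s.im| + 2))
  have hN1 : 1 ≤ ⌈q * (|s.im| + 2)⌉₊ := by rw [Nat.one_le_ceil_iff]; linarith
  have h1 := (bv_L_basic χ hη hη2 hs hs3 _ hN).1
  rw [bvc_ne hχ, ← bv_char_rep hχ hN1 (by linarith)] at h1
  exact h1.trans (bv_N_bound hη hη2 hX)

lemma bv_L_bound_one {q : ℕ} [NeZero q] (χ : DirichletCharacter ℂ q) {η : ℝ} (hη : 0 < η) (hη2 : η ≤ 1 / 2) {s : ℂ}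
    (hs : 1 - η ≤ s.re) (hs3 : s.re ≤ 3) (hs1 : s ≠ 1) :
    ‖χ.LFunction s‖ ≤ (32 + 2 / η) * (q * (|s.im| + 2)) ^ (2 * η) * (1 + 1 / ‖s - 1‖) := by
  have hq : (1 : ℝ) ≤ q := by exact_mod_cast Nat.pos_of_ne_zero (NeZero.ne q)
  have ha := abs_nonneg s.im
  have hX : 2 ≤ q * (|s.im| + 2) := by nlinarith
  have hN := Nat.le_ceil (q * (|s.im| + 2))
  have hN1 : 1 ≤ ⌈q * (|s.im| + 2)⌉₊ := by rw [Nat.one_le_ceil_iff]; linarith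
  have h1 := bv_L_basic χ hη hη2 hs hs3 _ hN
  have h2 := bv_char_rep_one χ hN1 (by linarith : 0 < s.re) hs1
  have h3 := bv_N_bound hη hη2 hX
  have hd : 0 < ‖s - 1‖ := norm_pos_iff.mpr (sub_ne_zero.mpr hs1)
  set N := ⌈q * (|s.im| + 2)⌉₊
  have h4 : ((N : ℕ) : ℝ) ^ η ≤ (N : ℝ) ^ η * (16 + log N) := by
    have : 0 ≤ log N := log_natCast_nonneg _
    exact le_mul_of_one_le_right (by positivity) (by linarith)
  have h5 : ‖s - 1‖ * ‖χ.LFunction s‖ ≤ (32 + 2 / η) * (q * (|s.im| + 2)) ^ (2 * η) * (‖s - 1‖ + 1) := by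
    rw [← norm_mul, h2, add_right_comm, ← mul_add]
    refine (norm_add_le _ _).trans ?_
    rw [norm_mul]
    nlinarith [h1.1, h1.2, norm_nonneg (s - 1)]
  rw [show (1 + 1 / ‖s - 1‖) = (‖s - 1‖ + 1) / ‖s - 1‖ by field_simp, ← mul_div_assoc, le_div_iff₀ hd]
  linarith

lemma bv_L_crude {q : ℕ} [NeZero q] {χ : DirichletCharacter ℂ q} (hχ : χ ≠ 1) {s : ℂ}
    (hs : 1 / 2 ≤ s.re) (hs3 : ‖s‖ ≤ 7 / 2) : ‖χ.LFunction s‖ ≤ 29 * q := by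
  have hq : (1 : ℝ) ≤ q := by exact_mod_cast Nat.pos_of_ne_zero (NeZero.ne q)
  rw [bv_char_rep hχ (le_refl 1) (by linarith)]
  have hp := bv_char_partial χ
  rw [bvc_ne hχ] at hp
  have h2 := bv_tail_bound hp (le_refl 1) (by linarith : 0 < s.re)
  have h3 : ‖s * ∫ u in Ioi ((1 : ℕ) : ℝ), bvE (fun n => χ (n : ZMod q)) 0 1 u * (u : ℂ) ^ (-(s + 1))‖ ≤ 28 * q := by
    rw [norm_mul]
    calc _ ≤ 7 / 2 * ((2 * (2 * q) + ‖(0:ℂ)‖) * (((1 : ℕ) : ℝ) ^ (-s.re) / s.re)) := by gcongr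
      _ = 14 * q * (1 / s.re) := by simp; ring
      _ ≤ 14 * q * 2 := by
        gcongr; rw [div_le_iff₀ (by linarith)]; linarith
      _ = _ := by ring
  refine (norm_add_le _ _).trans ?_
  have : ‖∑ n ∈ Icc (1 : ℕ) 1, χ (n : ZMod q) * (n : ℂ) ^ (-s)‖ ≤ 1 := by simp
  linarith

lemma bv_L_bounds {ε : ℝ} (hε : 0 < ε) : ∃ M₀ : ℝ, 1 ≤ M₀ ∧ ∃ η : ℝ, 0 < η ∧ η ≤ 1 / 4 ∧
    (∀ (q : ℕ) [NeZero q] (χ : DirichletCharacter ℂ q) (s : ℂ), 1 - η ≤ s.re → s.re ≤ 2 → s ≠ 1 →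
      ‖χ.LFunction s‖ ≤ M₀ * (q * (|s.im| + 2)) ^ ε * (1 + 1 / ‖s - 1‖)) ∧
    (∀ (q : ℕ) [NeZero q] (χ : DirichletCharacter ℂ q) (s : ℂ), 1 - η ≤ s.re → s.re ≤ 2 → (χ ≠ 1 ∨ 1 ≤ |s.im|) →
      ‖χ.LFunction s‖ ≤ M₀ * (q * (|s.im| + 2)) ^ ε ∧ ‖deriv χ.LFunction s‖ ≤ M₀ * (q * (|s.im| + 2)) ^ ε) := by
  set e := min (ε / 2) (1 / 2) with he
  have he0 : 0 < e := by positivity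
  have he1 : e ≤ 1 / 2 := min_le_right _ _
  have he2 : 2 * e ≤ ε := by have := min_le_left (ε / 2) (1 / 2); linarith
  set D := 32 + 2 / e with hD
  have hD0 : 0 < D := by positivity
  have mono : ∀ {X : ℝ}, 1 ≤ X → X ^ (2 * e) ≤ X ^ ε := fun hX => rpow_le_rpow_of_exponent_le hX he2
  -- uniform bound
  have hU : ∀ (q : ℕ) [NeZero q] (χ : DirichletCharacter ℂ q) (s : ℂ), 1 - e ≤ s.re → s.re ≤ 3 → (χ ≠ 1 ∨ 1 / 2 ≤ |s.im|) →
      ‖χ.LFunction s‖ ≤ 3 * D * (q * (|s.im| + 2)) ^ (2 * e) := by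
    intro q _ χ s h1 h2 h3
    have hp : 0 ≤ D * (q * (|s.im| + 2)) ^ (2 * e) := by positivity
    by_cases hχ : χ = 1
    · have h3 : 1 / 2 ≤ |s.im| := h3.resolve_left (not_not.mpr hχ)
      have hs1 : s ≠ 1 := by rintro rfl; simp at h3; linarith
      refine (bv_L_bound_one χ he0 he1 h1 h2 hs1).trans ?_
      have hn : 1 / 2 ≤ ‖s - 1‖ := h3.trans (by simpa using abs_im_le_norm (s - 1))
      have : 1 / ‖s - 1‖ ≤ 2 := by rw [div_le_iff₀ (by linarith)]; linarith
      rw [mul_assoc 3, mul_comm 3]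
      apply mul_le_mul_of_nonneg_left _ hp
      linarith
    · have := bv_L_bound hχ he0 he1 h1 h2
      linarith
  refine ⟨12 * D / e, ?_, e / 2, by positivity, by linarith, ?_, ?_⟩
  · rw [le_div_iff₀ he0]; have : 0 < 2 / e := by positivity
    linarith
  · intro q _ χ s h1 h2 hs1
    have hq : (1 : ℝ) ≤ q := by exact_mod_cast Nat.pos_of_ne_zero (NeZero.ne q)
    have ha := abs_nonneg s.im
    refine (bv_L_bound_one χ he0 he1 (by linarith) (by linarith) hs1).trans ?_
    gcongr
    · rw [le_div_iff₀ he0]; nlinarith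
    · nlinarith
  · intro q _ χ s h1 h2 h3
    have hq : (1 : ℝ) ≤ q := by exact_mod_cast Nat.pos_of_ne_zero (NeZero.ne q)
    have ha := abs_nonneg s.im
    have hX : 1 ≤ q * (|s.im| + 2) := by nlinarith
    have hXp : (q * (|s.im| + 2)) ^ (2 * e) ≤ (q * (|s.im| + 2)) ^ ε := mono hX
    have h3' : χ ≠ 1 ∨ 1 / 2 ≤ |s.im| := h3.imp_right (by intro h; linarith)
    constructor
    · refine (hU q χ s (by linarith) (by linarith) h3').trans ?_
      refine mul_le_mul ?_ hXp (by positivity) (by positivity)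
      rw [le_div_iff₀ he0]; nlinarith
    · have hsub : ∀ z ∈ Metric.sphere s (e / 2), ‖χ.LFunction z‖ ≤ 6 * D * (q * (|s.im| + 2)) ^ (2 * e) := by
        intro z hz
        rw [mem_sphere_iff_norm] at hz
        have hre := abs_re_le_norm (z - s)
        have him := abs_im_le_norm (z - s)
        rw [hz, sub_re, abs_le] at hre
        rw [hz, sub_im] at him
        have him1 := abs_sub_abs_le_abs_sub z.im s.im
        have him2 := abs_sub_abs_le_abs_sub s.im z.im
        rw [abs_sub_comm] at him2
        refine (hU q χ z (by linarith) (by linarith) (h3.imp_right (by intro h; linarith))).trans ?_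
        have : (q * (|z.im| + 2)) ^ (2 * e) ≤ 2 * (q * (|s.im| + 2)) ^ (2 * e) := by
          calc (q * (|z.im| + 2)) ^ (2 * e) ≤ (2 * (q * (|s.im| + 2))) ^ (2 * e) := by
                apply rpow_le_rpow (by positivity) _ (by positivity); nlinarith
            _ = 2 ^ (2 * e) * (q * (|s.im| + 2)) ^ (2 * e) := by rw [mul_rpow (by norm_num) (by linarith)]
            _ ≤ 2 ^ (1 : ℝ) * (q * (|s.im| + 2)) ^ (2 * e) := by gcongr <;> linarith
            _ = _ := by rw [rpow_one]
        nlinarith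
      have hdiff : DiffContOnCl ℂ χ.LFunction (Metric.ball s (e / 2)) := by
        apply DifferentiableOn.diffContOnCl
        intro z hz
        apply DifferentiableAt.differentiableWithinAt
        apply DirichletCharacter.differentiableAt_LFunction
        rcases h3 with h3 | h3
        · exact Or.inr h3
        · left
          rintro rfl
          have hz := Metric.closure_ball_subset_closedBall hz
          rw [mem_closedBall_iff_norm] at hz
          have him := abs_im_le_norm (1 - s)
          simp at him
          linarith
      refine (Complex.norm_deriv_le_of_forall_mem_sphere_norm_le (by positivity) hdiff hsub).trans ?_
      calc _ = 12 * D / e * (q * (|s.im| + 2)) ^ (2 * e) := by field_simp; ring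
        _ ≤ _ := by gcongr

/-- `(s-1)ζ(s)` -/
noncomputable def bvZ : ℂ → ℂ := LFunctionTrivChar₁ 1

lemma bvZ_diff : Differentiable ℂ bvZ := DirichletCharacter.differentiable_LFunctionTrivChar₁ 1

lemma bvZ_one : bvZ 1 = 1 := by
  simp [bvZ, LFunctionTrivChar₁]

lemma bvZ_ne {s : ℂ} (hs : s ≠ 1) : bvZ s = (s - 1) * riemannZeta s := by
  simp [bvZ, LFunctionTrivChar₁, Function.update_of_ne hs, LFunctionTrivChar, LFunction_modOne_eq]

lemma bv_iter_inv (n : ℕ) (l : ℂ) : iteratedDeriv n (fun s : ℂ => l * (s - 1)⁻¹) 2 = (-1) ^ n * n.factorial * l := by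
  have h := congrFun (iter_deriv_inv_linear_sub (𝕜 := ℂ) n 1 1) 2
  rw [← iteratedDeriv_eq_iterate] at h
  simp only [one_mul, one_pow, mul_one] at h
  have e : iteratedDeriv n (fun s : ℂ => l * (s - 1)⁻¹) 2 = l * iteratedDeriv n (fun s : ℂ => (s - 1)⁻¹) 2 := by
    rw [iteratedDeriv_const_mul_field]
  rw [e, h]
  norm_num
  ring

open scoped ComplexOrder in
/-- Estermann's lemma -/
lemma bv_estermann : ∃ c : ℝ, 0 < c ∧ ∃ D : ℝ, 0 < D ∧ ∀ (Φ : ℂ → ℂ) (b : ℕ → ℂ) (B β : ℝ), Differentiable ℂ Φ → 0 ≤ b → b 1 = 1 →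
    (∀ s : ℂ, 1 < s.re → LSeriesSummable b s) → (∀ s : ℂ, 1 < s.re → LSeries b s = riemannZeta s * Φ s) →
    1 ≤ B → (∀ z : ℂ, ‖z - 2‖ ≤ 3 / 2 → ‖Φ z‖ ≤ B) → 7 / 8 ≤ β → β < 1 → (riemannZeta β * Φ β).re ≤ 0 →
    c * (1 - β) * B ^ (-(D * (1 - β))) ≤ ‖Φ 1‖ := by
  obtain ⟨CZ, hCZ⟩ := (isCompact_closedBall (2 : ℂ) (3 / 2)).exists_bound_of_continuousOn bvZ_diff.continuous.continuousOn
  have hCZ0 : 0 ≤ CZ := (norm_nonneg _).trans (hCZ 2 (by simp; norm_num))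
  set C0 : ℝ := 2 * (CZ + 1) with hC0
  have hl : 0 < log (4 / 3) := log_pos (by norm_num)
  set D : ℝ := 1 / log (4 / 3) with hD
  have hD0 : 0 < D := by positivity
  refine ⟨1 / 2 * exp (-(1 + D * log (8 * C0))), by positivity, D, hD0, ?_⟩
  intro Φ b B β hΦ hb hb1 hsum hF hB hΦB hβ hβ1 hneg
  set lam := Φ 1 with hlam
  set G : ℂ → ℂ := fun s => bvZ s * Φ s with hG
  have hGd : Differentiable ℂ G := bvZ_diff.mul hΦ
  set g := dslope G 1 with hg
  have hgd : Differentiable ℂ g := by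
    rw [← differentiableOn_univ, hg, differentiableOn_dslope univ_mem]
    exact hGd.differentiableOn
  have hG1 : G 1 = lam := by simp [hG, bvZ_one, hlam]
  have hgv : ∀ s : ℂ, s ≠ 1 → g s = (s - 1)⁻¹ * (G s - lam) := by
    intro s hs
    rw [hg, dslope_of_ne _ hs, slope_def_module, hG1, smul_eq_mul]
  have hgv2 : ∀ s : ℂ, s ≠ 1 → g s = riemannZeta s * Φ s - lam * (s - 1)⁻¹ := by
    intro s hs
    rw [hgv s hs]
    simp only [hG]
    rw [bvZ_ne hs]
    have := sub_ne_zero.mpr hs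
    field_simp
  -- Cauchy bound
  have hcirc : ∀ z ∈ Metric.sphere (2 : ℂ) (3 / 2), ‖g z‖ ≤ C0 * B := by
    intro z hz
    have hz' := hz
    rw [mem_sphere_iff_norm] at hz
    have h1 : 1 / 2 ≤ ‖z - 1‖ := by
      have := norm_sub_norm_le (z - 2) (-1)
      rw [hz, norm_neg, norm_one, show z - 2 - -1 = z - 1 by ring] at this
      linarith
    have hz1 : z ≠ 1 := by rintro rfl; simp at h1; linarith
    rw [hgv z hz1, norm_mul, norm_inv]
    have h2 : ‖z - 1‖⁻¹ ≤ 2 := by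
      rw [inv_le_comm₀ (by linarith) (by norm_num)]; linarith
    have h3 : ‖G z - lam‖ ≤ (CZ + 1) * B := by
      refine (norm_sub_le _ _).trans ?_
      simp only [hG]
      rw [norm_mul]
      have := hCZ z (Metric.sphere_subset_closedBall hz')
      have h4 := hΦB z hz.le
      have h5 : ‖lam‖ ≤ B := hΦB 1 (by norm_num)
      nlinarith [norm_nonneg (Φ z)]
    calc _ ≤ 2 * ((CZ + 1) * B) := by gcongr
      _ = _ := by rw [hC0]; ring
  set A : ℕ → ℝ := fun n => ((-1) ^ n * iteratedDeriv n g 2 / n.factorial).re with hA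
  have hAb : ∀ n, |A n| ≤ C0 * B * (2 / 3) ^ n := by
    intro n
    refine (abs_re_le_norm _).trans ?_
    rw [norm_div, norm_mul, norm_pow, norm_neg, norm_one, one_pow, one_mul, Complex.norm_natCast]
    have := Complex.norm_iteratedDeriv_le_of_forall_mem_sphere_norm_le n (by norm_num) (hgd.diffContOnCl (s := Metric.ball 2 (3/2))) hcirc
    rw [div_le_iff₀ (by positivity)]
    refine this.trans (le_of_eq ?_)
    rw [div_eq_mul_inv, ← inv_pow]; norm_num; ring
  -- coefficients lower bound
  have habs : LSeries.abscissaOfAbsConv b < ((2 : ℝ) : EReal) := by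
    refine lt_of_le_of_lt (LSeriesSummable.abscissaOfAbsConv_le (s := ((3 / 2 : ℝ) : ℂ)) (hsum _ (by rw [ofReal_re]; norm_num))) ?_
    rw [ofReal_re]
    exact_mod_cast (by norm_num : (3 / 2 : ℝ) < 2)
  have hgloc : g =ᶠ[nhds (2 : ℂ)] fun s => LSeries b s - lam * (s - 1)⁻¹ := by
    have : {z : ℂ | 1 < z.re} ∈ nhds (2 : ℂ) :=
      (isOpen_lt continuous_const continuous_re).mem_nhds (by simp)
    filter_upwards [this] with z hz
    have hz1 : z ≠ 1 := by rintro rfl; simp at hz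
    rw [hgv2 z hz1, hF z hz]
  have hLan : AnalyticAt ℂ (LSeries b) 2 := by
    apply LSeries_analyticOnNhd
    exact habs
  have hcoef : ∀ n, (-1) ^ n * iteratedDeriv n g 2 / n.factorial = (-1) ^ n * iteratedDeriv n (LSeries b) 2 / n.factorial - lam := by
    intro n
    rw [hgloc.iteratedDeriv_eq, iteratedDeriv_fun_sub hLan.contDiffAt, bv_iter_inv]
    · have : (n.factorial : ℂ) ≠ 0 := by exact_mod_cast n.factorial_ne_zero
      have h2 : ((-1 : ℂ) ^ n) * (-1) ^ n = 1 := by rw [← mul_pow]; norm_num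
      field_simp
      linear_combination (-(n.factorial : ℂ) * lam) * h2
    · apply ContDiffAt.mul contDiffAt_const
      apply ContDiffAt.inv (by fun_prop); norm_num
  have hAlow : ∀ n, -‖lam‖ ≤ A n := by
    intro n
    simp only [hA]
    rw [hcoef, sub_re]
    have h1 := LSeries.iteratedDeriv_alternating hb habs n
    have h2 : 0 ≤ ((-1) ^ n * iteratedDeriv n (LSeries b) 2 / n.factorial).re := by
      rw [← Complex.ofReal_natCast, Complex.div_ofReal_re]
      apply div_nonneg _ (by positivity)
      have := (Complex.le_def.mp h1).1
      simpa using this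
    have := Complex.re_le_norm lam
    linarith
  have hA0 : 1 - ‖lam‖ ≤ A 0 := by
    simp only [hA]
    rw [hcoef, sub_re]
    have h2 : 1 ≤ ((-1) ^ 0 * iteratedDeriv 0 (LSeries b) 2 / (0).factorial).re := by
      simp only [pow_zero, iteratedDeriv_zero, Nat.factorial_zero, one_mul, Nat.cast_one, div_one]
      have hs2 : LSeriesSummable b ((2 : ℝ) : ℂ) := hsum _ (by rw [ofReal_re]; norm_num)
      have h3 : Summable (LSeries.term b ((2 : ℝ) : ℂ)) := hs2
      have h4 := h3.le_tsum 1 (fun n _ => LSeries.term_nonneg (hb n) 2)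
      have h5 : LSeries.term b ((2 : ℝ) : ℂ) 1 = 1 := by rw [LSeries.term_of_ne_zero one_ne_zero, hb1]; simp
      rw [h5] at h4
      have := (Complex.le_def.mp h4).1
      simpa [LSeries] using this
    have := Complex.re_le_norm lam
    linarith
  -- Taylor
  set y : ℝ := 2 - β with hy
  have hy1 : 1 < y := by linarith
  have hy2 : y ≤ 9 / 8 := by linarith
  have hT : HasSum (fun n => A n * y ^ n) (g β).re := by
    have h1 := Complex.hasSum_taylorSeries_on_ball (f := g) (c := 2) (r := 3 / 2) hgd.differentiableOn (z := β) (by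
      rw [mem_ball_iff_norm, show (β : ℂ) - 2 = ((β - 2 : ℝ) : ℂ) by push_cast; ring, norm_real, norm_eq_abs, abs_lt]
      constructor <;> linarith)
    have h2 := Complex.hasSum_re h1
    refine h2.congr_fun ?_ |> fun h => h
    intro n
    simp only [hA]
    rw [smul_eq_mul, smul_eq_mul, ← Complex.re_mul_ofReal]
    congr 1
    rw [hy, show (β : ℂ) - 2 = (-1) * ((2 - β : ℝ) : ℂ) by push_cast; ring, mul_pow]
    push_cast
    field_simp
  have hC02 : 2 ≤ C0 := by rw [hC0]; linarith
  have hCB : 1 ≤ 8 * C0 * B := by nlinarith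
  have hlogCB : 0 ≤ log (8 * C0 * B) := log_nonneg hCB
  set M : ℕ := ⌈D * log (8 * C0 * B)⌉₊ with hM
  have hM1 : D * log (8 * C0 * B) ≤ M := Nat.le_ceil _
  have hM2 : (M : ℝ) ≤ 1 + D * log (8 * C0 * B) := by
    have := Nat.ceil_lt_add_one (by positivity : 0 ≤ D * log (8 * C0 * B)); linarith
  have hpow : C0 * B * (4 * (3 / 4 : ℝ) ^ M) ≤ 1 / 2 := by
    have h1 : log (8 * C0 * B) ≤ M * log (4 / 3) := by
      have : log (8 * C0 * B) = (D * log (8 * C0 * B)) * log (4 / 3) := by rw [hD]; field_simp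
      rw [this]; gcongr
    have h2 : 8 * C0 * B ≤ (4 / 3 : ℝ) ^ M := by
      rw [← log_pow] at h1
      exact (log_le_log_iff (by linarith) (by positivity)).mp h1
    have h3 : (3 / 4 : ℝ) ^ M * (4 / 3 : ℝ) ^ M = 1 := by rw [← mul_pow]; norm_num
    have h4 : 0 < (3 / 4 : ℝ) ^ M := by positivity
    nlinarith
  have hMpos : 0 < M := by
    by_contra h0
    have : M = 0 := by omega
    rw [this] at hpow
    nlinarith
  have hsplit := hT.summable.sum_add_tsum_nat_add M
  rw [hT.tsum_eq] at hsplit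
  have hr : (2 / 3 * y : ℝ) ≤ 3 / 4 := by linarith
  have hterm : ∀ n, |A n * y ^ n| ≤ C0 * B * (3 / 4) ^ n := by
    intro n
    rw [abs_mul, abs_of_pos (by positivity : 0 < y ^ n)]
    calc _ ≤ C0 * B * (2 / 3) ^ n * y ^ n := by gcongr; exact hAb n
      _ = C0 * B * (2 / 3 * y) ^ n := by rw [mul_pow]; ring
      _ ≤ _ := by gcongr
  have hgeo : HasSum (fun n : ℕ => C0 * B * (3 / 4 : ℝ) ^ (n + M)) (C0 * B * (4 * (3 / 4 : ℝ) ^ M)) := by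
    have := (hasSum_geometric_of_lt_one (by norm_num : (0 : ℝ) ≤ 3 / 4) (by norm_num)).mul_left (C0 * B * (3 / 4 : ℝ) ^ M)
    have e1 : (fun n : ℕ => C0 * B * (3 / 4 : ℝ) ^ (n + M)) = fun n => C0 * B * (3 / 4 : ℝ) ^ M * (3 / 4) ^ n := by
      funext n; rw [pow_add]; ring
    have e2 : C0 * B * (4 * (3 / 4 : ℝ) ^ M) = C0 * B * (3 / 4 : ℝ) ^ M * (1 - 3 / 4)⁻¹ := by norm_num; ring
    rw [e1, e2]; exact this
  have htail : |∑' n, A (n + M) * y ^ (n + M)| ≤ C0 * B * (4 * (3 / 4 : ℝ) ^ M) := by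
    have := tsum_of_norm_bounded (f := fun n => A (n + M) * y ^ (n + M)) hgeo (fun n => by
      rw [norm_eq_abs]; exact hterm (n + M))
    rwa [norm_eq_abs] at this
  have hhead : 1 - ‖lam‖ * ((y ^ M - 1) / (1 - β)) ≤ ∑ n ∈ range M, A n * y ^ n := by
    have h1 : ∑ n ∈ range M, ((if n = 0 then (1 : ℝ) else 0) - ‖lam‖ * y ^ n) ≤ ∑ n ∈ range M, A n * y ^ n := by
      apply sum_le_sum
      intro n _
      split_ifs with h0
      · subst h0; simp; linarith
      · have := hAlow n
        have hyn : 0 < y ^ n := by positivity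
        nlinarith
    refine le_trans (le_of_eq ?_) h1
    rw [sum_sub_distrib, ← mul_sum, geom_sum_eq (by linarith), sum_ite_eq']
    simp [hMpos, hy]
    left; congr 1; ring
  have hgβ : (g β).re ≤ ‖lam‖ / (1 - β) := by
    have hβ1' : (β : ℂ) ≠ 1 := by exact_mod_cast hβ1.ne
    rw [hgv2 _ hβ1', sub_re]
    have h1 : -(lam * ((β : ℂ) - 1)⁻¹).re ≤ ‖lam‖ / (1 - β) := by
      refine (neg_le_abs _).trans ((abs_re_le_norm _).trans (le_of_eq ?_))
      rw [norm_mul, norm_inv, show (β : ℂ) - 1 = ((β - 1 : ℝ) : ℂ) by push_cast; ring, norm_real, norm_eq_abs,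
        abs_of_neg (by linarith), div_eq_mul_inv]
      congr 2; ring
    linarith
  have hb' : 0 < 1 - β := by linarith
  have hmain : 1 / 2 ≤ ‖lam‖ * y ^ M / (1 - β) := by
    have h1 := (abs_le.mp htail).1
    have h2 : ‖lam‖ * ((y ^ M - 1) / (1 - β)) + ‖lam‖ / (1 - β) = ‖lam‖ * y ^ M / (1 - β) := by field_simp; ring
    linarith
  have hyM : y ^ M ≤ exp (1 + D * log (8 * C0)) * B ^ (D * (1 - β)) := by
    have h1 : y ≤ exp (1 - β) := by have := add_one_le_exp (1 - β); linarith
    have hB0 : 0 < B := by linarith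
    calc y ^ M ≤ exp (1 - β) ^ M := by gcongr
      _ = exp ((1 - β) * M) := by rw [← exp_nat_mul]; congr 1; ring
      _ ≤ exp (1 + D * log (8 * C0) + log B * (D * (1 - β))) := by
        apply exp_le_exp.mpr
        rw [log_mul (by positivity) (by positivity)] at hM2
        have h3 : 0 ≤ log (8 * C0) := log_nonneg (by linarith)
        have h4 : 0 ≤ D * log (8 * C0) := by positivity
        nlinarith
      _ = _ := by rw [exp_add, rpow_def_of_pos hB0]
  rw [div_eq_mul_inv, ← div_eq_mul_inv, le_div_iff₀ hb'] at hmain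
  have hE : 0 < exp (1 + D * log (8 * C0)) := exp_pos _
  have hBp : 0 < B ^ (D * (1 - β)) := by positivity
  rw [exp_neg, rpow_neg (by linarith)]
  have h6 : 1 / 2 * (1 - β) ≤ ‖lam‖ * (exp (1 + D * log (8 * C0)) * B ^ (D * (1 - β))) :=
    hmain.trans (by gcongr)
  calc _ = (1 / 2 * (1 - β)) / (exp (1 + D * log (8 * C0)) * B ^ (D * (1 - β))) := by field_simp
    _ ≤ _ := by rw [div_le_iff₀ (by positivity)]; exact h6

section
open scoped ComplexOrder

/-- complex log as arithmetic function -/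
noncomputable def bvLog : ArithmeticFunction ℂ := ⟨fun n => (log n : ℂ), by simp⟩
noncomputable def bvAF {q : ℕ} (χ : DirichletCharacter ℂ q) : ArithmeticFunction ℂ := toArithmeticFunction (fun n => χ (n : ZMod q))
noncomputable def bvLam {q : ℕ} (χ : DirichletCharacter ℂ q) : ArithmeticFunction ℂ :=
  ⟨fun n => χ (n : ZMod q) * (vonMangoldt n : ℂ), by simp⟩

lemma bvAF_apply {q : ℕ} (χ : DirichletCharacter ℂ q) {n : ℕ} (hn : n ≠ 0) : bvAF χ n = χ (n : ZMod q) := by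
  simp [bvAF, toArithmeticFunction, hn]

lemma bv_deriv_char {q : ℕ} (χ : DirichletCharacter ℂ q) : (bvAF χ).pmul bvLog = bvAF χ * bvLam χ := by
  ext n
  by_cases hn : n = 0
  · simp [hn]
  rw [pmul_apply, ArithmeticFunction.mul_apply, bvAF_apply χ hn]
  have h1 : ∀ p ∈ n.divisorsAntidiagonal, bvAF χ p.1 * bvLam χ p.2 = χ (n : ZMod q) * (vonMangoldt p.2 : ℂ) := by
    intro p hp
    rw [Nat.mem_divisorsAntidiagonal] at hp
    have h0 : p.1 ≠ 0 := by intro h; rw [h] at hp; simp at hp; omega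
    rw [bvAF_apply χ h0]
    simp only [bvLam, ArithmeticFunction.coe_mk]
    rw [← mul_assoc, ← map_mul, ← Nat.cast_mul, hp.1]
  rw [sum_congr rfl h1, ← mul_sum]
  congr 1
  rw [Nat.sum_divisorsAntidiagonal' (f := fun _ j => (vonMangoldt j : ℂ)), ← Complex.ofReal_sum, ArithmeticFunction.vonMangoldt_sum]
  rfl

lemma bv_deriv_mul {b₁ b₂ h₁ h₂ : ArithmeticFunction ℂ} (e₁ : b₁.pmul bvLog = b₁ * h₁) (e₂ : b₂.pmul bvLog = b₂ * h₂) :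
    (b₁ * b₂).pmul bvLog = (b₁ * b₂) * (h₁ + h₂) := by
  have : (b₁ * b₂).pmul bvLog = (b₁.pmul bvLog) * b₂ + b₁ * (b₂.pmul bvLog) := by
    ext n
    rw [pmul_apply, ArithmeticFunction.add_apply, ArithmeticFunction.mul_apply, ArithmeticFunction.mul_apply,
      ArithmeticFunction.mul_apply, sum_mul, ← sum_add_distrib]
    apply sum_congr rfl
    intro p hp
    rw [Nat.mem_divisorsAntidiagonal] at hp
    have h0 : p.1 ≠ 0 := by intro h; rw [h] at hp; simp at hp; exact hp.2 hp.1.symm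
    have h0' : p.2 ≠ 0 := by intro h; rw [h] at hp; simp at hp; exact hp.2 hp.1.symm
    rw [pmul_apply, pmul_apply, ← hp.1]
    have : bvLog (p.1 * p.2) = bvLog p.1 + bvLog p.2 := by
      simp only [bvLog, ArithmeticFunction.coe_mk]
      rw [Nat.cast_mul, log_mul (by exact_mod_cast h0) (by exact_mod_cast h0')]
      push_cast; rfl
    rw [this]; ring
  rw [this, e₁, e₂]; ring

lemma bv_coef_nonneg {b h : ArithmeticFunction ℂ} (e : b.pmul bvLog = b * h) (h1 : b 1 = 1) (hh : ∀ n, 0 ≤ h n) (hh1 : h 1 = 0) (n : ℕ) :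
    0 ≤ b n := by
  induction n using Nat.strong_induction_on with
  | _ n ih =>
    rcases Nat.lt_or_ge n 2 with hn | hn
    · interval_cases n
      · simp
      · simp [h1]
    · have h2 := congrArg (fun f => f n) e
      simp only [pmul_apply, ArithmeticFunction.mul_apply] at h2
      have h3 : 0 ≤ b n * bvLog n := by
        rw [h2]
        apply sum_nonneg
        intro p hp
        rw [Nat.mem_divisorsAntidiagonal] at hp
        by_cases hp1 : p.2 = 1
        · rw [hp1, hh1, mul_zero]
        · have h0 : p.1 ≠ 0 := by intro h; rw [h] at hp; simp at hp; omega
          have h0' : p.2 ≠ 0 := by intro h; rw [h] at hp; simp at hp; omega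
          have : p.1 < n := by
            rw [← hp.1]
            have : 2 ≤ p.2 := by omega
            nlinarith [Nat.pos_of_ne_zero h0]
          exact mul_nonneg (ih _ this) (hh _)
      have h4 : bvLog n = ((log n : ℝ) : ℂ) := rfl
      have h5 : 0 < log n := log_pos (by exact_mod_cast (by omega : 1 < n))
      rw [h4] at h3
      have h6 : b n = (b n * (log n : ℂ)) * ((log n)⁻¹ : ℝ) := by
        push_cast; rw [mul_assoc, mul_inv_cancel₀ (by exact_mod_cast h5.ne'), mul_one]
      rw [h6]
      exact mul_nonneg h3 (by exact_mod_cast (by positivity : 0 ≤ (log n)⁻¹))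

lemma bv_AF_summable {q : ℕ} [NeZero q] (χ : DirichletCharacter ℂ q) {s : ℂ} (hs : 1 < s.re) : LSeriesSummable (fun n => bvAF χ n) s :=
  (LSeriesSummable_congr _ fun {n} hn => (bvAF_apply χ hn)).mpr (χ.LSeriesSummable_of_one_lt_re hs)

lemma bv_AF_LSeries {q : ℕ} [NeZero q] (χ : DirichletCharacter ℂ q) {s : ℂ} (hs : 1 < s.re) : LSeries (fun n => bvAF χ n) s = χ.LFunction s := by
  rw [LFunction_eq_LSeries _ hs]
  exact LSeries_congr (fun {n} hn => bvAF_apply χ hn) s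

lemma bvAF_one {q : ℕ} (χ : DirichletCharacter ℂ q) : bvAF χ 1 = 1 := by
  rw [bvAF_apply χ one_ne_zero]; simp

lemma bv_real_val {q : ℕ} {χ : DirichletCharacter ℂ q} (h : χ ^ 2 = 1) (a : ZMod q) : χ a = 0 ∨ χ a = 1 ∨ χ a = -1 := by
  by_cases ha : IsUnit a
  · right
    have h1 : (χ ^ 2) a = 1 := by rw [h]; exact MulChar.one_apply ha
    rw [MulChar.pow_apply' _ two_ne_zero] at h1
    exact sq_eq_one_iff.mp h1
  · left; exact χ.map_nonunit ha

lemma bv_changeLevel_mul {q₁ q₂ : ℕ} (χ₁ : DirichletCharacter ℂ q₁) (χ₂ : DirichletCharacter ℂ q₂) (n : ℕ) :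
    (changeLevel (Nat.dvd_mul_right q₁ q₂) χ₁ * changeLevel (Nat.dvd_mul_left q₂ q₁) χ₂) (n : ZMod (q₁ * q₂))
      = χ₁ (n : ZMod q₁) * χ₂ (n : ZMod q₂) := by
  by_cases hn : n.Coprime (q₁ * q₂)
  · rw [MulChar.mul_apply]
    have hc : IsCoprime (n : ℤ) ((q₁ * q₂ : ℕ) : ℤ) := Nat.isCoprime_iff_coprime.mpr hn
    have h1 := changeLevel_eq_cast_of_dvd' χ₁ (Nat.dvd_mul_right q₁ q₂) hc
    have h2 := changeLevel_eq_cast_of_dvd' χ₂ (Nat.dvd_mul_left q₂ q₁) hc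
    simp only [Int.cast_natCast] at h1 h2
    rw [h1, h2]
  · have h0 : ¬ IsUnit (n : ZMod (q₁ * q₂)) := by rwa [ZMod.isUnit_iff_coprime]
    rw [MulChar.map_nonunit _ h0]
    rw [Nat.coprime_mul_iff_right, not_and_or] at hn
    rcases hn with hn | hn
    · rw [MulChar.map_nonunit χ₁ (by rwa [ZMod.isUnit_iff_coprime]), zero_mul]
    · rw [MulChar.map_nonunit χ₂ (by rwa [ZMod.isUnit_iff_coprime]), mul_zero]
end

section
open scoped ComplexOrder ComplexConjugate

lemma bv_real_ext {f : ℂ → ℂ} (hf : Differentiable ℂ f) (h : ∀ σ : ℝ, 1 < σ → (f σ).im = 0) (σ : ℝ) : (f σ).im = 0 := by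
  have hg : Differentiable ℂ (conj ∘ f ∘ conj) := fun z => by
    have := (hf (conj z)).conj_conj
    simpa using this
  have e := AnalyticOnNhd.eq_of_frequently_eq (z₀ := (2:ℂ)) (fun z _ => hf.analyticAt z) (fun z _ => hg.analyticAt z) ?_
  · have := congrFun e σ
    simp only [Function.comp, conj_ofReal] at this
    exact Complex.conj_eq_iff_im.mp this.symm
  · have ht : Tendsto (fun r : ℝ => (r : ℂ)) (nhdsWithin 2 {2}ᶜ) (nhdsWithin (2 : ℂ) {2}ᶜ) := by
      refine tendsto_nhdsWithin_of_tendsto_nhds_of_eventually_within _ ?_ ?_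
      · have : Tendsto (fun r : ℝ => (r : ℂ)) (nhds 2) (nhds ((2:ℝ):ℂ)) := continuous_ofReal.tendsto _
        push_cast at this
        exact this.mono_left nhdsWithin_le_nhds
      · filter_upwards [self_mem_nhdsWithin] with r hr
        simp only [Set.mem_compl_iff, Set.mem_singleton_iff] at *
        exact_mod_cast hr
    refine ht.frequently (Eventually.frequently ?_)
    filter_upwards [mem_nhdsWithin_of_mem_nhds (Ioi_mem_nhds (by norm_num : (1:ℝ) < 2))] with r hr
    simp only [Function.comp, conj_ofReal]
    exact (Complex.conj_eq_iff_im.mpr (h r hr)).symm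

lemma bv_zeta_summable {s : ℂ} (hs : 1 < s.re) : LSeries (fun n => bvAF (1 : DirichletCharacter ℂ 1) n) s = riemannZeta s := by
  rw [bv_AF_LSeries _ hs, LFunction_modOne_eq]

lemma bv_real_le {q : ℕ} {χ : DirichletCharacter ℂ q} (h : χ ^ 2 = 1) (n : ZMod q) : 0 ≤ 1 + χ n := by
  rcases bv_real_val h n with h | h | h <;> rw [h] <;> norm_num

lemma bv_lam_nonneg (n : ℕ) : (0:ℂ) ≤ (vonMangoldt n : ℂ) := by
  exact_mod_cast vonMangoldt_nonneg

lemma bvLam_apply {q : ℕ} (χ : DirichletCharacter ℂ q) (n : ℕ) : bvLam χ n = χ (n : ZMod q) * (vonMangoldt n : ℂ) := rfl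

lemma bv_one_apply (n : ℕ) : (1 : DirichletCharacter ℂ 1) (n : ZMod 1) = 1 := by
  rw [Subsingleton.elim (n : ZMod 1) 1, map_one]

lemma bv_dir_nonneg {q : ℕ} {χ : DirichletCharacter ℂ q} (h : χ ^ 2 = 1) (n : ℕ) : 0 ≤ (bvAF (1 : DirichletCharacter ℂ 1) * bvAF χ) n := by
  refine bv_coef_nonneg (bv_deriv_mul (bv_deriv_char _) (bv_deriv_char χ)) ?_ ?_ ?_ n
  · rw [ArithmeticFunction.mul_apply]; simp [bvAF_one]
  · intro n
    simp only [ArithmeticFunction.add_apply, bvLam_apply, ← add_mul, bv_one_apply]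
    exact mul_nonneg (bv_real_le h _) (bv_lam_nonneg n)
  · simp [bvLam_apply]

lemma bv_dir4_nonneg {q₁ q₂ : ℕ} {χ₁ : DirichletCharacter ℂ q₁} {χ₂ : DirichletCharacter ℂ q₂} {χ₃ : DirichletCharacter ℂ (q₁ * q₂)} (h₁ : χ₁ ^ 2 = 1) (h₂ : χ₂ ^ 2 = 1)
    (h₃ : ∀ n : ℕ, χ₃ (n : ZMod (q₁ * q₂)) = χ₁ (n : ZMod q₁) * χ₂ (n : ZMod q₂)) (n : ℕ) : 0 ≤ (bvAF (1 : DirichletCharacter ℂ 1) * bvAF χ₁ * (bvAF χ₂ * bvAF χ₃)) n := by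
  refine bv_coef_nonneg (bv_deriv_mul (bv_deriv_mul (bv_deriv_char _) (bv_deriv_char χ₁)) (bv_deriv_mul (bv_deriv_char χ₂) (bv_deriv_char χ₃))) ?_ ?_ ?_ n
  · simp [ArithmeticFunction.mul_apply, bvAF_one]
  · intro n
    simp only [ArithmeticFunction.add_apply, bvLam_apply, ← add_mul, bv_one_apply, h₃]
    refine mul_nonneg ?_ (bv_lam_nonneg n)
    have := mul_nonneg (bv_real_le h₁ n) (bv_real_le h₂ n)
    convert this using 1
    ring
  · simp [bvLam_apply]

lemma bv_case_one : ∃ κ₀ : ℝ, κ₀ < 1 ∧ ∀ κ : ℝ, κ₀ ≤ κ → κ < 1 → ∀ (q : ℕ) [NeZero q] (χ : DirichletCharacter ℂ q), χ ^ 2 = 1 → χ ≠ 1 →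
    (∃ β : ℝ, κ ≤ β ∧ β < 1 ∧ χ.LFunction β = 0) ∨ (riemannZeta κ * χ.LFunction κ).re ≤ 0 := by
  have hev : ∀ᶠ σ : ℝ in nhds 1, bvZ σ ≠ 0 := by
    have hc : Continuous fun σ : ℝ => bvZ σ := bvZ_diff.continuous.comp continuous_ofReal
    exact hc.continuousAt.eventually_ne (by simp [bvZ_one])
  obtain ⟨δ, hδ, hball⟩ := Metric.eventually_nhds_iff.mp hev
  refine ⟨1 - δ / 2, by linarith, ?_⟩
  intro κ hκ hκ1 q _ χ h2 hχ
  have hFd : Differentiable ℂ (fun s => bvZ s * χ.LFunction s) := bvZ_diff.mul (differentiable_LFunction hχ)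
  have hpos : ∀ σ : ℝ, 1 < σ → 0 < riemannZeta σ * χ.LFunction σ := by
    intro σ hσ
    have hs : 1 < (σ : ℂ).re := by simpa
    have h1 := ArithmeticFunction.LSeries_mul' (bv_AF_summable (1 : DirichletCharacter ℂ 1) hs) (bv_AF_summable χ hs)
    rw [bv_zeta_summable hs, bv_AF_LSeries χ hs] at h1
    rw [← h1]
    refine LSeries.positive (fun n => bv_dir_nonneg h2 n) ?_ ?_
    · rw [ArithmeticFunction.mul_apply]; simp [bvAF_one]
    · refine lt_of_le_of_lt (LSeries.abscissaOfAbsConv_le_of_forall_lt_LSeriesSummable (x := 1) ?_) (by exact_mod_cast hσ)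
      intro y hy
      have hs : 1 < (y : ℂ).re := by simpa
      exact ArithmeticFunction.LSeriesSummable_mul (bv_AF_summable (1 : DirichletCharacter ℂ 1) hs) (bv_AF_summable χ hs)
  have hF : ∀ σ : ℝ, σ ≠ 1 → bvZ σ * χ.LFunction σ = ((σ - 1 : ℝ) : ℂ) * (riemannZeta σ * χ.LFunction σ) := by
    intro σ hσ
    rw [bvZ_ne (by exact_mod_cast hσ)]; push_cast; ring
  have hreal := bv_real_ext hFd (fun σ hσ => by
    have := (Complex.pos_iff.mp (hpos σ hσ))
    rw [hF σ hσ.ne', Complex.im_ofReal_mul, ← this.2, mul_zero])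
  by_cases hz : 0 ≤ (bvZ κ * χ.LFunction κ).re
  · right
    rw [hF κ hκ1.ne, re_ofReal_mul] at hz
    by_contra hc
    push Not at hc
    nlinarith
  · left
    push Not at hz
    have h2p : 0 < (bvZ (2:ℝ) * χ.LFunction (2:ℝ)).re := by
      rw [hF 2 (by norm_num), re_ofReal_mul]
      have := (Complex.pos_iff.mp (hpos 2 (by norm_num))).1
      nlinarith
    have hcont : Continuous fun σ : ℝ => (bvZ σ * χ.LFunction σ).re := continuous_re.comp (hFd.continuous.comp continuous_ofReal)
    obtain ⟨β, ⟨hβ1, hβ2⟩, hβ⟩ := intermediate_value_Icc (by linarith : κ ≤ 2) hcont.continuousOn ⟨hz.le, h2p.le⟩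
    have h0 : bvZ β * χ.LFunction β = 0 := Complex.ext hβ (hreal β)
    rcases lt_trichotomy β 1 with h | h | h
    · refine ⟨β, hβ1, h, ?_⟩
      have : bvZ β ≠ 0 := hball (by rw [dist_eq, abs_lt]; constructor <;> linarith)
      exact (mul_eq_zero.mp h0).resolve_left this
    · exfalso
      rw [h, Complex.ofReal_one, bvZ_one, one_mul] at h0
      exact DirichletCharacter.LFunction_apply_one_ne_zero hχ h0
    · exfalso
      rw [hF β h.ne'] at h0
      have h1 : ((β - 1 : ℝ) : ℂ) ≠ 0 := by exact_mod_cast (by linarith : β - 1 ≠ 0)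
      exact (hpos β h).ne' ((mul_eq_zero.mp h0).resolve_left h1)
end

section
open scoped ComplexOrder

lemma bv_ball {z : ℂ} (hz : ‖z - 2‖ ≤ 3 / 2) : 1 / 2 ≤ z.re ∧ ‖z‖ ≤ 7 / 2 := by
  have h1 := (abs_le.mp ((abs_re_le_norm (z - 2)).trans hz)).1
  have h2 : ‖z‖ ≤ ‖z - 2‖ + ‖(2:ℂ)‖ := by simpa using norm_add_le (z - 2) 2
  simp at h1 h2
  constructor <;> linarith

lemma bv_ls_mul {f g : ArithmeticFunction ℂ} {F G : ℂ → ℂ} (hf : ∀ s : ℂ, 1 < s.re → LSeriesSummable (fun n => f n) s ∧ LSeries (fun n => f n) s = F s)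
    (hg : ∀ s : ℂ, 1 < s.re → LSeriesSummable (fun n => g n) s ∧ LSeries (fun n => g n) s = G s) (s : ℂ) (hs : 1 < s.re) :
    LSeriesSummable (fun n => (f * g) n) s ∧ LSeries (fun n => (f * g) n) s = F s * G s :=
  ⟨ArithmeticFunction.LSeriesSummable_mul (hf s hs).1 (hg s hs).1, by
    rw [ArithmeticFunction.LSeries_mul' (hf s hs).1 (hg s hs).1, (hf s hs).2, (hg s hs).2]⟩

lemma bv_ls_char {q : ℕ} [NeZero q] (χ : DirichletCharacter ℂ q) (s : ℂ) (hs : 1 < s.re) :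
    LSeriesSummable (fun n => bvAF χ n) s ∧ LSeries (fun n => bvAF χ n) s = χ.LFunction s := ⟨bv_AF_summable χ hs, bv_AF_LSeries χ hs⟩

lemma bv_ls_one (s : ℂ) (hs : 1 < s.re) :
    LSeriesSummable (fun n => bvAF (1 : DirichletCharacter ℂ 1) n) s ∧ LSeries (fun n => bvAF (1 : DirichletCharacter ℂ 1) n) s = riemannZeta s := ⟨bv_AF_summable _ hs, bv_zeta_summable hs⟩

lemma bv_siegel {ε : ℝ} (hε : 0 < ε) : ∃ c : ℝ, 0 < c ∧ ∀ (q : ℕ) [NeZero q] (χ : DirichletCharacter ℂ q), χ.IsPrimitive → χ ^ 2 = 1 → χ ≠ 1 →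
    c * (q : ℝ) ^ (-ε) ≤ ‖χ.LFunction 1‖ := by
  obtain ⟨c, hc, D, hD, hest⟩ := bv_estermann
  obtain ⟨κ₀, hκ₀, hcase⟩ := bv_case_one
  set κ : ℝ := max (max κ₀ (7 / 8)) (1 - ε / (4 * D)) with hκd
  have hκ1 : κ < 1 := by
    refine max_lt (max_lt hκ₀ (by norm_num)) ?_
    have : 0 < ε / (4 * D) := by positivity
    linarith
  have hκa : κ₀ ≤ κ := (le_max_left _ _).trans (le_max_left _ _)
  have hκb : 7 / 8 ≤ κ := (le_max_right _ _).trans (le_max_left _ _)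
  have hκc : ∀ β, κ ≤ β → D * (1 - β) ≤ ε / 4 := by
    intro β hβ
    have h1 : 1 - ε / (4 * D) ≤ β := (le_max_right _ _).trans hβ
    have h2 : D * (ε / (4 * D)) = ε / 4 := by field_simp
    nlinarith
  by_cases hz : ∃ (q : ℕ) (_ : NeZero q) (χ : DirichletCharacter ℂ q) (β : ℝ), χ.IsPrimitive ∧ χ ^ 2 = 1 ∧ χ ≠ 1 ∧ κ ≤ β ∧ β < 1 ∧ χ.LFunction β = 0
  · obtain ⟨q₁, _, χ₁, β, hp₁, h₁, hχ₁, hβ, hβ1, hL⟩ := hz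
    obtain ⟨M, hM, η, hη, hη4, -, hLb⟩ := bv_L_bounds (by linarith : 0 < ε / 4)
    obtain ⟨χ₀, -, hmin⟩ := Finset.exists_min_image (Finset.univ : Finset (DirichletCharacter ℂ q₁)) (fun χ => if χ = 1 then 1 else ‖χ.LFunction 1‖) ⟨1, mem_univ _⟩
    set c₀ : ℝ := (if χ₀ = 1 then 1 else ‖χ₀.LFunction 1‖) with hc₀
    have hc₀p : 0 < c₀ := by
      rw [hc₀]; split_ifs with h
      · norm_num
      · exact norm_pos_iff.mpr (DirichletCharacter.LFunction_apply_one_ne_zero h)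
    have hq₁ : (1:ℝ) ≤ q₁ := by exact_mod_cast Nat.pos_of_ne_zero (NeZero.ne q₁)
    set K : ℝ := 29 ^ 3 * (q₁:ℝ) ^ 2 with hK
    have hK1 : 1 ≤ K := by rw [hK]; nlinarith
    set c₁ : ℝ := c * (1 - β) * K ^ (-(ε / 4)) / (29 * q₁ * (M * (2 * q₁) ^ (ε / 4))) with hc₁
    have hc₁p : 0 < c₁ := by
      have : 0 < 1 - β := by linarith
      positivity
    refine ⟨min c₀ c₁, lt_min hc₀p hc₁p, ?_⟩
    intro q₂ _ χ₂ hp₂ h₂ hχ₂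
    have hq₂ : (1:ℝ) ≤ q₂ := by exact_mod_cast Nat.pos_of_ne_zero (NeZero.ne q₂)
    have hq₂e : (q₂:ℝ) ^ (-ε) ≤ 1 := rpow_le_one_of_one_le_of_nonpos hq₂ (by linarith)
    set χ₃ := changeLevel (Nat.dvd_mul_right q₁ q₂) χ₁ * changeLevel (Nat.dvd_mul_left q₂ q₁) χ₂ with hχ₃
    by_cases h3 : χ₃ = 1
    · have hinv : changeLevel (Nat.dvd_mul_left q₂ q₁) χ₂ = changeLevel (Nat.dvd_mul_right q₁ q₂) χ₁ := by
        have hsq : changeLevel (Nat.dvd_mul_right q₁ q₂) χ₁ * changeLevel (Nat.dvd_mul_right q₁ q₂) χ₁ = 1 := by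
          rw [← map_mul, ← sq, h₁, map_one]
        exact mul_left_cancel (h3.trans hsq.symm)
      have hqq : q₂ = q₁ := by
        have := congrArg DirichletCharacter.conductor hinv
        rw [DirichletCharacter.conductor_changeLevel, DirichletCharacter.conductor_changeLevel] at this
        rw [← hp₁, ← hp₂, this]
      subst hqq
      have := hmin χ₂ (mem_univ _)
      rw [if_neg hχ₂] at this
      calc _ ≤ min c₀ c₁ * 1 := by gcongr
        _ ≤ c₀ := by rw [mul_one]; exact min_le_left _ _
        _ ≤ _ := this
    · have hev := bv_changeLevel_mul χ₁ χ₂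
      rw [← hχ₃] at hev
      have hls := bv_ls_mul (bv_ls_mul bv_ls_one (bv_ls_char χ₁)) (bv_ls_mul (bv_ls_char χ₂) (bv_ls_char χ₃))
      have hB1 : 1 ≤ K * (q₂:ℝ) ^ 2 := by nlinarith
      have key := hest (fun s => χ₁.LFunction s * (χ₂.LFunction s * χ₃.LFunction s)) _ (K * (q₂:ℝ) ^ 2) β
        ((differentiable_LFunction hχ₁).mul ((differentiable_LFunction hχ₂).mul (differentiable_LFunction h3)))
        (fun n => bv_dir4_nonneg h₁ h₂ hev n) (by simp [ArithmeticFunction.mul_apply, bvAF_one]) (fun s hs => (hls s hs).1) (fun s hs => by rw [(hls s hs).2]; ring)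
        hB1 ?_ (hκb.trans hβ) hβ1 (by simp [hL])
      · simp only [norm_mul] at key
        have e1 : ‖χ₁.LFunction 1‖ ≤ 29 * q₁ := bv_L_crude hχ₁ (by norm_num) (by norm_num)
        have e3 : ‖χ₃.LFunction 1‖ ≤ M * (2 * q₁) ^ (ε / 4) * q₂ ^ (ε / 4) := by
          have := (hLb _ χ₃ 1 (by simp; linarith) (by norm_num) (Or.inl h3)).1
          refine this.trans (le_of_eq ?_)
          rw [mul_assoc, ← mul_rpow (by positivity) (by positivity)]
          simp; left; ring_nf
        have e4 : K ^ (-(ε / 4)) * (q₂:ℝ) ^ (-(ε / 2)) ≤ (K * (q₂:ℝ) ^ 2) ^ (-(D * (1 - β))) := by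
          have : (q₂:ℝ) ^ (-(ε / 2)) = ((q₂:ℝ) ^ 2) ^ (-(ε / 4)) := by
            rw [← rpow_natCast, ← rpow_mul (by positivity)]; congr 1; push_cast; ring
          rw [this, ← mul_rpow (by positivity) (by positivity)]
          exact rpow_le_rpow_of_exponent_le hB1 (by linarith [hκc β hβ])
        have e5 : c * (1 - β) * (K ^ (-(ε / 4)) * (q₂:ℝ) ^ (-(ε / 2))) ≤ 29 * q₁ * (‖χ₂.LFunction 1‖ * (M * (2 * q₁) ^ (ε / 4) * q₂ ^ (ε / 4))) := by
          have : 0 < 1 - β := by linarith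
          calc _ ≤ c * (1 - β) * (K * (q₂:ℝ) ^ 2) ^ (-(D * (1 - β))) := by gcongr
            _ ≤ _ := key
            _ ≤ _ := by gcongr
        have e6 : c₁ * (q₂:ℝ) ^ (-(ε / 2)) ≤ ‖χ₂.LFunction 1‖ * (q₂:ℝ) ^ (ε / 4) := by
          rw [hc₁, div_mul_eq_mul_div, div_le_iff₀ (by positivity)]
          nlinarith
        have e7 : (q₂:ℝ) ^ (-ε) ≤ (q₂:ℝ) ^ (-(ε / 2)) * (q₂:ℝ) ^ (-(ε / 4)) := by
          rw [← rpow_add (by linarith)]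
          exact rpow_le_rpow_of_exponent_le hq₂ (by linarith)
        calc _ ≤ c₁ * ((q₂:ℝ) ^ (-(ε / 2)) * (q₂:ℝ) ^ (-(ε / 4))) := by gcongr; exact min_le_right _ _
          _ = c₁ * (q₂:ℝ) ^ (-(ε / 2)) * (q₂:ℝ) ^ (-(ε / 4)) := by ring
          _ ≤ ‖χ₂.LFunction 1‖ * (q₂:ℝ) ^ (ε / 4) * (q₂:ℝ) ^ (-(ε / 4)) := by gcongr
          _ = _ := by rw [mul_assoc, ← rpow_add (by linarith)]; simp
      · intro z hz
        obtain ⟨ha, hb⟩ := bv_ball hz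
        have e1 := bv_L_crude hχ₁ ha hb
        have e2 := bv_L_crude hχ₂ ha hb
        have e3 := bv_L_crude h3 ha hb
        rw [norm_mul, norm_mul]
        calc _ ≤ 29 * (q₁:ℝ) * (29 * q₂ * (29 * (q₁ * q₂ : ℕ))) := by gcongr
          _ = _ := by rw [hK]; push_cast; ring
  · push Not at hz
    refine ⟨c * (1 - κ) * 29 ^ (-ε), by have : 0 < 1 - κ := by linarith
                                        positivity, ?_⟩
    intro q hq χ hp h2 hχ
    have hq1 : (1:ℝ) ≤ q := by exact_mod_cast Nat.pos_of_ne_zero (NeZero.ne q)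
    have hneg := (hcase κ hκa hκ1 q χ h2 hχ).resolve_left (by
      rintro ⟨β, h1, h2', h3⟩
      exact hz q hq χ β hp h2 hχ h1 h2' h3)
    have hls := bv_ls_mul bv_ls_one (bv_ls_char χ)
    have hB1 : 1 ≤ 29 * (q:ℝ) := by linarith
    have key := hest χ.LFunction _ (29 * q) κ (differentiable_LFunction hχ) (fun n => bv_dir_nonneg h2 n)
      (by simp [ArithmeticFunction.mul_apply, bvAF_one]) (fun s hs => (hls s hs).1) (fun s hs => (hls s hs).2) hB1
      (fun z hz => bv_L_crude hχ (bv_ball hz).1 (bv_ball hz).2) hκb hκ1 hneg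
    refine le_trans ?_ key
    rw [mul_assoc, ← mul_rpow (by norm_num) (by linarith)]
    have : 0 < 1 - κ := by linarith
    gcongr
    linarith [hκc κ le_rfl]
end

lemma bv_341 {q : ℕ} [NeZero q] (χ : DirichletCharacter ℂ q) {d y M W t : ℝ} (hd : 0 < d) (hy : 0 < y) (hyd : y ^ 4 ≤ d) (hM : 1 ≤ M) (hW : 1 ≤ W)
    (h0 : ‖LFunctionTrivChar q (1 + d)‖ ≤ 2 * M / d) (h2 : ‖(χ ^ 2).LFunction (1 + d + 2 * I * t)‖ ≤ W) :
    y ^ 3 / (2 * M * W) ≤ ‖χ.LFunction (1 + d + I * t)‖ := by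
  have h := χ.norm_LFunction_product_ge_one hd t
  rw [norm_mul, norm_mul, norm_pow, norm_pow] at h
  by_contra hc
  push Not at hc
  set a := ‖χ.LFunction (1 + d + I * t)‖
  have ha : 0 ≤ a := norm_nonneg _
  have h4 : a ^ 4 ≤ (y ^ 3 / (2 * M * W)) ^ 4 := by gcongr
  have h5 : (1:ℝ) ≤ (2 * M / d) ^ 3 * (y ^ 3 / (2 * M * W)) ^ 4 * W := h.trans (by gcongr)
  have e : (2 * M / d) ^ 3 * (y ^ 3 / (2 * M * W)) ^ 4 * W = (y ^ 4 / d) ^ 3 * (1 / (2 * (M * W ^ 3))) := by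
    field_simp
  have h6 : (y ^ 4 / d) ^ 3 ≤ 1 := pow_le_one₀ (by positivity) (by rw [div_le_one hd]; exact hyd)
  have h7 : 1 / (2 * (M * W ^ 3)) ≤ 1 / 2 := by
    have : 1 ≤ M * W ^ 3 := one_le_mul_of_one_le_of_one_le hM (one_le_pow₀ hW)
    apply one_div_le_one_div_of_le <;> linarith
  rw [e] at h5
  have h8 : (y ^ 4 / d) ^ 3 * (1 / (2 * (M * W ^ 3))) ≤ 1 * (1 / 2) := by gcongr
  linarith

lemma bv_mv {f : ℂ → ℂ} {a b c d C : ℝ} (hf : ∀ z : ℂ, a ≤ z.re → z.re ≤ b → c ≤ z.im → z.im ≤ d → DifferentiableAt ℂ f z ∧ ‖deriv f z‖ ≤ C)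
    {x y : ℂ} (hx : a ≤ x.re ∧ x.re ≤ b ∧ c ≤ x.im ∧ x.im ≤ d) (hy : a ≤ y.re ∧ y.re ≤ b ∧ c ≤ y.im ∧ y.im ≤ d) : ‖f y - f x‖ ≤ C * ‖y - x‖ := by
  refine Convex.norm_image_sub_le_of_norm_deriv_le (s := {z : ℂ | (a ≤ z.re ∧ z.re ≤ b) ∧ (c ≤ z.im ∧ z.im ≤ d)}) ?_ ?_ ?_ ⟨⟨hx.1, hx.2.1⟩, hx.2.2⟩ ⟨⟨hy.1, hy.2.1⟩, hy.2.2⟩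
  · exact fun z hz => (hf z hz.1.1 hz.1.2 hz.2.1 hz.2.2).1
  · exact fun z hz => (hf z hz.1.1 hz.1.2 hz.2.1 hz.2.2).2
  · exact ((convex_Icc a b).linear_preimage Complex.reLm).inter ((convex_Icc c d).linear_preimage Complex.imLm)

set_option maxHeartbeats 2000000 in
/-- zero-free region -/
lemma bv_zf {ε : ℝ} (hε : 0 < ε) : ∃ d₀ : ℝ, 0 < d₀ ∧ d₀ ≤ 1 / 4 ∧ ∀ (q : ℕ) [NeZero q] (χ : DirichletCharacter ℂ q) (s : ℂ), χ.IsPrimitive → (χ ≠ 1 ∨ 1 ≤ |s.im|) →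
    1 - d₀ * (q * (|s.im| + 2)) ^ (-ε) ≤ s.re → s.re ≤ 2 →
    d₀ * (q * (|s.im| + 2)) ^ (-ε) ≤ ‖χ.LFunction s‖ ∧ ‖deriv χ.LFunction s‖ ≤ (q * (|s.im| + 2)) ^ ε / d₀ := by
  set e := min (ε / 20) 1 with he
  have he0 : 0 < e := lt_min (by positivity) one_pos
  have he1 : e ≤ 1 := min_le_right _ _
  have he20 : 20 * e ≤ ε := by have := min_le_left (ε / 20) 1; linarith
  obtain ⟨M₀, hM₀, η, hη, hη4, hL1, hL2⟩ := bv_L_bounds he0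
  obtain ⟨c', hc', hS⟩ := bv_siegel he0
  set c := min c' η with hc
  have hc0 : 0 < c := lt_min hc' hη
  have hcη : c ≤ η := min_le_right _ _
  have hcc : c ≤ c' := min_le_left _ _
  set d₀ := (c / (256 * M₀ ^ 4)) ^ 4 with hd₀
  have hr0 : 0 < c / (256 * M₀ ^ 4) := by positivity
  have hM4 : 1 ≤ M₀ ^ 4 := one_le_pow₀ hM₀
  have hr1 : c / (256 * M₀ ^ 4) ≤ 1 / 4 := by rw [div_le_iff₀ (by positivity)]; nlinarith
  have hd₀0 : 0 < d₀ := by positivity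
  have hd₀M : d₀ ≤ 1 / M₀ := by
    calc d₀ ≤ (c / (256 * M₀ ^ 4)) ^ 1 := pow_le_pow_of_le_one hr0.le (by linarith) (by norm_num)
      _ ≤ 1 / M₀ := by
        rw [pow_one, div_le_div_iff₀ (by positivity) (by positivity)]
        nlinarith [pow_le_pow_right₀ hM₀ (by norm_num : 1 ≤ 4)]
  have hd₀4 : d₀ ≤ 1 / 4 := by
    calc d₀ ≤ (c / (256 * M₀ ^ 4)) ^ 1 := pow_le_pow_of_le_one hr0.le (by linarith) (by norm_num)
      _ ≤ 1 / 4 := by rw [pow_one]; exact hr1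
  refine ⟨d₀, hd₀0, hd₀4, ?_⟩
  intro q _ χ s hp hcond hs1 hs2
  have hq : (1 : ℝ) ≤ q := by exact_mod_cast Nat.pos_of_ne_zero (NeZero.ne q)
  set t := s.im with ht
  set X := (q:ℝ) * (|t| + 2) with hX
  have ht0 := abs_nonneg t
  have hqX : (q:ℝ) ≤ X := le_mul_of_one_le_right (by linarith) (by linarith)
  have hX1 : 1 ≤ X := hq.trans hqX
  set M := M₀ * X ^ e with hM
  have hXe : 1 ≤ X ^ e := one_le_rpow hX1 he0.le
  have hM1 : 1 ≤ M := one_le_mul_of_one_le_of_one_le hM₀ hXe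
  set Y := (q:ℝ) ^ e with hY
  have hY1 : 1 ≤ Y := one_le_rpow hq he0.le
  have hYX : Y ≤ X ^ e := rpow_le_rpow (by linarith) hqX he0.le
  set w := c / (8 * M * Y) with hw
  have hw0 : 0 < w := by positivity
  have hwη : w ≤ η / 8 := by
    rw [hw, div_le_iff₀ (by positivity)]
    have := mul_le_mul_of_nonneg_left (one_le_mul_of_one_le_of_one_le hM1 hY1) hη.le
    linarith
  set W := 4 * M / w with hW
  have hW1 : 1 ≤ W := by rw [hW, le_div_iff₀ hw0]; linarith
  set y := 1 / (8 * M ^ 2 * W) with hy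
  have hy0 : 0 < y := by positivity
  have hye : y = c / (256 * M ^ 4 * Y) := by rw [hy, hW, hw]; field_simp; norm_num
  have hyw : y ≤ w := by
    rw [hye, hw, div_le_div_iff₀ (by positivity) (by positivity)]
    have h1 : M ≤ M ^ 4 := by simpa using pow_le_pow_right₀ hM1 (by norm_num : 1 ≤ 4)
    have h2 : 8 * M * Y ≤ 256 * M ^ 4 * Y := mul_le_mul_of_nonneg_right (by linarith) (by linarith)
    exact mul_le_mul_of_nonneg_left h2 hc0.le
  have hy4 : y ^ 4 ≤ y := by
    have : y ^ 4 ≤ y ^ 1 := pow_le_pow_of_le_one hy0.le (by linarith) (by norm_num)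
    simpa using this
  have hlow : d₀ * X ^ (-ε) ≤ y ^ 4 := by
    have h1 : (M₀ ^ 4) * (X ^ e) ^ 5 ≥ M ^ 4 * Y := by
      rw [hM];
      calc (M₀ * X ^ e) ^ 4 * Y ≤ (M₀ * X ^ e) ^ 4 * X ^ e := by gcongr
        _ = _ := by ring
    have h2 : c / (256 * M₀ ^ 4) * ((X ^ e) ^ 5)⁻¹ ≤ y := by
      rw [hye, ← div_eq_mul_inv, div_div]
      apply div_le_div_of_nonneg_left hc0.le (by positivity)
      linarith
    have h3 : X ^ (-ε) ≤ (((X ^ e) ^ 5)⁻¹) ^ 4 := by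
      rw [inv_pow, ← pow_mul, ← rpow_natCast, ← rpow_mul (by linarith), ← rpow_neg (by linarith)]
      apply rpow_le_rpow_of_exponent_le hX1
      push_cast; linarith
    calc d₀ * X ^ (-ε) ≤ d₀ * (((X ^ e) ^ 5)⁻¹) ^ 4 := by gcongr
      _ = (c / (256 * M₀ ^ 4) * ((X ^ e) ^ 5)⁻¹) ^ 4 := by rw [hd₀]; ring
      _ ≤ y ^ 4 := by gcongr
  have hση : 1 - η ≤ s.re := by linarith
  clear_value y W w Y M X d₀ c e
  have hder : ∀ z : ℂ, 1 - η ≤ z.re → z.re ≤ 2 → |z.im| ≤ |t| → (χ ≠ 1 ∨ 1 ≤ |z.im|) → DifferentiableAt ℂ χ.LFunction z ∧ ‖deriv χ.LFunction z‖ ≤ M := by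
    intro z h1 h2 h3 h4
    refine ⟨DirichletCharacter.differentiableAt_LFunction χ z ?_, ?_⟩
    · rcases h4 with h4 | h4
      · exact Or.inr h4
      · left; rintro rfl; norm_num at h4
    · refine (hL2 q χ z h1 h2 h4).2.trans ?_
      rw [hM, hX]; gcongr
  have hXd : X ^ e ≤ X ^ ε := rpow_le_rpow_of_exponent_le hX1 (by linarith)
  refine ⟨hlow.trans ?_, (hder s hση hs2 le_rfl hcond).2.trans ?_⟩
  swap
  · rw [le_div_iff₀ hd₀0]
    calc M * d₀ ≤ M₀ * X ^ e * (1 / M₀) := by rw [hM]; gcongr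
      _ = X ^ e := by field_simp
      _ ≤ _ := hXd
  have hyb : y ^ 4 ≤ y ^ 3 / (4 * M * W) := by
    rw [pow_succ, div_eq_mul_one_div]
    gcongr
    rw [hy]
    apply one_div_le_one_div_of_le (by positivity)
    have : M ≤ M ^ 2 := le_self_pow₀ hM1 two_ne_zero
    gcongr
    · norm_num
  have hyb2 : y ^ 3 / (4 * M * W) ≤ y ^ 3 / (2 * M * W) := by gcongr; norm_num
  have h0 : ∀ d : ℝ, 0 < d → d ≤ 1 → ‖LFunctionTrivChar q (1 + d)‖ ≤ 2 * M / d := by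
    intro d hd hd1
    have := hL1 q (1 : DirichletCharacter ℂ q) (1 + d) (by simp; linarith) (by simp; linarith) (by simp [hd.ne'])
    refine this.trans ?_
    have e1 : (1 + (d:ℂ)).im = 0 := by simp
    have e2 : ‖(1 + (d:ℂ)) - 1‖ = d := by simp [abs_of_pos hd]
    rw [e1, e2, abs_zero]
    have e3 : 1 + 1 / d ≤ 2 / d := by rw [le_div_iff₀ hd]; field_simp; linarith
    calc _ ≤ M * (2 / d) := by rw [hM, hX]; gcongr
      _ = _ := by ring
  have hX2 : (q * (|2 * t| + 2) : ℝ) ^ e ≤ 2 * X ^ e := by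
    calc (q * (|2 * t| + 2) : ℝ) ^ e ≤ (2 * X) ^ e := by
          apply rpow_le_rpow (by positivity) _ he0.le
          rw [hX, abs_mul, abs_two]; linarith
      _ = 2 ^ e * X ^ e := mul_rpow (by norm_num) (by linarith)
      _ ≤ 2 * X ^ e := by
        gcongr
        calc (2:ℝ) ^ e ≤ 2 ^ (1:ℝ) := rpow_le_rpow_of_exponent_le (by norm_num) he1
          _ = 2 := by norm_num
  have hw1 : w ≤ 1 := by linarith
  -- bound for L(chi^2)
  have h2 : ∀ d : ℝ, 0 < d → d ≤ 1 → (χ ^ 2 ≠ 1 ∨ w ≤ d ∨ w ≤ |t|) → ‖(χ ^ 2).LFunction (1 + d + 2 * I * t)‖ ≤ W := by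
    intro d hd hd1 h
    have er : (1 + (d:ℂ) + 2 * I * t).re = 1 + d := by simp
    have ei : (1 + (d:ℂ) + 2 * I * t).im = 2 * t := by simp
    by_cases hc2 : χ ^ 2 ≠ 1
    · have := (hL2 q (χ ^ 2) (1 + d + 2 * I * t) (by rw [er]; linarith) (by rw [er]; linarith) (Or.inl hc2)).1
      rw [ei] at this
      calc _ ≤ _ := this
        _ ≤ M₀ * (2 * X ^ e) := by gcongr
        _ = 2 * M := by rw [hM]; ring
        _ ≤ W := by rw [hW, le_div_iff₀ hw0]; linarith [mul_le_mul_of_nonneg_left hw1 (by linarith : 0 ≤ M)]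
    · have h := h.resolve_left hc2
      have hn : w ≤ ‖(1 + (d:ℂ) + 2 * I * t) - 1‖ := by
        rcases h with h | h
        · refine h.trans ?_
          have := abs_re_le_norm ((1 + (d:ℂ) + 2 * I * t) - 1)
          simp [abs_of_pos hd] at this
          simpa using this
        · have := abs_im_le_norm ((1 + (d:ℂ) + 2 * I * t) - 1)
          rw [sub_im, ei, Complex.one_im, sub_zero, abs_mul, abs_two] at this
          linarith
      have := hL1 q (χ ^ 2) (1 + d + 2 * I * t) (by rw [er]; linarith) (by rw [er]; linarith) (by
        intro h1; rw [h1] at er; simp at er; linarith)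
      rw [ei] at this
      calc _ ≤ _ := this
        _ ≤ M₀ * (2 * X ^ e) * (1 + 1 / w) := by gcongr
        _ = 2 * M * (1 + 1 / w) := by rw [hM]; ring
        _ ≤ 2 * M * (2 / w) := by
          gcongr
          rw [le_div_iff₀ hw0]; field_simp; linarith
        _ = W := by rw [hW]; ring
  have h341 : ∀ d : ℝ, y ^ 4 ≤ d → d ≤ 1 → (χ ^ 2 ≠ 1 ∨ w ≤ d ∨ w ≤ |t|) → y ^ 3 / (2 * M * W) ≤ ‖χ.LFunction (1 + d + I * t)‖ := by
    intro d hd hd1 h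
    have hd0 : 0 < d := lt_of_lt_of_le (by positivity) hd
    exact bv_341 χ hd0 hy0 hd hM1 hW1 (h0 d hd0 hd1) (h2 d hd0 hd1 h)
  have hsd : ∀ d : ℝ, d = s.re - 1 → (1 + (d:ℂ) + I * t) = s := by
    intro d hd; apply Complex.ext <;> simp [hd, ht]
  by_cases hA : χ ^ 2 ≠ 1 ∨ w ≤ |t|
  · by_cases hσ : 1 + y ^ 4 ≤ s.re
    · have := h341 (s.re - 1) (by linarith) (by linarith) (by tauto)
      rw [hsd _ rfl] at this
      linarith
    · push Not at hσ
      have h1 := h341 (y ^ 4) le_rfl (by linarith) (by tauto)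
      set z : ℂ := 1 + ((y ^ 4 : ℝ):ℂ) + I * t with hz
      have zr : z.re = 1 + y ^ 4 := by rw [hz, add_re, add_re, ofReal_re]; simp
      have zi : z.im = t := by rw [hz, Complex.add_im, Complex.add_im, ofReal_im]; simp
      have h3 := bv_mv (f := χ.LFunction) (a := 1 - η) (b := 2) (c := t) (d := t) (C := M) (fun z h1 h2 h3 h4 => by
        have h5 : z.im = t := le_antisymm h4 h3
        exact hder z h1 h2 (by rw [h5]) (by rw [h5]; exact hcond)) (x := z) (y := s) ⟨by linarith, by linarith, zi.ge, zi.le⟩ ⟨hση, hs2, ht.le, ht.ge⟩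
      have h4 : ‖s - z‖ ≤ 2 * y ^ 4 := by
        have : s - z = ((s.re - (1 + y ^ 4) : ℝ) : ℂ) := by
          apply Complex.ext
          · rw [sub_re, zr, ofReal_re]
          · rw [sub_im, zi, ofReal_im, ht, sub_self]
        rw [this, norm_real, norm_eq_abs, abs_le]
        constructor <;> linarith
      have h5 : ‖χ.LFunction z‖ ≤ ‖χ.LFunction s‖ + M * (2 * y ^ 4) := by
        have := norm_sub_norm_le (χ.LFunction z) (χ.LFunction s)
        rw [norm_sub_rev] at this
        have : M * ‖s - z‖ ≤ M * (2 * y ^ 4) := by gcongr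
        linarith
      have h6 : M * (2 * y ^ 4) ≤ y ^ 3 / (4 * M * W) := by
        have : M * (2 * y ^ 4) = y ^ 3 * (2 * M * y) := by ring
        rw [this, div_eq_mul_one_div]
        gcongr
        rw [hy]; apply le_of_eq; field_simp; norm_num
      have h7 : y ^ 3 / (2 * M * W) = 2 * (y ^ 3 / (4 * M * W)) := by field_simp; norm_num
      linarith
  · push Not at hA
    have hχ1 : χ ≠ 1 := by
      rcases hcond with h | h
      · exact h
      · linarith [hA.2]
    by_cases hσ : 1 + w ≤ s.re
    · have := h341 (s.re - 1) (by linarith) (by linarith) (by right; left; linarith)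
      rw [hsd _ rfl] at this
      linarith
    · push Not at hσ
      have h1 := hS q χ hp hA.1 hχ1
      have h3 := bv_mv (f := χ.LFunction) (a := 1 - η) (b := 2) (c := -|t|) (d := |t|) (C := M) (fun z h1 h2 h3 h4 => hder z h1 h2 (abs_le.mpr ⟨h3, h4⟩) (Or.inl hχ1))
        (x := 1) (y := s) ⟨by simp; linarith, by norm_num, by simp, by simp⟩ ⟨hση, hs2, neg_abs_le t, le_abs_self t⟩
      have h4 : ‖s - 1‖ ≤ 2 * w := by
        refine (Complex.norm_le_abs_re_add_abs_im _).trans ?_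
        have h5 : |(s - 1).re| ≤ w := by rw [sub_re, Complex.one_re, abs_le]; constructor <;> linarith
        have h6 : |(s - 1).im| ≤ w := by rw [sub_im, Complex.one_im, sub_zero]; exact hA.2.le
        linarith
      have h5 : ‖χ.LFunction 1‖ ≤ ‖χ.LFunction s‖ + M * (2 * w) := by
        have := norm_sub_norm_le (χ.LFunction 1) (χ.LFunction s)
        rw [norm_sub_rev] at this
        have : M * ‖s - 1‖ ≤ M * (2 * w) := by gcongr
        linarith
      have h6 : 8 * (M * w) ≤ ‖χ.LFunction 1‖ := by
        refine le_trans (le_of_eq ?_) (le_trans (mul_le_mul_of_nonneg_right hcc (by positivity)) h1)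
        rw [hw, rpow_neg (by linarith), ← hY]; field_simp
      have h7 : w ≤ M * w := le_mul_of_one_le_left hw0.le hM1
      linarith

lemma bv_tail_arctan {T : ℝ} (hT : 0 < T) : ∫ t in (Set.Ioc (-T) T)ᶜ, (1 + t ^ 2)⁻¹ ≤ 2 / T := by
  have h1 : (Set.Ioc (-T) T)ᶜ = Set.Iic (-T) ∪ Ioi T := by
    ext t; simp only [Set.mem_compl_iff, Set.mem_Ioc, Set.mem_union, Set.mem_Iic, Set.mem_Ioi, not_and_or, not_lt, not_le]
  rw [h1, MeasureTheory.setIntegral_union (Set.disjoint_left.mpr fun t h1 h2 => by simp only [Set.mem_Iic, Set.mem_Ioi] at h1 h2; linarith) measurableSet_Ioi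
    integrable_inv_one_add_sq.integrableOn integrable_inv_one_add_sq.integrableOn, integral_Iic_inv_one_add_sq, integral_Ioi_inv_one_add_sq, arctan_neg]
  have h2 := arctan_inv_of_pos hT
  have h3 : arctan T⁻¹ ≤ T⁻¹ := by
    have := le_tan (x := arctan T⁻¹) (arctan_nonneg.mpr (by positivity)) (arctan_lt_pi_div_two _)
    rwa [tan_arctan] at this
  have h4 : 2 / T = 2 * T⁻¹ := div_eq_mul_inv _ _
  linarith

lemma bv_shift {c : ℕ → ℂ} {G : ℂ → ℂ} {x a T K K₁ : ℝ} (hx : exp 1 ≤ x) (ha : 1 / 2 ≤ a) (ha1 : a ≤ 1) (hT : 1 ≤ T) (hK : 0 ≤ K) (hK₁ : 0 ≤ K₁)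
    (hc : ∀ σ : ℝ, 1 < σ → LSeriesSummable c σ) (hG : ∀ s : ℂ, 1 < s.re → LSeries c s = G s)
    (hb : ∀ s : ℂ, 1 < s.re → s.re ≤ 2 → ‖LSeries c s‖ ≤ K₁ / (s.re - 1))
    (hr : ∀ s : ℂ, a ≤ s.re → s.re ≤ 2 → |s.im| ≤ T → DifferentiableAt ℂ G s ∧ ‖G s‖ ≤ K) :
    ‖∑ n ∈ Icc 1 ⌊x⌋₊, c n * (log (x / n) : ℂ)‖ ≤ K₁ * log x * x * exp 1 / T + 2 * K * x ^ a + K * exp 1 * x / T := by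
  have hx0 : 0 < x := (exp_pos 1).trans_le hx
  have hx1 : 1 ≤ x := le_trans (by have := add_one_le_exp 1; linarith) hx
  have hL : 1 ≤ log x := by rwa [le_log_iff_exp_le hx0]
  set σ : ℝ := 1 + 1 / log x with hσ
  have hσ1 : 1 < σ := by rw [hσ]; have : 0 < 1 / log x := by positivity
                         linarith
  have hσ2 : σ ≤ 2 := by rw [hσ]; have : 1 / log x ≤ 1 := by rw [div_le_one (by linarith)]; exact hL
                         linarith
  have hxσ : x ^ σ = exp 1 * x := by
    rw [hσ, rpow_add hx0, rpow_one, rpow_def_of_pos hx0, mul_one_div_cancel (by linarith), mul_comm]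
  have hP := bv_perron_sum c (by linarith : 0 < σ) (hc σ hσ1) hx0
  set F : ℂ → ℂ := fun s => G s * (x : ℂ) ^ s * (1 / s ^ 2) with hF
  have hre : ∀ b t : ℝ, ((b : ℂ) + t * I).re = b := fun b t => by simp
  have him : ∀ b t : ℝ, ((b : ℂ) + t * I).im = t := fun b t => by simp
  have hFe : ∀ t : ℝ, LSeries c ((σ : ℂ) + t * I) * (x : ℂ) ^ ((σ : ℂ) + t * I) * (1 / ((σ : ℂ) + t * I) ^ 2) = F (σ + t * I) := by
    intro t; rw [hG _ (by rw [hre]; exact hσ1)]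
  simp only [hFe] at hP
  have hFn : ∀ b t k : ℝ, 1 / 2 ≤ b → ‖G (b + t * I)‖ ≤ k → ‖F (b + t * I)‖ ≤ k * x ^ b * (1 / (b ^ 2 + t ^ 2)) := by
    intro b t k hb hk
    rw [hF, norm_mul, norm_mul, bv_kernel_norm (by linarith), norm_cpow_eq_rpow_re_of_pos hx0, hre]
    gcongr
  have hF1 : ∀ t : ℝ, ‖F (σ + t * I)‖ ≤ K₁ * log x * (exp 1 * x) * (1 + t ^ 2)⁻¹ := by
    intro t
    have h1 := hb (σ + t * I) (by rw [hre]; exact hσ1) (by rw [hre]; exact hσ2)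
    rw [hG _ (by rw [hre]; exact hσ1), hre] at h1
    have h2 : K₁ / (σ - 1) = K₁ * log x := by rw [hσ]; field_simp; ring
    rw [h2] at h1
    refine (hFn σ t _ (by linarith) h1).trans ?_
    rw [hxσ, ← one_div]
    gcongr; nlinarith
  have hcont : Continuous fun t : ℝ => F (σ + t * I) := by
    have h1 : Continuous fun t : ℝ => LSeries c ((σ : ℂ) + t * I) := by
      rw [continuous_iff_continuousAt]
      intro t
      have h2 : LSeries.abscissaOfAbsConv c < ((((σ : ℂ) + t * I).re : ℝ) : EReal) := by
        rw [hre]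
        refine lt_of_le_of_lt (LSeries.abscissaOfAbsConv_le_of_forall_lt_LSeriesSummable (x := 1) hc) (by exact_mod_cast hσ1)
      exact ContinuousAt.comp (f := fun t : ℝ => (σ : ℂ) + t * I) (LSeries_analyticOnNhd c _ h2).continuousAt (by fun_prop)
    simp only [← hFe]
    refine (h1.mul ?_).mul ?_
    · exact Continuous.const_cpow (by fun_prop) (Or.inl (by exact_mod_cast hx0.ne'))
    · refine continuous_const.div (by fun_prop) fun t => pow_ne_zero 2 ?_
      intro h; have := hre σ t; rw [h] at this; simp at this; linarith
  have hint : Integrable fun t : ℝ => F (σ + t * I) :=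
    (integrable_inv_one_add_sq.const_mul _).mono' hcont.aestronglyMeasurable (Eventually.of_forall hF1)
  rw [← MeasureTheory.integral_add_compl (measurableSet_Ioc (a := -T) (b := T)) hint] at hP
  have htail : ‖∫ t in (Set.Ioc (-T) T)ᶜ, F (σ + t * I)‖ ≤ K₁ * log x * (exp 1 * x) * (2 / T) := by
    refine (MeasureTheory.norm_integral_le_of_norm_le (integrable_inv_one_add_sq.const_mul _).integrableOn (Eventually.of_forall hF1)).trans ?_
    rw [integral_const_mul]
    gcongr
    exact bv_tail_arctan (by linarith)
  have hrect := Complex.integral_boundary_rect_eq_zero_of_differentiableOn F (a + (-T : ℝ) * I) (σ + T * I) ?_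
  swap
  · intro s hs
    rw [hre, hre, him, him, Set.uIcc_of_le (by linarith), Set.uIcc_of_le (by linarith), mem_reProdIm] at hs
    have h1 := (hr s hs.1.1 (hs.1.2.trans hσ2) (abs_le.mpr hs.2)).1
    have hs0 : s ≠ 0 := by rintro rfl; have := hs.1.1; simp at this; linarith
    refine DifferentiableAt.differentiableWithinAt ((h1.mul ?_).mul ?_)
    · exact DifferentiableAt.const_cpow differentiableAt_id (Or.inl (by exact_mod_cast hx0.ne'))
    · exact (differentiableAt_const _).div (by fun_prop) (pow_ne_zero 2 hs0)
  rw [hre, hre, him, him] at hrect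
  have hhor : ∀ t : ℝ, |t| = T → ‖∫ u in a..σ, F (u + t * I)‖ ≤ K * (exp 1 * x) * (1 / T) * 2 := by
    intro t ht
    refine (intervalIntegral.norm_integral_le_of_norm_le_const (C := K * (exp 1 * x) * (1 / T)) ?_).trans ?_
    · intro u hu
      rw [Set.uIoc_of_le (by linarith)] at hu
      refine (hFn u t K (by linarith [hu.1]) (hr _ (by rw [hre]; exact hu.1.le) (by rw [hre]; linarith [hu.2]) (by rw [him, ht])).2).trans ?_
      have h1 : x ^ u ≤ exp 1 * x := by rw [← hxσ]; exact rpow_le_rpow_of_exponent_le hx1 hu.2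
      have h2 : T ≤ u ^ 2 + t ^ 2 := by rw [← sq_abs t, ht]; nlinarith [sq_nonneg u]
      gcongr
    · rw [abs_of_nonneg (by linarith)]
      gcongr; linarith
  have hver : ‖∫ t in (-T)..T, F (a + t * I)‖ ≤ K * x ^ a * 4 * π := by
    have h1 : ‖∫ t in (-T)..T, F (a + t * I)‖ ≤ ∫ t in (-T)..T, K * x ^ a * 4 * (1 + t ^ 2)⁻¹ := by
      refine intervalIntegral.norm_integral_le_of_norm_le (by linarith) (Eventually.of_forall fun t ht => ?_) ?_
      · refine (hFn a t K ha (hr _ (by rw [hre]) (by rw [hre]; linarith) (by rw [him]; exact abs_le.mpr ⟨ht.1.le, ht.2⟩)).2).trans ?_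
        rw [mul_assoc (K * x ^ a)]
        gcongr
        rw [← div_eq_mul_inv, div_le_div_iff₀ (by positivity) (by positivity)]
        nlinarith
      · exact (integrable_inv_one_add_sq.const_mul _).intervalIntegrable
    refine h1.trans ?_
    rw [intervalIntegral.integral_const_mul, integral_inv_one_add_sq]
    gcongr
    have := arctan_lt_pi_div_two T
    rw [arctan_neg]; linarith
  rw [← intervalIntegral.integral_of_le (by linarith)] at hP
  set I1 := ∫ t in (-T)..T, F (σ + t * I)
  set I2 := ∫ t in (-T)..T, F (a + t * I)
  have hn1 : ‖I1‖ ≤ K * (exp 1 * x) * (1 / T) * 4 + K * x ^ a * 4 * π := by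
    have e : I • I1 = I • I2 - (∫ u in a..σ, F (u + (-T : ℝ) * I)) + ∫ u in a..σ, F (u + T * I) := by
      linear_combination hrect
    have h1 : ‖I1‖ = ‖I • I1‖ := by rw [norm_smul, norm_I, one_mul]
    have h2 : ‖I2‖ = ‖I • I2‖ := by rw [norm_smul, norm_I, one_mul]
    rw [h1, e]
    have h3 := hhor (-T) (by rw [abs_neg, abs_of_pos (by linarith)])
    have h4 := hhor T (abs_of_pos (by linarith))
    refine (norm_add_le _ _).trans ?_
    have h5 := norm_sub_le (I • I2) (∫ u in a..σ, F (u + (-T : ℝ) * I))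
    rw [← h2] at h5
    linarith
  have hfin : 2 * π * ‖∑ n ∈ Icc 1 ⌊x⌋₊, c n * (log (x / n) : ℂ)‖ ≤ K * (exp 1 * x) * (1 / T) * 4 + K * x ^ a * 4 * π + K₁ * log x * (exp 1 * x) * (2 / T) := by
    have : ‖(2 * π : ℂ)‖ = 2 * π := by
      rw [norm_mul, norm_real, norm_of_nonneg pi_pos.le]; simp
    rw [← this, ← norm_mul, ← hP]
    refine (norm_add_le _ _).trans (add_le_add hn1 htail)
  have hpi := pi_gt_three
  set Z := ‖∑ n ∈ Icc 1 ⌊x⌋₊, c n * (log (x / n) : ℂ)‖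
  have p1 : 0 ≤ K * exp 1 * x / T := by positivity
  have p2 : 0 ≤ K₁ * log x * x * exp 1 / T := by positivity
  have e1 : K * (exp 1 * x) * (1 / T) * 4 = 4 * (K * exp 1 * x / T) := by ring
  have e2 : K₁ * log x * (exp 1 * x) * (2 / T) = 2 * (K₁ * log x * x * exp 1 / T) := by ring
  rw [e1, e2] at hfin
  refine le_of_mul_le_mul_left (hfin.trans ?_) (by positivity : 0 < 2 * π)
  nlinarith

lemma bv_Z_near : ∃ δ : ℝ, 0 < δ ∧ ∃ C : ℝ, 0 ≤ C ∧ ∀ s : ℂ, 1 - δ ≤ s.re → s.re ≤ 2 → |s.im| ≤ 1 →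
    bvZ s ≠ 0 ∧ ‖deriv bvZ s / bvZ s‖ ≤ C ∧ ‖dslope bvZ 1 s‖ ≤ C ∧ ‖bvZ s‖ ≤ C := by
  have hcZ := bvZ_diff.continuous
  have hsub : (Set.Icc (1:ℝ) 2 ×ℂ Set.Icc (-1:ℝ) 1) ⊆ {s | bvZ s ≠ 0} := by
    intro s hs
    rw [mem_reProdIm] at hs
    by_cases h1 : s = 1
    · simp [h1, bvZ_one]
    · simp only [Set.mem_setOf_eq]
      rw [bvZ_ne h1]
      exact mul_ne_zero (sub_ne_zero.mpr h1) (riemannZeta_ne_zero_of_one_le_re hs.1.1)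
  obtain ⟨δ, hδ, hth⟩ := (isCompact_Icc.reProdIm isCompact_Icc).exists_cthickening_subset_open (isOpen_ne_fun hcZ continuous_const) hsub
  have hnz : ∀ s : ℂ, 1 - δ ≤ s.re → s.re ≤ 2 → |s.im| ≤ 1 → bvZ s ≠ 0 := by
    intro s h1 h2 h3
    have h3 := abs_le.mp h3
    by_cases h4 : 1 ≤ s.re
    · exact hsub (mem_reProdIm.mpr ⟨⟨h4, h2⟩, h3⟩)
    · push Not at h4
      refine hth (Metric.mem_cthickening_of_dist_le s (1 + s.im * I) δ _ (mem_reProdIm.mpr (by simpa using h3)) ?_)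
      have e : s - (1 + s.im * I) = ((s.re - 1 : ℝ) : ℂ) := by apply Complex.ext <;> simp
      rw [dist_eq_norm, e, norm_real, norm_eq_abs, abs_le]
      constructor <;> linarith
  have hcomp : IsCompact (Set.Icc (1 - δ) 2 ×ℂ Set.Icc (-1:ℝ) 1) := isCompact_Icc.reProdIm isCompact_Icc
  have hmem : ∀ s : ℂ, s ∈ (Set.Icc (1 - δ) 2 ×ℂ Set.Icc (-1:ℝ) 1) ↔ (1 - δ ≤ s.re ∧ s.re ≤ 2) ∧ |s.im| ≤ 1 := by
    intro s; rw [mem_reProdIm, abs_le]; rfl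
  have hdc : Continuous (deriv bvZ) := (bvZ_diff.contDiff (n := 1)).continuous_deriv le_rfl
  have hds : Continuous (dslope bvZ 1) := by
    have := (differentiableOn_dslope (f := bvZ) (c := 1) (s := Set.univ) univ_mem).mpr bvZ_diff.differentiableOn
    exact (differentiableOn_univ.mp this).continuous
  obtain ⟨C1, h1⟩ := hcomp.exists_bound_of_continuousOn (f := fun s => deriv bvZ s / bvZ s) (hdc.continuousOn.div hcZ.continuousOn fun s hs => by
    rw [hmem] at hs; exact hnz s hs.1.1 hs.1.2 hs.2)
  obtain ⟨C2, h2⟩ := hcomp.exists_bound_of_continuousOn hds.continuousOn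
  obtain ⟨C3, h3⟩ := hcomp.exists_bound_of_continuousOn hcZ.continuousOn
  refine ⟨δ, hδ, |C1| + |C2| + |C3|, by positivity, fun s a b c => ⟨hnz s a b c, ?_, ?_, ?_⟩⟩
  · have := h1 s ((hmem s).mpr ⟨⟨a, b⟩, c⟩); have := le_abs_self C1; have := abs_nonneg C2; have := abs_nonneg C3; linarith
  · have := h2 s ((hmem s).mpr ⟨⟨a, b⟩, c⟩); have := le_abs_self C2; have := abs_nonneg C1; have := abs_nonneg C3; linarith
  · have := h3 s ((hmem s).mpr ⟨⟨a, b⟩, c⟩); have := le_abs_self C3; have := abs_nonneg C1; have := abs_nonneg C2; linarith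

lemma bv_Z_log {s : ℂ} (hs : s ≠ 1) (hz : riemannZeta s ≠ 0) :
    deriv bvZ s / bvZ s = 1 / (s - 1) + deriv riemannZeta s / riemannZeta s ∧ dslope bvZ 1 s = riemannZeta s - 1 / (s - 1) := by
  have hs' := sub_ne_zero.mpr hs
  have he : bvZ =ᶠ[nhds s] fun z => (z - 1) * riemannZeta z := by
    filter_upwards [isOpen_ne.mem_nhds hs] with z hz using bvZ_ne hz
  have hd : deriv bvZ s = riemannZeta s + (s - 1) * deriv riemannZeta s := by
    rw [he.deriv_eq, deriv_fun_mul (by fun_prop) (differentiableAt_riemannZeta hs)]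
    simp
  constructor
  · rw [hd, bvZ_ne hs]; field_simp
  · rw [dslope_of_ne _ hs, slope_def_field, bvZ_one, bvZ_ne hs]; field_simp

lemma bv_LSeries_dom {f : ℕ → ℂ} {g : ℕ → ℝ} (hg : ∀ n, 0 ≤ g n) (h : ∀ n, ‖f n‖ ≤ g n) {s : ℂ} (hs : LSeriesSummable (fun n => (g n : ℂ)) (s.re : ℂ)) :
    ‖LSeries f s‖ ≤ ‖LSeries (fun n => (g n : ℂ)) (s.re : ℂ)‖ := by
  have h1 : ∀ n, ‖LSeries.term f s n‖ ≤ ‖LSeries.term (fun n => (g n : ℂ)) (s.re : ℂ) n‖ := by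
    intro n
    rw [LSeries.norm_term_eq, LSeries.norm_term_eq]
    split_ifs
    · rfl
    · rw [ofReal_re, norm_real, norm_of_nonneg (hg n)]
      have := h n
      gcongr
  have h2 : ∀ n, LSeries.term (fun n => (g n : ℂ)) (s.re : ℂ) n = ((‖LSeries.term (fun n => (g n : ℂ)) (s.re : ℂ) n‖ : ℝ) : ℂ) := by
    intro n
    rw [LSeries.norm_term_eq, LSeries.term_def]
    split_ifs
    · simp
    · rw [ofReal_re, norm_real, norm_of_nonneg (hg n)]
      push_cast
      rw [Complex.ofReal_cpow (Nat.cast_nonneg n)]; simp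
  have h3 : LSeries (fun n => (g n : ℂ)) (s.re : ℂ) = ((∑' n, ‖LSeries.term (fun n => (g n : ℂ)) (s.re : ℂ) n‖ : ℝ) : ℂ) := by
    rw [LSeries, Complex.ofReal_tsum]
    exact tsum_congr h2
  rw [h3, norm_real, norm_of_nonneg (tsum_nonneg fun n => norm_nonneg _)]
  exact tsum_of_norm_bounded hs.norm.hasSum h1

lemma bv_K1 : ∃ K₁ : ℝ, 0 ≤ K₁ ∧ ∀ (f : ℕ → ℂ), (∀ n, ‖f n‖ ≤ vonMangoldt n + 1) → ∀ s : ℂ, 1 < s.re → s.re ≤ 2 → ‖LSeries f s‖ ≤ K₁ / (s.re - 1) := by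
  obtain ⟨δ, hδ, C, hC, h⟩ := bv_Z_near
  refine ⟨1 + 2 * C, by positivity, fun f hf s hs hs2 => ?_⟩
  have hs' : 1 < ((s.re : ℝ) : ℂ).re := by simpa
  have e : (fun n => ((vonMangoldt n + 1 : ℝ) : ℂ)) = (fun n => (vonMangoldt n : ℂ)) + 1 := by ext n; simp
  have hΛ := ArithmeticFunction.LSeriesSummable_vonMangoldt hs'
  have h1 := LSeriesSummable_one_iff.mpr hs'
  refine (bv_LSeries_dom (g := fun n => vonMangoldt n + 1) (fun n => by have := @vonMangoldt_nonneg n; positivity) hf (by rw [e]; exact hΛ.add h1)).trans ?_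
  rw [e, LSeries_add hΛ h1, ArithmeticFunction.LSeries_vonMangoldt_eq_deriv_riemannZeta_div hs', LSeries_one_eq_riemannZeta hs']
  have hne : ((s.re : ℝ) : ℂ) ≠ 1 := by intro hh; rw [hh] at hs'; simp at hs'
  have hz := riemannZeta_ne_zero_of_one_le_re hs'.le
  obtain ⟨-, b1, -, b2⟩ := h (s.re : ℂ) (by simp; linarith) (by simpa) (by simp)
  obtain ⟨e1, -⟩ := bv_Z_log hne hz
  have hsub : ((s.re : ℝ) : ℂ) - 1 = ((s.re - 1 : ℝ) : ℂ) := by push_cast; rfl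
  have hp : 0 < s.re - 1 := by linarith
  have e2 : -deriv riemannZeta (s.re : ℂ) / riemannZeta (s.re : ℂ) + riemannZeta (s.re : ℂ) = 1 / ((s.re - 1 : ℝ) : ℂ) - deriv bvZ (s.re : ℂ) / bvZ (s.re : ℂ) + bvZ (s.re : ℂ) / ((s.re - 1 : ℝ) : ℂ) := by
    rw [e1, bvZ_ne hne, ← hsub]
    have := sub_ne_zero.mpr hne
    field_simp; ring
  rw [e2]
  have n1 : ‖1 / ((s.re - 1 : ℝ) : ℂ)‖ = 1 / (s.re - 1) := by rw [norm_div, norm_one, norm_real, norm_of_nonneg hp.le]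
  have n2 : ‖bvZ (s.re : ℂ) / ((s.re - 1 : ℝ) : ℂ)‖ ≤ C / (s.re - 1) := by rw [norm_div, norm_real, norm_of_nonneg hp.le]; gcongr
  have n3 : C ≤ C / (s.re - 1) := by rw [le_div_iff₀ hp]; nlinarith
  have n4 : (1 + 2 * C) / (s.re - 1) = 1 / (s.re - 1) + C / (s.re - 1) + C / (s.re - 1) := by ring
  have := norm_add_le (1 / ((s.re - 1 : ℝ) : ℂ) - deriv bvZ (s.re : ℂ) / bvZ (s.re : ℂ)) (bvZ (s.re : ℂ) / ((s.re - 1 : ℝ) : ℂ))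
  have := norm_sub_le (1 / ((s.re - 1 : ℝ) : ℂ)) (deriv bvZ (s.re : ℂ) / bvZ (s.re : ℂ))
  linarith

lemma bv_sw_core {A K₁ K₂ d : ℝ} (hA : 0 < A) (hK₁ : 0 ≤ K₁) (hK₂ : 0 ≤ K₂) (hd : 0 < d) (hd1 : d ≤ 1 / 2) : ∃ C : ℝ, 0 ≤ C ∧ ∀ x : ℝ, exp 1 ≤ x → ∀ (c : ℕ → ℂ) (G : ℂ → ℂ),
    (∀ σ : ℝ, 1 < σ → LSeriesSummable c σ) → (∀ s : ℂ, 1 < s.re → LSeries c s = G s) →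
    (∀ s : ℂ, 1 < s.re → s.re ≤ 2 → ‖LSeries c s‖ ≤ K₁ / (s.re - 1)) →
    (∀ s : ℂ, 1 - d * (log x) ^ (-(1/2) : ℝ) ≤ s.re → s.re ≤ 2 → |s.im| ≤ (log x) ^ (A + 2) → DifferentiableAt ℂ G s ∧ ‖G s‖ ≤ K₂ * log x) →
    ‖∑ n ∈ Icc 1 ⌊x⌋₊, c n * (log (x / n) : ℂ)‖ ≤ C * x * (log x) ^ (-A) := by
  set n := ⌈2 * A + 2⌉₊ with hn
  have hn1 : 2 * A + 2 ≤ n := Nat.le_ceil _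
  refine ⟨K₁ * exp 1 + 2 * K₂ * (n.factorial / d ^ n) + K₂ * exp 1, by positivity, ?_⟩
  intro x hx c G hc hG hb hr
  have hx0 : 0 < x := (exp_pos 1).trans_le hx
  have hL : 1 ≤ log x := by rwa [le_log_iff_exp_le hx0]
  set L := log x with hLd
  have hL0 : 0 < L := by linarith
  have hLh : L ^ (-(1/2) : ℝ) ≤ 1 := rpow_le_one_of_one_le_of_nonpos hL (by norm_num)
  have hLh0 : 0 < L ^ (-(1/2) : ℝ) := by positivity
  refine (bv_shift (a := 1 - d * L ^ (-(1/2) : ℝ)) hx (by nlinarith) (by nlinarith) (one_le_rpow hL (by linarith) : 1 ≤ L ^ (A + 2)) (by positivity : 0 ≤ K₂ * L) hK₁ hc hG hb hr).trans ?_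
  have hT : L / L ^ (A + 2) ≤ L ^ (-A) := by
    rw [← rpow_one_sub' hL0.le (by linarith)]
    exact rpow_le_rpow_of_exponent_le hL (by linarith)
  have hxa : L * x ^ (1 - d * L ^ (-(1/2) : ℝ)) ≤ (n.factorial / d ^ n) * x * L ^ (-A) := by
    have e1 : x ^ (1 - d * L ^ (-(1/2) : ℝ)) = x * exp (-(d * L ^ (1/2 : ℝ))) := by
      rw [rpow_sub hx0, rpow_one, rpow_def_of_pos hx0, div_eq_mul_inv, ← exp_neg, ← hLd]
      congr 3
      have : L * L ^ (-(1/2) : ℝ) = L ^ (1/2 : ℝ) := by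
        nth_rewrite 1 [← rpow_one L]
        rw [← rpow_add hL0]; norm_num
      rw [← this]; ring
    have e2 := pow_div_factorial_le_exp (d * L ^ (1/2 : ℝ)) (by positivity) n
    have e3 : L ^ (A + 1) ≤ (L ^ (1/2 : ℝ)) ^ n := by
      rw [← rpow_natCast, ← rpow_mul hL0.le]
      exact rpow_le_rpow_of_exponent_le hL (by linarith)
    have e4 : d ^ n * L ^ (A + 1) / n.factorial ≤ exp (d * L ^ (1/2 : ℝ)) := by
      refine le_trans ?_ e2
      rw [mul_pow]; gcongr
    have e5 : exp (-(d * L ^ (1/2 : ℝ))) ≤ n.factorial / (d ^ n * L ^ (A + 1)) := by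
      rw [exp_neg]
      exact (inv_anti₀ (by positivity) e4).trans_eq (inv_div _ _)
    rw [e1]
    calc L * (x * exp (-(d * L ^ (1/2 : ℝ)))) ≤ L * (x * (n.factorial / (d ^ n * L ^ (A + 1)))) := by gcongr
      _ = _ := by
        rw [rpow_add hL0, rpow_one, rpow_neg hL0.le]; field_simp
  calc K₁ * L * x * exp 1 / L ^ (A + 2) + 2 * (K₂ * L) * x ^ (1 - d * L ^ (-(1/2) : ℝ)) + K₂ * L * exp 1 * x / L ^ (A + 2)
      = (K₁ * exp 1 + K₂ * exp 1) * x * (L / L ^ (A + 2)) + 2 * K₂ * (L * x ^ (1 - d * L ^ (-(1/2) : ℝ))) := by ring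
    _ ≤ (K₁ * exp 1 + K₂ * exp 1) * x * L ^ (-A) + 2 * K₂ * ((n.factorial / d ^ n) * x * L ^ (-A)) := by gcongr
    _ = _ := by ring

lemma bv_X {A L q t : ℝ} (hA : 0 < A) (hL : 1 ≤ L) (hq : 1 ≤ q) (hqL : q ≤ L ^ A) (ht : |t| ≤ L ^ (A + 2)) :
    (q * (|t| + 2)) ^ (1 / (4 * A + 4) : ℝ) ≤ 3 * L ^ (1/2 : ℝ) ∧ L ^ (-(1/2) : ℝ) / 3 ≤ (q * (|t| + 2)) ^ (-(1 / (4 * A + 4)) : ℝ) := by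
  have hL0 : 0 < L := by linarith
  have hX : 0 < q * (|t| + 2) := by positivity
  have h1 : 1 ≤ L ^ (A + 2) := one_le_rpow hL (by linarith)
  have h2 : q * (|t| + 2) ≤ 3 * L ^ (2 * A + 2) := by
    calc q * (|t| + 2) ≤ L ^ A * (3 * L ^ (A + 2)) := by gcongr; linarith
      _ = _ := by rw [mul_left_comm, ← rpow_add hL0]; ring_nf
  have hε : (0 : ℝ) ≤ 1 / (4 * A + 4) := by positivity
  have h3 : (q * (|t| + 2)) ^ (1 / (4 * A + 4) : ℝ) ≤ 3 * L ^ (1/2 : ℝ) := by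
    refine (rpow_le_rpow hX.le h2 hε).trans ?_
    rw [mul_rpow (by norm_num) (by positivity), ← rpow_mul hL0.le]
    have e : (2 * A + 2) * (1 / (4 * A + 4)) = 1 / 2 := by field_simp; ring
    rw [e]
    gcongr
    calc (3 : ℝ) ^ (1 / (4 * A + 4)) ≤ 3 ^ (1 : ℝ) := rpow_le_rpow_of_exponent_le (by norm_num) (by rw [div_le_one (by positivity)]; linarith)
      _ = 3 := by norm_num
  refine ⟨h3, ?_⟩
  rw [rpow_neg hX.le, rpow_neg hL0.le, ← inv_div, div_inv_eq_mul]
  exact inv_anti₀ (by positivity) h3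

lemma bv_sw_chi {A : ℝ} (hA : 0 < A) : ∃ C : ℝ, 0 ≤ C ∧ ∀ x : ℝ, exp 1 ≤ x → ∀ (q : ℕ) [NeZero q] (χ : DirichletCharacter ℂ q),
    χ.IsPrimitive → χ ≠ 1 → (q : ℝ) ≤ (log x) ^ A →
    ‖∑ n ∈ Icc 1 ⌊x⌋₊, χ n * (vonMangoldt n : ℂ) * (log (x / n) : ℂ)‖ ≤ C * x * (log x) ^ (-A) := by
  obtain ⟨d₀, hd, hd4, hz⟩ := bv_zf (ε := 1 / (4 * A + 4)) (by positivity)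
  obtain ⟨K₁, hK, hK1⟩ := bv_K1
  obtain ⟨C, hC, h⟩ := bv_sw_core (K₁ := K₁) (K₂ := 9 / d₀ ^ 2) (d := d₀ / 3) hA hK (by positivity) (by positivity) (by linarith)
  refine ⟨C, hC, fun x hx q _ χ hp h1 hq => ?_⟩
  have hx0 : 0 < x := (exp_pos 1).trans_le hx
  have hL : 1 ≤ log x := by rwa [le_log_iff_exp_le hx0]
  have hq1 : (1 : ℝ) ≤ q := by exact_mod_cast NeZero.one_le
  refine h x hx ((fun n : ℕ => χ n) * fun n => (vonMangoldt n : ℂ)) (fun s => -deriv χ.LFunction s / χ.LFunction s) ?_ ?_ ?_ ?_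
  · intro σ hσ; exact χ.LSeriesSummable_twist_vonMangoldt (by simpa)
  · intro s hs
    rw [χ.LSeries_twist_vonMangoldt_eq hs, χ.LFunction_eq_LSeries hs, χ.deriv_LFunction_eq_deriv_LSeries hs]
  · refine hK1 _ fun n => ?_
    have := @vonMangoldt_nonneg n
    simp only [Pi.mul_apply, norm_mul, norm_real, norm_eq_abs, abs_of_nonneg this]
    nlinarith [χ.norm_le_one n]
  · intro s hs hs2 ht
    obtain ⟨b1, b2⟩ := bv_X hA hL hq1 hq ht
    have b3 : d₀ / 3 * log x ^ (-(1/2) : ℝ) ≤ d₀ * (q * (|s.im| + 2)) ^ (-(1 / (4 * A + 4)) : ℝ) := by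
      calc _ = d₀ * (log x ^ (-(1/2) : ℝ) / 3) := by ring
        _ ≤ _ := by gcongr
    obtain ⟨z1, z2⟩ := hz q χ s hp (Or.inl h1) (by linarith) hs2
    have hX : 0 < q * (|s.im| + 2) := by positivity
    have hL0 : χ.LFunction s ≠ 0 := by rw [← norm_pos_iff]; refine lt_of_lt_of_le (by positivity) z1
    have hdf := differentiable_LFunction h1
    have hdd : Differentiable ℂ (deriv χ.LFunction) := hdf.deriv
    refine ⟨((hdd s).neg).div (hdf s) hL0, ?_⟩
    rw [norm_div, norm_neg]
    set E := (q * (|s.im| + 2)) ^ (1 / (4 * A + 4) : ℝ) with hE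
    rw [rpow_neg hX.le, ← hE] at z1
    have hEp : 0 < E := by positivity
    calc ‖deriv χ.LFunction s‖ / ‖χ.LFunction s‖ ≤ (E / d₀) / (d₀ * E⁻¹) := by gcongr
      _ = E ^ 2 / d₀ ^ 2 := by field_simp
      _ ≤ (3 * log x ^ (1/2 : ℝ)) ^ 2 / d₀ ^ 2 := by gcongr
      _ = _ := by
        rw [mul_pow, ← rpow_natCast (log x ^ (1/2 : ℝ)), ← rpow_mul (by linarith)]; norm_num; ring

lemma bv_sw_one {A : ℝ} (hA : 0 < A) : ∃ C : ℝ, 0 ≤ C ∧ ∀ x : ℝ, exp 1 ≤ x →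
    ‖∑ n ∈ Icc 1 ⌊x⌋₊, ((vonMangoldt n : ℂ) - 1) * (log (x / n) : ℂ)‖ ≤ C * x * (log x) ^ (-A) := by
  have hεp : (0 : ℝ) < 1 / (4 * A + 4) := by positivity
  obtain ⟨d₀, hd, hd4, hz⟩ := bv_zf hεp
  obtain ⟨M, hM, η, hη, hη4, -, hLb⟩ := bv_L_bounds hεp
  obtain ⟨δ, hδ, C₀, hC₀, hn⟩ := bv_Z_near
  obtain ⟨K₁, hK, hK1⟩ := bv_K1
  set d := min (d₀ / 3) (min η δ) with hdd
  have hd0 : 0 < d := by positivity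
  have e1 : d ≤ d₀ / 3 := min_le_left _ _
  have e2 : d ≤ η := (min_le_right _ _).trans (min_le_left _ _)
  have e3 : d ≤ δ := (min_le_right _ _).trans (min_le_right _ _)
  clear_value d
  obtain ⟨C, hC, h⟩ := bv_sw_core (K₁ := K₁) (K₂ := 9 / d₀ ^ 2 + 3 * M + 2 * C₀) (d := d) hA hK (by positivity) hd0 (by linarith)
  refine ⟨C, hC, fun x hx => ?_⟩
  have hx0 : 0 < x := (exp_pos 1).trans_le hx
  have hL : 1 ≤ log x := by rwa [le_log_iff_exp_le hx0]
  have hΛ : ∀ {s : ℂ}, 1 < s.re → LSeriesSummable (fun n => (vonMangoldt n : ℂ)) s := fun hs => ArithmeticFunction.LSeriesSummable_vonMangoldt hs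
  have h1s : ∀ {s : ℂ}, 1 < s.re → LSeriesSummable 1 s := fun hs => LSeriesSummable_one_iff.mpr hs
  have hLh : log x ^ (-(1/2) : ℝ) ≤ 1 := rpow_le_one_of_one_le_of_nonpos hL (by norm_num)
  have hLh0 : 0 < log x ^ (-(1/2) : ℝ) := by positivity
  refine h x hx ((fun n => (vonMangoldt n : ℂ)) - 1) (fun s => -(deriv bvZ s / bvZ s) - dslope bvZ 1 s) ?_ ?_ ?_ ?_
  · intro σ hσ; exact (hΛ (by simpa)).sub (h1s (by simpa))
  · intro s hs
    have hs1 : s ≠ 1 := by rintro rfl; simp at hs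
    obtain ⟨f1, f2⟩ := bv_Z_log hs1 (riemannZeta_ne_zero_of_one_le_re hs.le)
    simp only [f1, f2]
    rw [LSeries_sub (hΛ hs) (h1s hs), LSeries_one_eq_riemannZeta hs, ArithmeticFunction.LSeries_vonMangoldt_eq_deriv_riemannZeta_div hs]
    ring
  · refine hK1 _ fun n => ?_
    have := @vonMangoldt_nonneg n
    simp only [Pi.sub_apply, Pi.one_apply]
    refine (norm_sub_le _ _).trans ?_
    simp [abs_of_nonneg this]
  · intro s hs hs2 ht
    have hds : DifferentiableAt ℂ (dslope bvZ 1) s := by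
      have := (differentiableOn_dslope (f := bvZ) (s := Set.univ) (c := 1) Filter.univ_mem).mpr bvZ_diff.differentiableOn
      exact (differentiableOn_univ.mp this) s
    have hddZ : Differentiable ℂ (deriv bvZ) := bvZ_diff.deriv
    have hmul : d * log x ^ (-(1/2) : ℝ) ≤ d := by nlinarith
    have key : bvZ s ≠ 0 ∧ ‖-(deriv bvZ s / bvZ s) - dslope bvZ 1 s‖ ≤ (9 / d₀ ^ 2 + 3 * M + 2 * C₀) * log x := by
      have g1 : 0 ≤ 9 / d₀ ^ 2 * log x := by positivity
      have g2 : 0 ≤ M * log x := by positivity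
      rcases le_total |s.im| 1 with h1 | h1
      · obtain ⟨u1, u2, u3, -⟩ := hn s (by linarith) hs2 h1
        refine ⟨u1, ?_⟩
        refine (norm_sub_le _ _).trans ?_
        rw [norm_neg]
        nlinarith
      · obtain ⟨b1, b2⟩ := bv_X (q := 1) hA hL le_rfl (one_le_rpow hL hA.le) ht
        have b3 : d * log x ^ (-(1/2) : ℝ) ≤ d₀ * (1 * (|s.im| + 2)) ^ (-(1 / (4 * A + 4)) : ℝ) := by
          calc _ ≤ d₀ / 3 * log x ^ (-(1/2) : ℝ) := by gcongr
            _ = d₀ * (log x ^ (-(1/2) : ℝ) / 3) := by ring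
            _ ≤ _ := by gcongr
        have z12 := hz 1 (1 : DirichletCharacter ℂ 1) s DirichletCharacter.isPrimitive_one_level_one (Or.inr h1) (by push_cast; linarith) hs2
        have z3 := (hLb 1 (1 : DirichletCharacter ℂ 1) s (by linarith) hs2 (Or.inr h1)).1
        rw [LFunction_modOne_eq] at z12 z3
        obtain ⟨z1, z2⟩ := z12
        push_cast at z1 z2 z3
        have hX : 0 < 1 * (|s.im| + 2) := by positivity
        have hL0 : riemannZeta s ≠ 0 := by rw [← norm_pos_iff]; refine lt_of_lt_of_le (by positivity) z1
        set E := (1 * (|s.im| + 2)) ^ (1 / (4 * A + 4) : ℝ) with hE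
        rw [rpow_neg hX.le, ← hE] at z1
        have hEp : 0 < E := by positivity
        have hs1 : s ≠ 1 := by rintro rfl; simp at h1; linarith
        obtain ⟨f1, f2⟩ := bv_Z_log hs1 hL0
        refine ⟨by rw [bvZ_ne hs1]; exact mul_ne_zero (sub_ne_zero.mpr hs1) hL0, ?_⟩
        have e : -(deriv bvZ s / bvZ s) - dslope bvZ 1 s = -(deriv riemannZeta s / riemannZeta s) - riemannZeta s := by rw [f1, f2]; ring
        rw [e]
        refine (norm_sub_le _ _).trans ?_
        rw [norm_neg, norm_div]
        have q1 : ‖deriv riemannZeta s‖ / ‖riemannZeta s‖ ≤ 9 / d₀ ^ 2 * log x := by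
          calc _ ≤ (E / d₀) / (d₀ * E⁻¹) := by gcongr
            _ = E ^ 2 / d₀ ^ 2 := by field_simp
            _ ≤ (3 * log x ^ (1/2 : ℝ)) ^ 2 / d₀ ^ 2 := by gcongr
            _ = _ := by
              rw [mul_pow, ← rpow_natCast (log x ^ (1/2 : ℝ)), ← rpow_mul (by linarith)]; norm_num; ring
        have q2 : log x ^ (1/2 : ℝ) ≤ log x := by
          calc _ ≤ log x ^ (1 : ℝ) := rpow_le_rpow_of_exponent_le hL (by norm_num)
            _ = _ := rpow_one _
        have q3 : M * E ≤ M * (3 * log x) := by gcongr; linarith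
        nlinarith
    exact ⟨(((hddZ s).div (bvZ_diff s) key.1).neg).sub hds, key.2⟩

noncomputable def bvS (a : ℕ → ℂ) (N : ℕ) (t : ℝ) : ℂ := ∑ n ∈ Icc 1 N, a n * Complex.exp ((2 * π * I * n) * t)

lemma bvS_cont (a : ℕ → ℂ) (N : ℕ) : Continuous (bvS a N) := by unfold bvS; fun_prop

lemma bvS_deriv (a : ℕ → ℂ) (N : ℕ) (t : ℝ) : HasDerivAt (bvS a N) (bvS (fun n => 2 * π * I * n * a n) N t) t := by
  unfold bvS
  have : ∀ n ∈ Icc 1 N, HasDerivAt (fun t : ℝ => a n * Complex.exp ((2 * π * I * n) * t)) (2 * π * I * n * a n * Complex.exp ((2 * π * I * n) * t)) t := by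
    intro n _
    have h1 : HasDerivAt (fun t : ℝ => (2 * π * I * n) * (t : ℂ)) (2 * π * I * n) t := by
      simpa using (Complex.ofRealCLM.hasDerivAt (x := t)).const_mul (2 * π * I * n : ℂ)
    exact ((h1.cexp).const_mul (a n)).congr_deriv (by ring)
  exact HasDerivAt.fun_sum this

lemma bv_parseval (a : ℕ → ℂ) (N : ℕ) (c : ℝ) : ∫ t in c..c + 1, ‖bvS a N t‖ ^ 2 = ∑ n ∈ Icc 1 N, ‖a n‖ ^ 2 := by
  apply Complex.ofReal_injective
  rw [← intervalIntegral.integral_ofReal]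
  have h1 : ∀ t : ℝ, ((‖bvS a N t‖ ^ 2 : ℝ) : ℂ) = ∑ n ∈ Icc 1 N, ∑ m ∈ Icc 1 N, a n * (starRingEnd ℂ) (a m) * Complex.exp ((2 * π * I * ((n : ℂ) - m)) * t) := by
    intro t
    rw [Complex.ofReal_pow, ← mul_conj', bvS, map_sum, sum_mul_sum]
    refine sum_congr rfl fun n _ => sum_congr rfl fun m _ => ?_
    rw [map_mul, ← Complex.exp_conj]
    simp only [map_mul, Complex.conj_I, conj_ofReal, Complex.conj_natCast, Complex.conj_ofNat]
    rw [mul_mul_mul_comm, ← Complex.exp_add]; ring_nf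
  simp_rw [h1]
  rw [intervalIntegral.integral_finset_sum (fun n _ => by apply Continuous.intervalIntegrable; fun_prop)]
  push_cast
  refine sum_congr rfl fun n hn => ?_
  rw [intervalIntegral.integral_finset_sum (fun n _ => by apply Continuous.intervalIntegrable; fun_prop)]
  rw [Finset.sum_eq_single n]
  · simp [mul_conj']
  · intro m _ hmn
    rw [intervalIntegral.integral_const_mul, integral_exp_mul_complex]
    · have : Complex.exp (2 * π * I * ((n : ℂ) - m) * ((c + 1 : ℝ) : ℂ)) = Complex.exp (2 * π * I * ((n : ℂ) - m) * (c : ℂ)) := by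
        rw [Complex.exp_eq_exp_iff_exists_int]
        exact ⟨(n : ℤ) - m, by push_cast; ring⟩
      rw [this]; simp
    · have : (n : ℂ) - m ≠ 0 := sub_ne_zero.mpr (by exact_mod_cast hmn.symm)
      have hp : (π : ℂ) ≠ 0 := by exact_mod_cast pi_ne_zero
      simp [this, hp]
  · intro h; exact absurd hn h

lemma bv_gallagher (a : ℕ → ℂ) {N : ℕ} (hN : 0 < N) {δ : ℝ} (hδ : 0 < δ) (α : ℝ) :
    ‖bvS a N α‖ ^ 2 ≤ ∫ t in α..α + δ, ((1 / δ + N) * ‖bvS a N t‖ ^ 2 + 1 / N * ‖bvS (fun n => 2 * π * I * n * a n) N t‖ ^ 2) := by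
  set f := bvS a N with hf
  set g := bvS (fun n => 2 * π * I * n * a n) N with hg
  have hfc : Continuous f := bvS_cont _ _
  have hgc : Continuous g := bvS_cont _ _
  have hN' : (0 : ℝ) < N := by exact_mod_cast hN
  have hd : ∀ t ∈ Set.uIcc α (α + δ), HasDerivAt (fun t : ℝ => (t - (α + δ)) * ‖f t‖ ^ 2) (1 * ‖f t‖ ^ 2 + (t - (α + δ)) * (2 * inner ℝ (f t) (g t))) t := by
    intro t _
    exact ((hasDerivAt_id t).sub_const (α + δ)).mul (HasDerivAt.norm_sq (bvS_deriv a N t))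
  have hint := intervalIntegral.integral_eq_sub_of_hasDerivAt hd (by apply Continuous.intervalIntegrable; fun_prop)
  have e : ‖f α‖ ^ 2 = (1 / δ) * ∫ t in α..α + δ, (1 * ‖f t‖ ^ 2 + (t - (α + δ)) * (2 * inner ℝ (f t) (g t))) := by
    rw [hint]; field_simp; ring
  rw [e, ← intervalIntegral.integral_const_mul]
  apply intervalIntegral.integral_mono_on (by linarith)
  · apply Continuous.intervalIntegrable; fun_prop
  · apply Continuous.intervalIntegrable; fun_prop
  · intro t ht
    have h1 : |(inner ℝ (f t) (g t) : ℝ)| ≤ ‖f t‖ * ‖g t‖ := abs_real_inner_le_norm _ _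
    have h2 : 2 * (‖f t‖ * ‖g t‖) ≤ N * ‖f t‖ ^ 2 + 1 / N * ‖g t‖ ^ 2 := by
      have := sq_nonneg (N * ‖f t‖ - ‖g t‖)
      have e2 : N * ‖f t‖ ^ 2 + 1 / N * ‖g t‖ ^ 2 - 2 * (‖f t‖ * ‖g t‖) = 1 / N * (N * ‖f t‖ - ‖g t‖) ^ 2 := by field_simp; ring
      have : 0 ≤ 1 / N * (N * ‖f t‖ - ‖g t‖) ^ 2 := by positivity
      linarith
    have h3 : (t - (α + δ)) * (2 * inner ℝ (f t) (g t)) ≤ δ * (N * ‖f t‖ ^ 2 + 1 / N * ‖g t‖ ^ 2) := by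
      calc _ ≤ |(t - (α + δ)) * (2 * inner ℝ (f t) (g t))| := le_abs_self _
        _ = |t - (α + δ)| * (2 * |inner ℝ (f t) (g t)|) := by rw [abs_mul, abs_mul, abs_two]
        _ ≤ δ * (2 * (‖f t‖ * ‖g t‖)) := by
          gcongr
          rw [abs_le]; constructor <;> linarith [ht.1, ht.2]
        _ ≤ _ := by gcongr
    calc 1 / δ * (1 * ‖f t‖ ^ 2 + (t - (α + δ)) * (2 * inner ℝ (f t) (g t))) ≤ 1 / δ * (1 * ‖f t‖ ^ 2 + δ * (N * ‖f t‖ ^ 2 + 1 / N * ‖g t‖ ^ 2)) := by gcongr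
      _ = _ := by field_simp; ring

lemma bv_add_ls (a : ℕ → ℂ) {N R : ℕ} (hN : 0 < N) (hR : 0 < R) (P : Finset (ℕ × ℕ))
    (hP : ∀ p ∈ P, 1 ≤ p.1 ∧ p.1 ≤ R ∧ 1 ≤ p.2 ∧ p.2 ≤ p.1 ∧ p.2.Coprime p.1) :
    ∑ p ∈ P, ‖bvS a N ((p.2 : ℝ) / p.1)‖ ^ 2 ≤ (R ^ 2 + 41 * N) * ∑ n ∈ Icc 1 N, ‖a n‖ ^ 2 := by
  set δ : ℝ := 1 / R ^ 2 with hδd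
  have hR' : (1 : ℝ) ≤ R := by exact_mod_cast hR
  have hN' : (0 : ℝ) < N := by exact_mod_cast hN
  have hδ : 0 < δ := by positivity
  set H : ℝ → ℝ := fun t => (1 / δ + N) * ‖bvS a N t‖ ^ 2 + 1 / N * ‖bvS (fun n => 2 * π * I * n * a n) N t‖ ^ 2 with hH
  have hHc : Continuous H := by
    have h1 := bvS_cont a N
    have h2 := bvS_cont (fun n => 2 * π * I * n * a n) N
    fun_prop
  have hH0 : ∀ t, 0 ≤ H t := fun t => by positivity
  set W : ℕ × ℕ → Set ℝ := fun p => Set.Ioc ((p.2 : ℝ) / p.1) ((p.2 : ℝ) / p.1 + δ) with hW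
  have hdisj : ∀ p ∈ P, ∀ p' ∈ P, (p.2 : ℝ) / p.1 ≤ (p'.2 : ℝ) / p'.1 → p ≠ p' → (p.2 : ℝ) / p.1 + δ ≤ (p'.2 : ℝ) / p'.1 := by
    intro p hp p' hp' hle hne
    obtain ⟨h1, h2, h3, h4, h5⟩ := hP p hp
    obtain ⟨k1, k2, k3, k4, k5⟩ := hP p' hp'
    have hp0 : (0 : ℝ) < p.1 := by exact_mod_cast h1
    have hp0' : (0 : ℝ) < p'.1 := by exact_mod_cast k1
    have hm : p.2 * p'.1 ≤ p'.2 * p.1 := by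
      rw [div_le_div_iff₀ hp0 hp0'] at hle; exact_mod_cast hle
    have hm2 : p.2 * p'.1 ≠ p'.2 * p.1 := by
      intro he
      apply hne
      have d1 : p.1 ∣ p'.1 := h5.symm.dvd_of_dvd_mul_left (Dvd.intro_left _ he.symm)
      have d2 : p'.1 ∣ p.1 := k5.symm.dvd_of_dvd_mul_left (Dvd.intro_left _ he)
      have d3 := Nat.dvd_antisymm d1 d2
      rw [d3] at he
      exact Prod.ext d3 (Nat.eq_of_mul_eq_mul_right k1 he)
    have hm3 : p.2 * p'.1 + 1 ≤ p'.2 * p.1 := by omega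
    have hm4 : (p.2 : ℝ) * p'.1 + 1 ≤ p'.2 * p.1 := by exact_mod_cast hm3
    have e1 : δ ≤ 1 / (p.1 * p'.1) := by
      rw [hδd, sq]; gcongr
    calc (p.2 : ℝ) / p.1 + δ ≤ (p.2 : ℝ) / p.1 + 1 / (p.1 * p'.1) := by gcongr
      _ = (p.2 * p'.1 + 1) / (p.1 * p'.1) := by field_simp
      _ ≤ (p'.2 * p.1) / (p.1 * p'.1) := by gcongr
      _ = _ := by field_simp
  have hpd : Set.Pairwise (↑P) (Function.onFun Disjoint W) := by
    intro p hp p' hp' hne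
    rw [Function.onFun, Set.disjoint_left]
    rintro t ⟨u1, u2⟩ ⟨v1, v2⟩
    rcases le_total ((p.2 : ℝ) / p.1) ((p'.2 : ℝ) / p'.1) with h | h
    · linarith [hdisj p hp p' hp' h hne]
    · linarith [hdisj p' hp' p hp h hne.symm]
  have hsub : ⋃ p ∈ P, W p ⊆ Set.Ioc δ (δ + 1) := by
    intro t ht
    simp only [Set.mem_iUnion] at ht
    obtain ⟨p, hp, u1, u2⟩ := ht
    obtain ⟨h1, h2, h3, h4, h5⟩ := hP p hp
    have hp0 : (0 : ℝ) < p.1 := by exact_mod_cast h1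
    have h3' : (1 : ℝ) ≤ p.2 := by exact_mod_cast h3
    have h2' : (p.1 : ℝ) ≤ R := by exact_mod_cast h2
    have a1 : (p.2 : ℝ) / p.1 ≤ 1 := by rw [div_le_one hp0]; exact_mod_cast h4
    have a2 : δ ≤ (p.2 : ℝ) / p.1 := by
      rw [hδd, div_le_div_iff₀ (by positivity) hp0]; nlinarith
    exact ⟨by linarith, by linarith⟩
  calc ∑ p ∈ P, ‖bvS a N ((p.2 : ℝ) / p.1)‖ ^ 2 ≤ ∑ p ∈ P, ∫ t in W p, H t := by
        refine sum_le_sum fun p _ => (bv_gallagher a hN hδ _).trans_eq ?_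
        rw [intervalIntegral.integral_of_le (by linarith)]
    _ = ∫ t in ⋃ p ∈ P, W p, H t := by
        rw [MeasureTheory.integral_biUnion_finset P (fun p _ => measurableSet_Ioc) hpd (fun p _ => (hHc.integrableOn_Icc).mono_set Set.Ioc_subset_Icc_self)]
    _ ≤ ∫ t in Set.Ioc δ (δ + 1), H t := by
        apply MeasureTheory.setIntegral_mono_set ((hHc.integrableOn_Icc).mono_set Set.Ioc_subset_Icc_self) (Eventually.of_forall hH0)
        exact hsub.eventuallyLE
    _ = ∫ t in δ..δ + 1, H t := by rw [intervalIntegral.integral_of_le (by linarith)]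
    _ = (1 / δ + N) * ∑ n ∈ Icc 1 N, ‖a n‖ ^ 2 + 1 / N * ∑ n ∈ Icc 1 N, ‖2 * π * I * n * a n‖ ^ 2 := by
        have h1 := bvS_cont a N
        have h2 := bvS_cont (fun n => 2 * π * I * n * a n) N
        rw [hH, intervalIntegral.integral_add (by apply Continuous.intervalIntegrable; fun_prop) (by apply Continuous.intervalIntegrable; fun_prop), intervalIntegral.integral_const_mul, intervalIntegral.integral_const_mul, bv_parseval, bv_parseval]
    _ ≤ (1 / δ + N) * ∑ n ∈ Icc 1 N, ‖a n‖ ^ 2 + 1 / N * ((40 * N ^ 2) * ∑ n ∈ Icc 1 N, ‖a n‖ ^ 2) := by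
        gcongr
        rw [mul_sum]
        refine sum_le_sum fun n hn => ?_
        have hn2 : (n : ℝ) ≤ N := by exact_mod_cast (mem_Icc.mp hn).2
        rw [norm_mul, mul_pow]
        gcongr
        simp only [norm_mul, norm_I, norm_real, norm_eq_abs, abs_of_pos pi_pos, Complex.norm_natCast, Complex.norm_ofNat, mul_one]
        have hpi : π ^ 2 ≤ 10 := by nlinarith [pi_lt_d2, pi_pos]
        have q1 : π ^ 2 * (n : ℝ) ^ 2 ≤ 10 * (N : ℝ) ^ 2 := by gcongr
        linarith [show (2 * π * (n : ℝ)) ^ 2 = 4 * (π ^ 2 * (n : ℝ) ^ 2) by ring]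
    _ = _ := by rw [hδd]; field_simp; ring

open Classical in
noncomputable def bvPr (r : ℕ) : Finset (ℕ → ℂ) :=
  if h : r = 0 then ∅ else
    haveI : NeZero r := ⟨h⟩
    (Finset.univ.filter (fun χ : DirichletCharacter ℂ r => χ.IsPrimitive)).image (fun χ n => χ (n : ZMod r))

lemma bvPr_mem {r : ℕ} [NeZero r] {f : ℕ → ℂ} : f ∈ bvPr r ↔ ∃ χ : DirichletCharacter ℂ r, χ.IsPrimitive ∧ (fun n : ℕ => χ (n : ZMod r)) = f := by
  rw [bvPr, dif_neg (NeZero.ne r)]; simp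

lemma bv_char_inj {r : ℕ} [NeZero r] {χ ψ : DirichletCharacter ℂ r} (h : (fun n : ℕ => χ (n : ZMod r)) = fun n : ℕ => ψ (n : ZMod r)) : χ = ψ := by
  refine MulChar.ext' fun a => ?_
  have := congrFun h a.val
  simpa using this

open Classical in
lemma bvPr_sum {r : ℕ} [NeZero r] (F : (ℕ → ℂ) → ℝ) : ∑ f ∈ bvPr r, F f = ∑ χ : DirichletCharacter ℂ r with χ.IsPrimitive, F (fun n => χ n) := by
  rw [bvPr, dif_neg (NeZero.ne r), Finset.sum_image (fun χ _ ψ _ h => bv_char_inj h)]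

open Classical in
lemma bv_orth {ι κ : Type*} [Fintype ι] [Fintype κ] (u : ι → κ → ℂ) (c : κ → ℝ)
    (h : ∀ b b', ∑ i, u i b * (starRingEnd ℂ) (u i b') = if b = b' then (c b : ℂ) else 0) (g : κ → ℂ) :
    ∑ i, ‖∑ b, g b * u i b‖ ^ 2 = ∑ b, c b * ‖g b‖ ^ 2 := by
  apply Complex.ofReal_injective
  push_cast
  calc ∑ i, ((‖∑ b, g b * u i b‖ : ℝ) : ℂ) ^ 2 = ∑ i, ∑ b, ∑ b', g b * (starRingEnd ℂ) (g b') * (u i b * (starRingEnd ℂ) (u i b')) := by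
        refine sum_congr rfl fun i _ => ?_
        rw [← mul_conj', map_sum, sum_mul_sum]
        refine sum_congr rfl fun b _ => sum_congr rfl fun b' _ => ?_
        rw [map_mul]; ring
    _ = ∑ b, ∑ b', g b * (starRingEnd ℂ) (g b') * ∑ i, (u i b * (starRingEnd ℂ) (u i b')) := by
        rw [sum_comm]
        refine sum_congr rfl fun b _ => ?_
        rw [sum_comm]
        simp_rw [mul_sum]
    _ = _ := by
        simp_rw [h]
        refine sum_congr rfl fun b _ => ?_
        simp [mul_conj', mul_comm]

lemma bv_conj_char {r : ℕ} (χ : DirichletCharacter ℂ r) (a : ZMod r) : (starRingEnd ℂ) (χ a) = χ⁻¹ a := MulChar.star_apply' χ a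

open Classical in
lemma bv_orth_char {r : ℕ} [NeZero r] (g : ZMod r → ℂ) :
    ∑ χ : DirichletCharacter ℂ r, ‖∑ b, g b * χ b‖ ^ 2 = ∑ b, (if IsUnit b then (r.totient : ℝ) else 0) * ‖g b‖ ^ 2 := by
  refine bv_orth (fun (χ : DirichletCharacter ℂ r) b => χ b) _ (fun b b' => ?_) g
  by_cases hb : IsUnit b'
  · obtain ⟨u, rfl⟩ := hb
    have : ∀ χ : DirichletCharacter ℂ r, χ b * (starRingEnd ℂ) (χ (u : ZMod r)) = χ (u : ZMod r)⁻¹ * χ b := fun χ => by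
      rw [bv_conj_char, MulChar.inv_apply, Ring.inverse_unit, ZMod.inv_coe_unit, mul_comm]
    simp_rw [this]
    rw [DirichletCharacter.sum_char_inv_mul_char_eq ℂ u.isUnit b]
    by_cases h : b = u
    · subst h; simp
    · rw [if_neg h, if_neg (Ne.symm h)]
  · have : ∀ χ : DirichletCharacter ℂ r, χ b' = 0 := fun χ => MulChar.map_nonunit χ hb
    simp only [this, map_zero, mul_zero, Finset.sum_const_zero]
    split_ifs with h h2
    · rw [h] at h2; exact absurd h2 hb
    · simp
    · rfl

lemma bv_orth_add {r : ℕ} [NeZero r] (g : ZMod r → ℂ) :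
    ∑ a : ZMod r, ‖∑ b, g b * ZMod.stdAddChar (a * b)‖ ^ 2 = ∑ b, (r : ℝ) * ‖g b‖ ^ 2 := by
  refine bv_orth (fun (a : ZMod r) b => ZMod.stdAddChar (a * b)) (fun _ => (r : ℝ)) (fun b b' => ?_) g
  have : ∀ a : ZMod r, ZMod.stdAddChar (a * b) * (starRingEnd ℂ) (ZMod.stdAddChar (a * b')) = ZMod.stdAddChar (a * (b - b')) := fun a => by
    rw [← AddChar.map_neg_eq_conj, ← AddChar.map_add_eq_mul]; ring_nf
  simp_rw [this]
  rw [AddChar.sum_mulShift _ (ZMod.isPrimitive_stdAddChar r)]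
  simp only [sub_eq_zero, ZMod.card]
  split_ifs <;> simp

lemma bv_gauss_norm {r : ℕ} [NeZero r] {χ : DirichletCharacter ℂ r} (hχ : χ.IsPrimitive) : ‖gaussSum χ ZMod.stdAddChar‖ ^ 2 = r := by
  have h := bv_orth_add (fun b => χ b)
  have h2 : ∀ a : ZMod r, ∑ b, χ b * ZMod.stdAddChar (a * b) = χ⁻¹ a * gaussSum χ ZMod.stdAddChar := fun a => by
    rw [← gaussSum_mulShift_of_isPrimitive _ hχ a, gaussSum]; simp [AddChar.mulShift_apply]
  have h3 : ∀ a : ZMod r, ‖χ⁻¹ a‖ = ‖χ a‖ := fun a => by rw [← bv_conj_char, RCLike.norm_conj]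
  simp_rw [h2, norm_mul, mul_pow, h3] at h
  rw [← sum_mul, ← mul_sum, mul_comm] at h
  have hp : 0 < ∑ a : ZMod r, ‖χ a‖ ^ 2 := by
    refine Finset.sum_pos' (fun _ _ => by positivity) ⟨1, mem_univ _, by simp⟩
  exact mul_right_cancel₀ hp.ne' h

open Classical in
lemma bv_ls_r (a : ℕ → ℂ) (N : ℕ) {r : ℕ} [NeZero r] :
    (r : ℝ) / r.totient * ∑ f ∈ bvPr r, ‖∑ n ∈ Icc 1 N, a n * f n‖ ^ 2 ≤
      ∑ b ∈ (Icc 1 r).filter (fun b => b.Coprime r), ‖bvS (fun n => (starRingEnd ℂ) (a n)) N ((b : ℝ) / r)‖ ^ 2 := by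
  have hφ : (0 : ℝ) < r.totient := by exact_mod_cast Nat.totient_pos.mpr (NeZero.pos r)
  set S : ZMod r → ℂ := fun b => ∑ n ∈ Icc 1 N, (starRingEnd ℂ) (a n) * ZMod.stdAddChar ((n : ZMod r) * b) with hS
  have h1 : ∀ χ : DirichletCharacter ℂ r, χ.IsPrimitive → (r : ℝ) * ‖∑ n ∈ Icc 1 N, a n * χ n‖ ^ 2 = ‖∑ b, S b * χ b‖ ^ 2 := by
    intro χ hχ
    rw [← bv_gauss_norm hχ, ← RCLike.norm_conj (∑ n ∈ Icc 1 N, a n * χ n), ← mul_pow, ← norm_mul, map_sum, mul_sum]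
    congr 2
    simp only [hS, sum_mul]
    rw [sum_comm]
    refine sum_congr rfl fun n _ => ?_
    rw [map_mul, bv_conj_char, mul_left_comm, mul_comm (gaussSum _ _), ← gaussSum_mulShift_of_isPrimitive _ hχ, gaussSum, mul_sum]
    refine sum_congr rfl fun b _ => ?_
    rw [AddChar.mulShift_apply]; ring
  have h2 : (r : ℝ) * ∑ f ∈ bvPr r, ‖∑ n ∈ Icc 1 N, a n * f n‖ ^ 2 ≤ ∑ b, (if IsUnit b then (r.totient : ℝ) else 0) * ‖S b‖ ^ 2 := by
    rw [bvPr_sum (fun f => ‖∑ n ∈ Icc 1 N, a n * f n‖ ^ 2), ← bv_orth_char, mul_sum]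
    refine (sum_le_sum (fun χ hχ => (h1 χ (mem_filter.mp hχ).2).le)).trans ?_
    exact sum_le_sum_of_subset_of_nonneg (Finset.filter_subset _ _) (fun _ _ _ => by positivity)
  have h3 : ∀ b : ℕ, S (b : ZMod r) = bvS (fun n => (starRingEnd ℂ) (a n)) N ((b : ℝ) / r) := by
    intro b
    simp only [hS, bvS]
    refine sum_congr rfl fun n _ => ?_
    congr 1
    have := ZMod.stdAddChar_coe (N := r) ((n : ℤ) * b)
    push_cast at this ⊢
    rw [this]; congr 1; ring
  have h4 : ∀ F : ZMod r → ℝ, ∑ b, F b = ∑ b ∈ Icc 1 r, F (b : ZMod r) := by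
    intro F
    have e1 : ∑ b ∈ Icc 1 r, F (b : ZMod r) = ∑ b ∈ range r, F ((b + 1 : ℕ) : ZMod r) := by
      rw [Finset.range_eq_Ico, Finset.sum_Ico_add' (fun b : ℕ => F (b : ZMod r)) 0 r 1]; rfl
    have e2 := Finset.sum_range_succ' (fun b : ℕ => F (b : ZMod r)) r
    rw [Finset.sum_range_succ] at e2
    have e3 : ∑ b ∈ range r, F (b : ZMod r) = ∑ b, F b := by
      have := bv_sum_range_zmod (fun b => (F b : ℂ))
      exact_mod_cast this
    rw [← e3, e1]
    simp at e2 ⊢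
    linarith
  rw [h4] at h2
  rw [div_mul_eq_mul_div, div_le_iff₀ hφ]
  refine h2.trans (le_of_eq ?_)
  rw [sum_filter, sum_mul]
  refine sum_congr rfl fun b _ => ?_
  rw [← h3]
  have := ZMod.isUnit_iff_coprime b r
  by_cases hb : b.Coprime r
  · rw [if_pos hb, if_pos (this.mpr hb)]; ring
  · rw [if_neg hb, if_neg (fun h => hb (this.mp h))]; ring

lemma bv_large_sieve (a : ℕ → ℂ) (N R : ℕ) :
    ∑ r ∈ Icc 1 R, (r : ℝ) / r.totient * ∑ f ∈ bvPr r, ‖∑ n ∈ Icc 1 N, a n * f n‖ ^ 2 ≤ (R ^ 2 + 41 * N) * ∑ n ∈ Icc 1 N, ‖a n‖ ^ 2 := by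
  rcases Nat.eq_zero_or_pos N with rfl | hN
  · simp
  rcases Nat.eq_zero_or_pos R with rfl | hR
  · simp; positivity
  set P : Finset (ℕ × ℕ) := (Icc 1 R ×ˢ Icc 1 R).filter (fun p => p.2 ≤ p.1 ∧ p.2.Coprime p.1) with hP
  have h := bv_add_ls (fun n => (starRingEnd ℂ) (a n)) hN hR P (by
    intro p hp
    simp only [hP, mem_filter, Finset.mem_product, mem_Icc] at hp
    tauto)
  simp only [RCLike.norm_conj] at h
  refine le_trans ?_ h
  rw [Finset.sum_finset_product' P (Icc 1 R) (fun r => (Icc 1 r).filter (fun b => b.Coprime r)) (by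
    rintro ⟨p1, p2⟩
    simp only [hP, mem_filter, Finset.mem_product, mem_Icc]
    constructor
    · tauto
    · rintro ⟨⟨h1, h2⟩, ⟨h3, h4⟩, h5⟩; exact ⟨⟨⟨h1, h2⟩, h3, h4.trans h2⟩, h4, h5⟩) (f := fun r b => ‖bvS (fun n => (starRingEnd ℂ) (a n)) N ((b : ℝ) / r)‖ ^ 2)]
  refine sum_le_sum fun r hr => ?_
  haveI : NeZero r := ⟨by have := (mem_Icc.mp hr).1; omega⟩
  exact bv_ls_r a N

noncomputable def bvl (y : ℝ) : ℝ := max (log y) 0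

noncomputable def bvEx (σ : ℝ) (m : ℕ) (t : ℝ) : ℂ := Complex.exp (-(log m : ℂ) * ((σ : ℂ) + t * I))

lemma bvEx_norm {σ : ℝ} (hσ : 0 < σ) (m : ℕ) (t : ℝ) : ‖bvEx σ m t‖ ≤ 1 := by
  rw [bvEx, Complex.norm_exp]
  simp only [neg_mul, Complex.neg_re, re_ofReal_mul, add_re, ofReal_re, Complex.mul_re, Complex.I_re, mul_zero, ofReal_im, Complex.I_im, mul_one, sub_self, add_zero]
  rw [exp_le_one_iff]
  have := mul_nonneg (log_natCast_nonneg m) hσ.le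
  linarith

lemma bv_bilin_f {x : ℝ} (hx : exp 1 ≤ x) (a b : ℕ → ℂ) (M N : ℕ) :
    ‖∑ m ∈ Icc 1 M, ∑ n ∈ Icc 1 N, a m * b n * (bvl (x / (m * n)) : ℂ)‖ ≤
      ∫ t : ℝ, (exp 1 / (2 * π)) * (‖∑ m ∈ Icc 1 M, a m * bvEx (1 / log x) m t‖ * ‖∑ n ∈ Icc 1 N, b n * bvEx (1 / log x) n t‖) * (1 / ((1 / log x) ^ 2 + t ^ 2)) := by
  have hx0 : 0 < x := (exp_pos 1).trans_le hx
  have hL : 1 ≤ log x := by rwa [le_log_iff_exp_le hx0]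
  set σ := 1 / log x with hσd
  have hσ : 0 < σ := by positivity
  have h1 : ∀ m ∈ Icc 1 M, ∀ n ∈ Icc 1 N, a m * b n * (bvl (x / (m * n)) : ℂ) =
      (1 / (2 * π) : ℂ) * ∫ t : ℝ, a m * b n * (((x / (m * n) : ℝ) : ℂ) ^ ((σ : ℂ) + t * I) * (1 / ((σ : ℂ) + t * I) ^ 2)) := by
    intro m hm n hn
    have hm0 : (0 : ℝ) < m := by exact_mod_cast (mem_Icc.mp hm).1
    have hn0 : (0 : ℝ) < n := by exact_mod_cast (mem_Icc.mp hn).1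
    rw [integral_const_mul, bv_perron hσ (by positivity), bvl]
    have : (π : ℂ) ≠ 0 := by exact_mod_cast pi_ne_zero
    field_simp
  have h2 : ∀ m ∈ Icc 1 M, ∀ n ∈ Icc 1 N, ∀ t : ℝ, a m * b n * (((x / (m * n) : ℝ) : ℂ) ^ ((σ : ℂ) + t * I) * (1 / ((σ : ℂ) + t * I) ^ 2)) =
      (a m * bvEx σ m t) * (b n * bvEx σ n t) * (Complex.exp ((log x : ℂ) * ((σ : ℂ) + t * I)) * (1 / ((σ : ℂ) + t * I) ^ 2)) := by
    intro m hm n hn t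
    have hm0 : (0 : ℝ) < m := by exact_mod_cast (mem_Icc.mp hm).1
    have hn0 : (0 : ℝ) < n := by exact_mod_cast (mem_Icc.mp hn).1
    have hy : (0 : ℝ) < x / (m * n) := by positivity
    have e : ((x / (m * n) : ℝ) : ℂ) ^ ((σ : ℂ) + t * I) = bvEx σ m t * bvEx σ n t * Complex.exp ((log x : ℂ) * ((σ : ℂ) + t * I)) := by
      rw [Complex.cpow_def_of_ne_zero (by exact_mod_cast hy.ne'), ← Complex.ofReal_log hy.le, log_div hx0.ne' (by positivity), log_mul hm0.ne' hn0.ne', bvEx, bvEx, ← Complex.exp_add, ← Complex.exp_add]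
      congr 1; push_cast; ring
    rw [e]; ring
  have hcont : ∀ m, Continuous (bvEx σ m) := fun m => by unfold bvEx; fun_prop
  have hk := bv_kernel_int hσ
  have hexp : ∀ t : ℝ, ‖Complex.exp ((log x : ℂ) * ((σ : ℂ) + t * I))‖ = exp 1 := by
    intro t
    rw [Complex.norm_exp]
    simp [hσd]
    rw [mul_inv_cancel₀ (by linarith)]
  have hint : ∀ m ∈ Icc 1 M, ∀ n ∈ Icc 1 N, Integrable (fun t : ℝ => (a m * bvEx σ m t) * (b n * bvEx σ n t) * (Complex.exp ((log x : ℂ) * ((σ : ℂ) + t * I)) * (1 / ((σ : ℂ) + t * I) ^ 2))) := by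
    intro m _ n _
    have := hcont m
    have := hcont n
    simp_rw [← mul_assoc _ (Complex.exp _)]
    refine hk.bdd_mul (c := ‖a m‖ * ‖b n‖ * exp 1) (Continuous.aestronglyMeasurable (by fun_prop)) (Eventually.of_forall fun t => ?_)
    rw [norm_mul, norm_mul, norm_mul, norm_mul, hexp]
    gcongr
    · exact mul_le_of_le_one_right (norm_nonneg _) (bvEx_norm hσ m t)
    · exact mul_le_of_le_one_right (norm_nonneg _) (bvEx_norm hσ n t)
  have h3 : ∑ m ∈ Icc 1 M, ∑ n ∈ Icc 1 N, a m * b n * (bvl (x / (m * n)) : ℂ) = (1 / (2 * π) : ℂ) *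
      ∫ t : ℝ, (∑ m ∈ Icc 1 M, a m * bvEx σ m t) * (∑ n ∈ Icc 1 N, b n * bvEx σ n t) * (Complex.exp ((log x : ℂ) * ((σ : ℂ) + t * I)) * (1 / ((σ : ℂ) + t * I) ^ 2)) := by
    simp_rw [sum_mul_sum, sum_mul]
    rw [integral_finset_sum _ (fun m hm => MeasureTheory.integrable_finset_sum _ (hint m hm)), mul_sum]
    refine sum_congr rfl fun m hm => ?_
    rw [integral_finset_sum _ (hint m hm), mul_sum]
    refine sum_congr rfl fun n hn => ?_
    rw [h1 m hm n hn]
    congr 1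
    exact MeasureTheory.integral_congr_ae (Eventually.of_forall fun t => h2 m hm n hn t)
  rw [h3, norm_mul]
  have e1 : ‖(1 / (2 * π) : ℂ)‖ = 1 / (2 * π) := by simp [abs_of_pos pi_pos]
  rw [e1]
  calc _ ≤ 1 / (2 * π) * ∫ t : ℝ, ‖(∑ m ∈ Icc 1 M, a m * bvEx σ m t) * (∑ n ∈ Icc 1 N, b n * bvEx σ n t) * (Complex.exp ((log x : ℂ) * ((σ : ℂ) + t * I)) * (1 / ((σ : ℂ) + t * I) ^ 2))‖ := by
        gcongr; exact MeasureTheory.norm_integral_le_integral_norm _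
    _ = _ := by
        rw [← integral_const_mul]
        congr 1; ext t
        rw [norm_mul, norm_mul, norm_mul, hexp, bv_kernel_norm hσ]; ring

lemma bv_kernel_real_int {σ : ℝ} (hσ : 0 < σ) : Integrable (fun t : ℝ => 1 / (σ ^ 2 + t ^ 2)) := by
  have := (bv_kernel_int hσ).norm
  simpa only [bv_kernel_norm hσ] using this

lemma bv_bilin {x : ℝ} (hx : exp 1 ≤ x) (a b : ℕ → ℂ) (M N R : ℕ) :
    ∑ r ∈ Icc 1 R, (r : ℝ) / r.totient * ∑ f ∈ bvPr r, ‖∑ m ∈ Icc 1 M, ∑ n ∈ Icc 1 N, (a m * f m) * (b n * f n) * (bvl (x / (m * n)) : ℂ)‖ ≤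
      (exp 1 / 2) * log x * (√((R ^ 2 + 41 * M) * ∑ m ∈ Icc 1 M, ‖a m‖ ^ 2) * √((R ^ 2 + 41 * N) * ∑ n ∈ Icc 1 N, ‖b n‖ ^ 2)) := by
  have hx0 : 0 < x := (exp_pos 1).trans_le hx
  have hL : 1 ≤ log x := by rwa [le_log_iff_exp_le hx0]
  set σ := 1 / log x with hσd
  have hσ : 0 < σ := by positivity
  set K := √((R ^ 2 + 41 * M) * ∑ m ∈ Icc 1 M, ‖a m‖ ^ 2) * √((R ^ 2 + 41 * N) * ∑ n ∈ Icc 1 N, ‖b n‖ ^ 2) with hK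
  set I := (Icc 1 R).sigma bvPr with hI
  set w : (Σ _ : ℕ, ℕ → ℂ) → ℝ := fun p => (p.1 : ℝ) / p.1.totient with hw
  have hw0 : ∀ p, 0 ≤ w p := fun p => by positivity
  set PA : (Σ _ : ℕ, ℕ → ℂ) → ℝ → ℝ := fun p t => ‖∑ m ∈ Icc 1 M, a m * p.2 m * bvEx σ m t‖ with hPA
  set PB : (Σ _ : ℕ, ℕ → ℂ) → ℝ → ℝ := fun p t => ‖∑ n ∈ Icc 1 N, b n * p.2 n * bvEx σ n t‖ with hPB
  have hLS : ∀ (c : ℕ → ℂ) (N : ℕ) (t : ℝ), ∑ p ∈ I, w p * ‖∑ n ∈ Icc 1 N, c n * p.2 n * bvEx σ n t‖ ^ 2 ≤ (R ^ 2 + 41 * N) * ∑ n ∈ Icc 1 N, ‖c n‖ ^ 2 := by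
    intro c N t
    have h := bv_large_sieve (fun n => c n * bvEx σ n t) N R
    rw [hI, Finset.sum_sigma]
    simp only [hw]
    simp_rw [← mul_sum]
    calc _ = _ := by
          refine sum_congr rfl fun r _ => ?_
          congr 1
          refine sum_congr rfl fun f _ => ?_
          congr 2
          refine sum_congr rfl fun n _ => ?_
          rw [mul_right_comm]
      _ ≤ _ := h
      _ ≤ _ := by
        gcongr with n _
        rw [norm_mul]; exact mul_le_of_le_one_right (norm_nonneg _) (bvEx_norm hσ n t)
  have hCS : ∀ t, ∑ p ∈ I, w p * (PA p t * PB p t) ≤ K := by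
    intro t
    have h := sum_mul_le_sqrt_mul_sqrt I (fun p => √(w p) * PA p t) (fun p => √(w p) * PB p t)
    simp only [mul_pow, sq_sqrt (hw0 _)] at h
    calc _ = ∑ p ∈ I, √(w p) * PA p t * (√(w p) * PB p t) := by
          refine sum_congr rfl fun p _ => ?_
          nth_rw 1 [← mul_self_sqrt (hw0 p)]; ring
      _ ≤ _ := h
      _ ≤ K := by
        rw [hK]
        gcongr
        · exact hLS a M t
        · exact hLS b N t
  have hcont : ∀ m, Continuous (bvEx σ m) := fun m => by unfold bvEx; fun_prop
  have hkr := bv_kernel_real_int hσ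
  have hb : ∀ (c : ℕ → ℂ) (N : ℕ) (t : ℝ), ‖∑ n ∈ Icc 1 N, c n * bvEx σ n t‖ ≤ ∑ n ∈ Icc 1 N, ‖c n‖ := by
    intro c N t
    refine (norm_sum_le _ _).trans (sum_le_sum fun n _ => ?_)
    rw [norm_mul]; exact mul_le_of_le_one_right (norm_nonneg _) (bvEx_norm hσ n t)
  have hint : ∀ p ∈ I, Integrable (fun t : ℝ => (exp 1 / (2 * π)) * (PA p t * PB p t) * (1 / (σ ^ 2 + t ^ 2))) := by
    intro p _
    refine hkr.bdd_mul (c := (exp 1 / (2 * π)) * ((∑ n ∈ Icc 1 M, ‖a n * p.2 n‖) * ∑ n ∈ Icc 1 N, ‖b n * p.2 n‖)) (Continuous.aestronglyMeasurable (by fun_prop)) (Eventually.of_forall fun t => ?_)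
    rw [norm_of_nonneg (by positivity)]
    gcongr
    · exact hb _ M t
    · exact hb _ N t
  calc _ = ∑ p ∈ I, w p * ‖∑ m ∈ Icc 1 M, ∑ n ∈ Icc 1 N, (a m * p.2 m) * (b n * p.2 n) * (bvl (x / (m * n)) : ℂ)‖ := by
        rw [hI, Finset.sum_sigma]
        simp_rw [mul_sum]; rfl
    _ ≤ ∑ p ∈ I, w p * ∫ t : ℝ, (exp 1 / (2 * π)) * (PA p t * PB p t) * (1 / (σ ^ 2 + t ^ 2)) := by
        refine sum_le_sum fun p _ => mul_le_mul_of_nonneg_left ?_ (hw0 p)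
        exact bv_bilin_f hx (fun m => a m * p.2 m) (fun n => b n * p.2 n) M N
    _ = ∫ t : ℝ, ∑ p ∈ I, w p * ((exp 1 / (2 * π)) * (PA p t * PB p t) * (1 / (σ ^ 2 + t ^ 2))) := by
        rw [integral_finset_sum _ (fun p hp => (hint p hp).const_mul _)]
        simp_rw [integral_const_mul (w _)]
    _ ≤ ∫ t : ℝ, (exp 1 / (2 * π)) * K * (1 / (σ ^ 2 + t ^ 2)) := by
        refine MeasureTheory.integral_mono (MeasureTheory.integrable_finset_sum _ fun p hp => (hint p hp).const_mul _) (hkr.const_mul _) fun t => ?_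
        calc _ = (exp 1 / (2 * π)) * (∑ p ∈ I, w p * (PA p t * PB p t)) * (1 / (σ ^ 2 + t ^ 2)) := by
              rw [mul_sum, sum_mul]
              refine sum_congr rfl fun p _ => by ring
          _ ≤ _ := by
              have := hCS t
              show _ ≤ (exp 1 / (2 * π)) * K * (1 / (σ ^ 2 + t ^ 2))
              gcongr
    _ = _ := by
        rw [integral_const_mul, bv_kernel_int_norm hσ, hσd]; field_simp

lemma bv_conv {E : Type*} [AddCommMonoid E] (F : ℕ → ℕ → E) (N : ℕ) :
    ∑ k ∈ Icc 1 N, ∑ p ∈ k.divisorsAntidiagonal, F p.1 p.2 = ∑ m ∈ Icc 1 N, ∑ n ∈ Icc 1 N, if m * n ≤ N then F m n else 0 := by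
  have e : Icc 1 N = Ioc 0 N := rfl
  rw [e]
  trans ∑ k ∈ Ioc 0 N, ∑ p ∈ Ioc 0 N ×ˢ Ioc 0 N with p.1 * p.2 = k, F p.1 p.2
  · refine sum_congr rfl fun k hk => ?_
    simp only [mem_Ioc] at hk
    rw [Nat.divisorsAntidiagonal_eq_prod_filter_of_le hk.1.ne' hk.2]
  · simp_rw [sum_filter]
    rw [sum_comm, Finset.sum_product]
    refine sum_congr rfl fun m hm => sum_congr rfl fun n hn => ?_
    simp only [mem_Ioc] at hm hn
    have : 0 < m * n := Nat.mul_pos hm.1 hn.1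
    simp [this]

lemma bv_harm (N : ℕ) : ∑ n ∈ Icc 1 N, (1 / n : ℝ) ≤ 1 + log N := by
  have h := harmonic_le_one_add_log N
  rw [harmonic_eq_sum_Icc] at h
  push_cast at h
  simpa using h

lemma bv_tau_div (N : ℕ) : ∑ n ∈ Icc 1 N, ((n.divisors.card : ℝ) / n) ≤ (1 + log N) ^ 2 := by
  have e : ∀ k ∈ Icc 1 N, ((k.divisors.card : ℝ) / k) = ∑ p ∈ k.divisorsAntidiagonal, (1 / p.1 : ℝ) * (1 / p.2) := by
    intro k _
    have : ∀ p ∈ k.divisorsAntidiagonal, (1 / p.1 : ℝ) * (1 / p.2) = 1 / k := by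
      intro p hp
      rw [← (Nat.mem_divisorsAntidiagonal.mp hp).1, one_div_mul_one_div, Nat.cast_mul]
    rw [sum_congr rfl this, sum_const, nsmul_eq_mul, ← Nat.map_div_right_divisors, card_map]; ring
  rw [sum_congr rfl e, bv_conv (fun m n => (1 / m : ℝ) * (1 / n)) N]
  calc _ ≤ ∑ m ∈ Icc 1 N, ∑ n ∈ Icc 1 N, (1 / m : ℝ) * (1 / n) := by
        refine sum_le_sum fun m _ => sum_le_sum fun n _ => ?_
        split_ifs
        · exact le_rfl
        · positivity
    _ = (∑ m ∈ Icc 1 N, (1 / m : ℝ)) ^ 2 := by rw [sq, sum_mul_sum]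
    _ ≤ _ := by
        gcongr
        exact bv_harm N

lemma bv_tau_sq (N : ℕ) : ∑ n ∈ Icc 1 N, (n.divisors.card : ℝ) ^ 2 ≤ N * (1 + log N) ^ 4 := by
  have e : ∀ k ∈ Icc 1 N, (k.divisors.card : ℝ) ^ 2 = ∑ p ∈ k.divisorsAntidiagonal, ((p.1 * p.2).divisors.card : ℝ) := by
    intro k _
    have : ∀ p ∈ k.divisorsAntidiagonal, ((p.1 * p.2).divisors.card : ℝ) = k.divisors.card := by
      intro p hp; rw [(Nat.mem_divisorsAntidiagonal.mp hp).1]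
    rw [sum_congr rfl this, sum_const, nsmul_eq_mul, ← Nat.map_div_right_divisors, card_map, sq]
  rw [sum_congr rfl e, bv_conv (fun m n => ((m * n).divisors.card : ℝ)) N]
  calc _ ≤ ∑ m ∈ Icc 1 N, ∑ n ∈ Icc 1 N, (N : ℝ) * (((m.divisors.card : ℝ) / m) * ((n.divisors.card : ℝ) / n)) := by
        refine sum_le_sum fun m hm => sum_le_sum fun n hn => ?_
        split_ifs with h
        · have hm0 : (0 : ℝ) < m := by exact_mod_cast (mem_Icc.mp hm).1
          have hn0 : (0 : ℝ) < n := by exact_mod_cast (mem_Icc.mp hn).1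
          have h1 : ((m * n).divisors.card : ℝ) ≤ m.divisors.card * n.divisors.card := by
            rw [Nat.divisors_mul]; exact_mod_cast Finset.card_mul_le
          have h2 : (m : ℝ) * n ≤ N := by exact_mod_cast h
          refine h1.trans ?_
          rw [div_mul_div_comm, ← mul_div_assoc, le_div_iff₀ (by positivity), mul_comm]
          gcongr
        · positivity
    _ = N * (∑ m ∈ Icc 1 N, ((m.divisors.card : ℝ) / m)) ^ 2 := by
        rw [sq, sum_mul_sum, mul_sum]; simp_rw [mul_sum]
    _ ≤ N * ((1 + log N) ^ 2) ^ 2 := by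
        gcongr
        exact bv_tau_div N
    _ = _ := by ring

lemma bv_Lam_sq (N : ℕ) : ∑ n ∈ Icc 1 N, (vonMangoldt n) ^ 2 ≤ 6 * N * log N := by
  have hψ := Chebyshev.psi_le_const_mul_self (x := N) (by positivity)
  have h4 : log 4 ≤ 2 := by
    rw [show (4 : ℝ) = 2 ^ 2 by norm_num, log_pow]; push_cast; linarith [log_two_lt_d9]
  rw [Chebyshev.psi, Nat.floor_natCast] at hψ
  calc _ ≤ ∑ n ∈ Icc 1 N, vonMangoldt n * log N := by
        refine sum_le_sum fun n hn => ?_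
        rw [sq]
        refine mul_le_mul_of_nonneg_left ?_ vonMangoldt_nonneg
        refine ArithmeticFunction.vonMangoldt_le_log.trans ?_
        obtain ⟨h1, h2⟩ := mem_Icc.mp hn
        exact log_le_log (by exact_mod_cast h1) (by exact_mod_cast h2)
    _ = (∑ n ∈ Ioc 0 N, vonMangoldt n) * log N := by rw [sum_mul]; rfl
    _ ≤ _ := by
        refine mul_le_mul_of_nonneg_right (hψ.trans ?_) (log_natCast_nonneg N)
        gcongr; linarith

noncomputable def bvTr (g : ArithmeticFunction ℝ) (U : ℕ) : ArithmeticFunction ℝ := ⟨fun n => if n ≤ U then g n else 0, by simp⟩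

lemma bvTr_apply (g : ArithmeticFunction ℝ) (U n : ℕ) : bvTr g U n = if n ≤ U then g n else 0 := rfl

noncomputable def bvT (g : ArithmeticFunction ℝ) (f : ℕ → ℂ) (x : ℝ) : ℂ := ∑ n ∈ Icc 1 ⌊x⌋₊, (g n : ℂ) * f n * (bvl (x / n) : ℂ)

lemma bvl_nonneg (y : ℝ) : 0 ≤ bvl y := le_max_right _ _

lemma bvl_zero {y : ℝ} (h0 : 0 ≤ y) (h : y ≤ 1) : bvl y = 0 := max_eq_right (log_nonpos h0 h)

lemma bvl_mono {y z : ℝ} (h0 : 0 ≤ y) (h : y ≤ z) : bvl y ≤ bvl z := by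
  rcases h0.eq_or_lt with rfl | hp
  · rw [bvl_zero le_rfl (by norm_num)]; exact bvl_nonneg _
  · exact max_le_max (log_le_log hp h) le_rfl

lemma bvl_eq {y : ℝ} (h : 1 ≤ y) : bvl y = log y := max_eq_left (log_nonneg h)

lemma bvT_mul (g h : ArithmeticFunction ℝ) {f : ℕ → ℂ} (hf : ∀ m n, f (m * n) = f m * f n) {x : ℝ} (hx : 0 < x) :
    bvT (g * h) f x = ∑ m ∈ Icc 1 ⌊x⌋₊, ∑ n ∈ Icc 1 ⌊x⌋₊, ((g m : ℂ) * f m) * ((h n : ℂ) * f n) * (bvl (x / (m * n)) : ℂ) := by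
  have e : bvT (g * h) f x = ∑ k ∈ Icc 1 ⌊x⌋₊, ∑ p ∈ k.divisorsAntidiagonal, ((g p.1 : ℂ) * f p.1) * ((h p.2 : ℂ) * f p.2) * (bvl (x / (p.1 * p.2)) : ℂ) := by
    refine sum_congr rfl fun k _ => ?_
    rw [ArithmeticFunction.mul_apply]
    push_cast
    rw [sum_mul, sum_mul]
    refine sum_congr rfl fun p hp => ?_
    rw [← (Nat.mem_divisorsAntidiagonal.mp hp).1, hf]
    push_cast; ring
  rw [e, bv_conv (fun m n => ((g m : ℂ) * f m) * ((h n : ℂ) * f n) * (bvl (x / (m * n)) : ℂ))]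
  refine sum_congr rfl fun m hm => sum_congr rfl fun n hn => ?_
  split_ifs with hmn
  · rfl
  · have h1 : x < (m * n : ℕ) := (Nat.floor_lt hx.le).mp (not_le.mp hmn)
    push_cast at h1
    rw [bvl_zero (by positivity) ((div_le_one (hx.trans h1)).mpr h1.le)]; simp

lemma bvT_add (g h : ArithmeticFunction ℝ) (f : ℕ → ℂ) (x : ℝ) : bvT (g + h) f x = bvT g f x + bvT h f x := by
  rw [bvT, bvT, bvT, ← sum_add_distrib]
  refine sum_congr rfl fun n _ => ?_
  rw [ArithmeticFunction.add_apply]; push_cast; ring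

lemma bvT_neg (g : ArithmeticFunction ℝ) (f : ℕ → ℂ) (x : ℝ) : bvT (-g) f x = -bvT g f x := by
  rw [bvT, bvT, ← Finset.sum_neg_distrib]
  refine sum_congr rfl fun n _ => ?_
  rw [ArithmeticFunction.neg_apply]; push_cast; ring

open ArithmeticFunction in
lemma bv_vaughan (U : ℕ) : (vonMangoldt : ArithmeticFunction ℝ) = (bvTr ((moebius : ArithmeticFunction ℤ) : ArithmeticFunction ℝ) U) * ArithmeticFunction.log + bvTr vonMangoldt U
    + -((bvTr vonMangoldt U * bvTr ((moebius : ArithmeticFunction ℤ) : ArithmeticFunction ℝ) U) * (zeta : ArithmeticFunction ℝ))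
    + (vonMangoldt - bvTr vonMangoldt U) * (((moebius : ArithmeticFunction ℤ) : ArithmeticFunction ℝ) - bvTr ((moebius : ArithmeticFunction ℤ) : ArithmeticFunction ℝ) U) * (zeta : ArithmeticFunction ℝ) := by
  have h1 : (vonMangoldt : ArithmeticFunction ℝ) * (zeta : ArithmeticFunction ℝ) = ArithmeticFunction.log := vonMangoldt_mul_zeta
  have h2 : ((moebius : ArithmeticFunction ℤ) : ArithmeticFunction ℝ) * (zeta : ArithmeticFunction ℝ) = 1 := coe_moebius_mul_coe_zeta
  rw [← h1]
  linear_combination (bvTr vonMangoldt U - vonMangoldt) * h2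

lemma bv_abel {f : ℕ → ℂ} {C : ℝ} (hC : ∀ n, ‖∑ k ∈ Icc 1 n, f k‖ ≤ C) {w : ℕ → ℝ} (hw0 : ∀ n, 0 ≤ w n) (hw : ∀ n, 1 ≤ n → w (n + 1) ≤ w n) (N : ℕ) :
    ‖∑ n ∈ Icc 1 N, f n * (w n : ℂ)‖ ≤ C * w 1 := by
  have h1 : ∀ N, ∑ n ∈ Icc 1 N, f n * (w n : ℂ) = (∑ k ∈ Icc 1 N, f k) * (w (N + 1) : ℂ) + ∑ n ∈ Icc 1 N, (∑ k ∈ Icc 1 n, f k) * ((w n - w (n + 1) : ℝ) : ℂ) := by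
    intro N
    induction N with
    | zero => simp
    | succ N ih =>
      rw [sum_Icc_succ_top (by omega), ih, sum_Icc_succ_top (by omega), sum_Icc_succ_top (by omega) (fun n => (∑ k ∈ Icc 1 n, f k) * ((w n - w (n + 1) : ℝ) : ℂ)), sum_Icc_succ_top (by omega)]
      push_cast; ring
  have h2 : ∀ N, ∑ n ∈ Icc 1 N, (w n - w (n + 1)) = w 1 - w (N + 1) := by
    intro N
    induction N with
    | zero => simp
    | succ N ih => rw [sum_Icc_succ_top (by omega), ih]; ring
  rw [h1]
  refine (norm_add_le _ _).trans ?_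
  have h3 : ‖∑ n ∈ Icc 1 N, (∑ k ∈ Icc 1 n, f k) * ((w n - w (n + 1) : ℝ) : ℂ)‖ ≤ C * (w 1 - w (N + 1)) := by
    rw [← h2, mul_sum]
    refine (norm_sum_le _ _).trans (sum_le_sum fun n hn => ?_)
    have := hw n (mem_Icc.mp hn).1
    rw [norm_mul, norm_real, norm_of_nonneg (by linarith)]
    exact mul_le_mul_of_nonneg_right (hC n) (by linarith)
  have h4 : ‖(∑ k ∈ Icc 1 N, f k) * (w (N + 1) : ℂ)‖ ≤ C * w (N + 1) := by
    rw [norm_mul, norm_real, norm_of_nonneg (hw0 _)]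
    exact mul_le_mul_of_nonneg_right (hC N) (hw0 _)
  linarith

lemma bvTr_sum {g : ArithmeticFunction ℝ} {U N : ℕ} {B : ℝ} (hB : 0 ≤ B) (h : ∀ n ∈ Icc 1 N, |g n| ≤ B) :
    ∑ n ∈ Icc 1 N, |bvTr g U n| ≤ U * B := by
  calc _ ≤ ∑ n ∈ Icc 1 N, if n ≤ U then B else 0 := by
        refine sum_le_sum fun n hn => ?_
        rw [bvTr_apply]
        split_ifs
        · exact h n hn
        · simp
    _ = ((Icc 1 N).filter (fun n => n ≤ U)).card * B := by rw [← sum_filter, sum_const, nsmul_eq_mul]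
    _ ≤ U * B := by
        gcongr
        refine (Finset.card_le_card (t := Icc 1 U) fun n hn => ?_).trans_eq (by simp)
        simp only [mem_filter, mem_Icc] at hn ⊢
        exact ⟨hn.1.1, hn.2⟩

lemma bvT_mul_le (g h : ArithmeticFunction ℝ) {f : ℕ → ℂ} (hf : ∀ m n, f (m * n) = f m * f n) (hf1 : ∀ n, ‖f n‖ ≤ 1) {x B : ℝ} (hx : 0 < x)
    (hB : ∀ m : ℕ, 1 ≤ m → ‖∑ n ∈ Icc 1 ⌊x⌋₊, (h n : ℂ) * f n * (bvl (x / m / n) : ℂ)‖ ≤ B) :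
    ‖bvT (g * h) f x‖ ≤ (∑ m ∈ Icc 1 ⌊x⌋₊, |g m|) * B := by
  rw [bvT_mul g h hf hx, sum_mul]
  refine (norm_sum_le _ _).trans (sum_le_sum fun m hm => ?_)
  have h1 := hB m (mem_Icc.mp hm).1
  have e : ∑ n ∈ Icc 1 ⌊x⌋₊, ((g m : ℂ) * f m) * ((h n : ℂ) * f n) * (bvl (x / (m * n)) : ℂ) = ((g m : ℂ) * f m) * ∑ n ∈ Icc 1 ⌊x⌋₊, (h n : ℂ) * f n * (bvl (x / m / n) : ℂ) := by
    rw [mul_sum]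
    refine sum_congr rfl fun n _ => ?_
    rw [div_div]; ring
  rw [e, norm_mul, norm_mul, norm_real, norm_eq_abs]
  have h2 : |g m| * ‖f m‖ ≤ |g m| := mul_le_of_le_one_right (abs_nonneg _) (hf1 m)
  gcongr

lemma bvl_anti {y : ℝ} (hy : 0 ≤ y) {n : ℕ} (hn : 1 ≤ n) : bvl (y / (n + 1 : ℕ)) ≤ bvl (y / n) := by
  have : (0 : ℝ) < n := by exact_mod_cast hn
  refine bvl_mono (by positivity) ?_
  push_cast
  gcongr; linarith

lemma bvl_le {x : ℝ} (hx : 1 ≤ x) {m : ℕ} (hm : 1 ≤ m) : bvl (x / m) ≤ log x := by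
  rw [← bvl_eq hx]
  have : (1 : ℝ) ≤ m := by exact_mod_cast hm
  exact bvl_mono (by positivity) (div_le_self (by linarith) this)

open ArithmeticFunction in
lemma bv_typeI {x C : ℝ} {f : ℕ → ℂ} {U : ℕ} (hx : exp 1 ≤ x) (hC : 1 ≤ C) (hf : ∀ m n, f (m * n) = f m * f n) (hf1 : ∀ n, ‖f n‖ ≤ 1)
    (hp : ∀ n, ‖∑ k ∈ Icc 1 n, f k‖ ≤ C) (hU : 1 ≤ U) :
    ‖bvT vonMangoldt f x‖ ≤ 4 * C * U ^ 2 * (log x) ^ 2 + ‖bvT ((vonMangoldt - bvTr vonMangoldt U) * ((((moebius : ArithmeticFunction ℤ) : ArithmeticFunction ℝ) - bvTr ((moebius : ArithmeticFunction ℤ) : ArithmeticFunction ℝ) U) * (zeta : ArithmeticFunction ℝ))) f x‖ := by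
  have hx0 : 0 < x := (exp_pos 1).trans_le hx
  have hL : 1 ≤ log x := by rwa [le_log_iff_exp_le hx0]
  have hx1 : 1 ≤ x := by linarith [add_one_le_exp 1]
  set L := log x with hLd
  have hU' : (1 : ℝ) ≤ U := by exact_mod_cast hU
  have hC0 : 0 ≤ C := by linarith
  set μ₁ := bvTr ((moebius : ArithmeticFunction ℤ) : ArithmeticFunction ℝ) U with hμ
  have hμs : ∑ n ∈ Icc 1 ⌊x⌋₊, |μ₁ n| ≤ U * 1 := bvTr_sum zero_le_one fun n _ => by
    rw [intCoe_apply]; exact_mod_cast abs_moebius_le_one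
  have hΛL : ∀ n ∈ Icc 1 ⌊x⌋₊, |vonMangoldt n| ≤ L := by
    intro n hn
    obtain ⟨h1, h2⟩ := mem_Icc.mp hn
    rw [abs_of_nonneg vonMangoldt_nonneg]
    exact vonMangoldt_le_log.trans (log_le_log (by exact_mod_cast h1) ((Nat.le_floor_iff hx0.le).mp h2))
  have hΛs := bvTr_sum (U := U) (by linarith) hΛL
  have hin1 : ∀ m : ℕ, 1 ≤ m → ∀ k : ℕ, ‖∑ n ∈ Icc 1 ⌊x⌋₊, f n * ((bvl (x / m / n) ^ k : ℝ) : ℂ)‖ ≤ C * bvl (x / m) ^ k := by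
    intro m hm k
    have := bv_abel hp (w := fun n => bvl (x / m / n) ^ k) (fun n => pow_nonneg (bvl_nonneg _) k) (fun n hn => pow_le_pow_left₀ (bvl_nonneg _) (bvl_anti (by positivity) hn) k) ⌊x⌋₊
    simpa using this
  have t1 : ‖bvT (μ₁ * ArithmeticFunction.log) f x‖ ≤ U * (2 * C * L ^ 2) := by
    refine (bvT_mul_le _ _ hf hf1 hx0 (B := 2 * C * L ^ 2) fun m hm => ?_).trans ?_
    · have e : ∑ n ∈ Icc 1 ⌊x⌋₊, ((ArithmeticFunction.log n : ℝ) : ℂ) * f n * (bvl (x / m / n) : ℂ) =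
          (bvl (x / m) : ℂ) * ∑ n ∈ Icc 1 ⌊x⌋₊, f n * ((bvl (x / m / n) ^ 1 : ℝ) : ℂ) - ∑ n ∈ Icc 1 ⌊x⌋₊, f n * ((bvl (x / m / n) ^ 2 : ℝ) : ℂ) := by
        rw [mul_sum, ← sum_sub_distrib]
        refine sum_congr rfl fun n hn => ?_
        have hn1 : (1 : ℝ) ≤ n := by exact_mod_cast (mem_Icc.mp hn).1
        have hm1 : (1 : ℝ) ≤ m := by exact_mod_cast hm
        rw [log_apply]
        have : Real.log n * bvl (x / m / n) = bvl (x / m) * bvl (x / m / n) - bvl (x / m / n) ^ 2 := by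
          rcases le_total (x / m / n) 1 with h | h
          · rw [bvl_zero (by positivity) h]; ring
          · have h' : 1 ≤ x / m := h.trans (div_le_self (by positivity) hn1)
            rw [bvl_eq h, bvl_eq h', log_div (by positivity) (by positivity)]; ring
        calc ((Real.log n : ℝ) : ℂ) * f n * (bvl (x / m / n) : ℂ) = f n * ((Real.log n * bvl (x / m / n) : ℝ) : ℂ) := by push_cast; ring
          _ = _ := by rw [this]; push_cast; ring
      rw [e]
      refine (norm_sub_le _ _).trans ?_
      rw [norm_mul, norm_real, norm_of_nonneg (bvl_nonneg _)]
      have b0 := bvl_nonneg (x / m)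
      have b1 := hin1 m hm 1
      have b2 := hin1 m hm 2
      have b3 := bvl_le hx1 hm
      have b4 : bvl (x / m) ^ 2 ≤ L ^ 2 := by gcongr
      calc _ ≤ bvl (x / m) * (C * bvl (x / m) ^ 1) + C * bvl (x / m) ^ 2 := by gcongr
        _ = 2 * C * bvl (x / m) ^ 2 := by ring
        _ ≤ _ := by gcongr
    · gcongr; linarith
  have t2 : ‖bvT (bvTr vonMangoldt U) f x‖ ≤ U * L * L := by
    calc _ ≤ ∑ n ∈ Icc 1 ⌊x⌋₊, |bvTr vonMangoldt U n| * L := by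
          refine (norm_sum_le _ _).trans (sum_le_sum fun n hn => ?_)
          rw [norm_mul, norm_mul, norm_real, norm_real, norm_eq_abs, norm_of_nonneg (bvl_nonneg _)]
          have h2 := mul_le_of_le_one_right (abs_nonneg (bvTr vonMangoldt U n)) (hf1 n)
          have := bvl_le hx1 (mem_Icc.mp hn).1
          have := bvl_nonneg (x / n)
          gcongr
      _ ≤ _ := by rw [← sum_mul]; gcongr
  have t3 : ‖bvT ((bvTr vonMangoldt U * μ₁) * (zeta : ArithmeticFunction ℝ)) f x‖ ≤ (U * L * U) * (C * L) := by
    refine (bvT_mul_le _ _ hf hf1 hx0 (B := C * L) fun m hm => ?_).trans ?_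
    · have h1 := hin1 m hm 1
      have e : ∑ n ∈ Icc 1 ⌊x⌋₊, (((zeta : ArithmeticFunction ℝ) n : ℝ) : ℂ) * f n * (bvl (x / m / n) : ℂ) = ∑ n ∈ Icc 1 ⌊x⌋₊, f n * ((bvl (x / m / n) ^ 1 : ℝ) : ℂ) := by
        refine sum_congr rfl fun n hn => ?_
        have : n ≠ 0 := by have := (mem_Icc.mp hn).1; omega
        simp [natCoe_apply, zeta_apply, this]
      rw [e]
      refine h1.trans ?_
      rw [pow_one]
      gcongr; exact bvl_le hx1 hm
    · gcongr
      calc _ ≤ ∑ k ∈ Icc 1 ⌊x⌋₊, ∑ p ∈ k.divisorsAntidiagonal, |bvTr vonMangoldt U p.1| * |μ₁ p.2| := by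
            refine sum_le_sum fun k _ => ?_
            rw [mul_apply]
            refine (abs_sum_le_sum_abs _ _).trans_eq ?_
            simp_rw [abs_mul]
        _ ≤ ∑ m ∈ Icc 1 ⌊x⌋₊, ∑ n ∈ Icc 1 ⌊x⌋₊, |bvTr vonMangoldt U m| * |μ₁ n| := by
            rw [bv_conv (fun m n => |bvTr vonMangoldt U m| * |μ₁ n|)]
            refine sum_le_sum fun m _ => sum_le_sum fun n _ => ?_
            split_ifs
            · exact le_rfl
            · positivity
        _ = (∑ m ∈ Icc 1 ⌊x⌋₊, |bvTr vonMangoldt U m|) * ∑ n ∈ Icc 1 ⌊x⌋₊, |μ₁ n| := by rw [sum_mul_sum]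
        _ ≤ (U * L) * U := by
            rw [mul_one] at hμs
            gcongr
  rw [bv_vaughan U, bvT_add, bvT_add, bvT_add, bvT_neg, ← bv_vaughan U, mul_assoc (vonMangoldt - bvTr vonMangoldt U)]
  refine (norm_add_le _ _).trans (add_le_add_left ?_ _)
  refine (norm_add_le _ _).trans ?_
  rw [norm_neg]
  refine (add_le_add (norm_add_le _ _) le_rfl).trans ?_
  have u1 : (U : ℝ) ≤ U ^ 2 := by nlinarith
  have k1 : U * (2 * C * L ^ 2) ≤ U ^ 2 * (2 * C * L ^ 2) := by gcongr
  have k2 : U * L * L ≤ U ^ 2 * C * L ^ 2 := by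
    calc U * L * L = U * 1 * L ^ 2 := by ring
      _ ≤ _ := by gcongr
  linarith [show (U * L * U) * (C * L) = U ^ 2 * C * L ^ 2 by ring]

lemma bv_box {F : ℕ → ℕ → ℂ} {M N M' N' : ℕ} (hM : M ≤ M') (hN : N ≤ N') (h1 : ∀ m n, 1 ≤ m → 1 ≤ n → M < m → F m n = 0)
    (h2 : ∀ m n, 1 ≤ m → 1 ≤ n → N < n → F m n = 0) :
    ∑ m ∈ Icc 1 M, ∑ n ∈ Icc 1 N, F m n = ∑ m ∈ Icc 1 M', ∑ n ∈ Icc 1 N', F m n := by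
  have e : ∀ m ∈ Icc 1 M', ∑ n ∈ Icc 1 N, F m n = ∑ n ∈ Icc 1 N', F m n := by
    intro m hm
    refine sum_subset (Icc_subset_Icc_right hN) fun n hn hn' => ?_
    simp only [mem_Icc] at hm hn hn'
    exact h2 m n hm.1 hn.1 (by omega)
  rw [← sum_congr rfl e]
  refine sum_subset (Icc_subset_Icc_right hM) fun m hm hm' => ?_
  simp only [mem_Icc] at hm hm'
  refine sum_eq_zero fun n hn => h1 m n hm.1 (mem_Icc.mp hn).1 (by omega)

lemma bv_blk_arith {x L R U M y P1 P2 : ℝ} (hx : 0 < x) (hL : 1 ≤ L) (hR : 0 ≤ R) (hU : 0 < U) (hM : U ≤ M) (hy : U ≤ y) (hMy : M * y = 2 * x)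
    (h1 : P1 ≤ (R ^ 2 + 41 * M) * (12 * M * L)) (h2 : P2 ≤ (R ^ 2 + 41 * y) * (16 * y * L ^ 4)) :
    √P1 * √P2 ≤ 1140 * L ^ 3 * (√x * R ^ 2 + R * (x / √U) + x) := by
  have hM0 : 0 < M := hU.trans_le hM
  have hy0 : 0 < y := hU.trans_le hy
  have a1 : M ≤ 2 * x / U := by
    rw [le_div_iff₀ hU, ← hMy]; exact mul_le_mul_of_nonneg_left hy hM0.le
  have a2 : y ≤ 2 * x / U := by
    rw [le_div_iff₀ hU, ← hMy, mul_comm M]; exact mul_le_mul_of_nonneg_left hM hy0.le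
  have hL0 : 0 < L := by linarith
  calc √P1 * √P2 ≤ √((R ^ 2 + 41 * M) * (12 * M * L)) * √((R ^ 2 + 41 * y) * (16 * y * L ^ 4)) := by gcongr
    _ = √(((R ^ 2 + 41 * M) * (12 * M * L)) * ((R ^ 2 + 41 * y) * (16 * y * L ^ 4))) := by
        rw [← sqrt_mul (by positivity)]
    _ ≤ _ := by
        refine sqrt_le_iff.mpr ⟨by positivity, ?_⟩
        have e1 : ((R ^ 2 + 41 * M) * (12 * M * L)) * ((R ^ 2 + 41 * y) * (16 * y * L ^ 4)) = 384 * x * L ^ 5 * (R ^ 4 + 41 * R ^ 2 * (M + y) + 3362 * x) := by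
          have : ((R ^ 2 + 41 * M) * (12 * M * L)) * ((R ^ 2 + 41 * y) * (16 * y * L ^ 4)) = 192 * (M * y) * L ^ 5 * (R ^ 4 + 41 * R ^ 2 * (M + y) + 1681 * (M * y)) := by ring
          rw [this, hMy]; ring
        rw [e1]
        have e2 : (1140 * L ^ 3 * (√x * R ^ 2 + R * (x / √U) + x)) ^ 2 ≥ 1140 ^ 2 * L ^ 6 * (x * R ^ 4 + R ^ 2 * (x ^ 2 / U) + x ^ 2) := by
          have s1 : (√x) ^ 2 = x := sq_sqrt hx.le
          have s2 : (x / √U) ^ 2 = x ^ 2 / U := by rw [div_pow, sq_sqrt hU.le]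
          have hA : 0 ≤ √x * R ^ 2 := by positivity
          have hB : 0 ≤ R * (x / √U) := by positivity
          have : x * R ^ 4 + R ^ 2 * (x ^ 2 / U) + x ^ 2 ≤ (√x * R ^ 2 + R * (x / √U) + x) ^ 2 := by
            have : x * R ^ 4 + R ^ 2 * (x ^ 2 / U) = (√x * R ^ 2) ^ 2 + (R * (x / √U)) ^ 2 := by
              rw [mul_pow, mul_pow, s1, s2]; ring
            rw [this]
            nlinarith [mul_nonneg hA hB, mul_nonneg hA hx.le, mul_nonneg hB hx.le]
          calc _ ≤ 1140 ^ 2 * L ^ 6 * (√x * R ^ 2 + R * (x / √U) + x) ^ 2 := by gcongr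
            _ = _ := by ring
        refine le_trans ?_ e2
        have b1 : 384 * x * L ^ 5 * (R ^ 4 + 41 * R ^ 2 * (M + y) + 3362 * x) ≤ 384 * x * L ^ 6 * (R ^ 4 + 41 * R ^ 2 * (4 * x / U) + 3362 * x) := by
          have : M + y ≤ 4 * x / U := by
            have : 4 * x / U = 2 * x / U + 2 * x / U := by ring
            linarith
          have hLL : L ^ 5 ≤ L ^ 6 := pow_le_pow_right₀ hL (by norm_num)
          gcongr
        refine b1.trans ?_
        have c1 : 0 ≤ L ^ 6 * (x * R ^ 4) := by positivity
        have c2 : 0 ≤ L ^ 6 * (R ^ 2 * (x ^ 2 / U)) := by positivity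
        have c3 : 0 ≤ L ^ 6 * (x ^ 2) := by positivity
        have : 384 * x * L ^ 6 * (R ^ 4 + 41 * R ^ 2 * (4 * x / U) + 3362 * x) = 384 * (L ^ 6 * (x * R ^ 4)) + 62976 * (L ^ 6 * (R ^ 2 * (x ^ 2 / U))) + 1291008 * (L ^ 6 * (x ^ 2)) := by
          ring
        rw [this]
        nlinarith

lemma bvPr_mul {r : ℕ} {f : ℕ → ℂ} (hf : f ∈ bvPr r) (m n : ℕ) : f (m * n) = f m * f n := by
  rcases Nat.eq_zero_or_pos r with rfl | hr
  · simp [bvPr] at hf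
  · haveI : NeZero r := ⟨hr.ne'⟩
    obtain ⟨χ, _, rfl⟩ := bvPr_mem.mp hf
    simp

lemma bv_typeII_blk {x : ℝ} (hx : exp 1 ≤ x) {g h : ArithmeticFunction ℝ} {U : ℕ} (hU : 1 ≤ U)
    (hg : ∀ n, n ≤ U → g n = 0) (hh : ∀ n, n ≤ U → h n = 0) (hg1 : ∀ n, |g n| ≤ vonMangoldt n)
    (hh1 : ∀ n, |h n| ≤ (n.divisors.card : ℝ)) (R j : ℕ) (hj : (2 : ℝ) ^ j ≤ x) :
    ∑ r ∈ Icc 1 R, (r : ℝ) / r.totient * ∑ f ∈ bvPr r, ‖∑ m ∈ Icc 1 ⌊x⌋₊, ∑ n ∈ Icc 1 ⌊x⌋₊, (((if Nat.log 2 m = j then g m else 0 : ℝ) : ℂ) * f m) * ((h n : ℂ) * f n) * (bvl (x / (m * n)) : ℂ)‖ ≤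
      1600 * (log x) ^ 4 * (√x * R ^ 2 + R * (x / √U) + x) := by
  have hx0 : 0 < x := (exp_pos 1).trans_le hx
  have hL : 1 ≤ log x := by rwa [le_log_iff_exp_le hx0]
  have hx1 : 1 ≤ x := by linarith [add_one_le_exp 1]
  set α : ℕ → ℝ := fun m => if Nat.log 2 m = j then g m else 0 with hα
  have hsup : ∀ m, α m ≠ 0 → 2 ^ j ≤ m ∧ m < 2 ^ (j + 1) := by
    intro m hm
    simp only [hα] at hm
    split_ifs at hm with hl
    · have hm0 : m ≠ 0 := by rintro rfl; simp at hm
      refine ⟨?_, ?_⟩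
      · rw [← hl]; exact Nat.pow_log_le_self 2 hm0
      · rw [← hl]; exact Nat.lt_pow_succ_log_self (by norm_num) m
    · exact absurd rfl hm
  have hbl : ∀ m n : ℕ, 1 ≤ m → 1 ≤ n → x ≤ (m : ℝ) * n → bvl (x / (m * n)) = 0 := by
    intro m n hm hn hmn
    have : (0 : ℝ) < m * n := by
      have : (0 : ℝ) < m := by exact_mod_cast hm
      have : (0 : ℝ) < n := by exact_mod_cast hn
      positivity
    exact bvl_zero (by positivity) ((div_le_one this).mpr hmn)
  set M : ℕ := 2 ^ (j + 1) with hM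
  set K : ℕ := ⌊x / 2 ^ j⌋₊ with hK
  have hbox : ∀ f : ℕ → ℂ, ∑ m ∈ Icc 1 ⌊x⌋₊, ∑ n ∈ Icc 1 ⌊x⌋₊, ((α m : ℂ) * f m) * ((h n : ℂ) * f n) * (bvl (x / (m * n)) : ℂ) =
      ∑ m ∈ Icc 1 M, ∑ n ∈ Icc 1 K, ((α m : ℂ) * f m) * ((h n : ℂ) * f n) * (bvl (x / (m * n)) : ℂ) := by
    intro f
    rw [bv_box (le_max_left ⌊x⌋₊ M) (le_max_left ⌊x⌋₊ K), bv_box (M := M) (N := K) (le_max_right ⌊x⌋₊ M) (le_max_right ⌊x⌋₊ K)]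
    · intro m n hm hn hlt
      have : α m = 0 := by
        by_contra hc
        have := (hsup m hc).2
        omega
      simp [this]
    · intro m n hm hn hlt
      by_cases hc : α m = 0
      · simp [hc]
      · have h1 := (hsup m hc).1
        rw [hK, Nat.floor_lt (by positivity), div_lt_iff₀ (by positivity)] at hlt
        have h1' : (2 : ℝ) ^ j ≤ m := by exact_mod_cast h1
        rw [hbl m n hm hn]
        · simp
        · have : (n : ℝ) * 2 ^ j ≤ n * m := by gcongr
          linarith
    · intro m n hm hn hlt
      have : x < m := (Nat.floor_lt hx0.le).mp hlt
      have h1n : (1 : ℝ) ≤ n := by exact_mod_cast hn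
      rw [hbl m n hm hn (by nlinarith)]; simp
    · intro m n hm hn hlt
      have : x < n := (Nat.floor_lt hx0.le).mp hlt
      have h1n : (1 : ℝ) ≤ m := by exact_mod_cast hm
      rw [hbl m n hm hn (by nlinarith)]; simp
  have hU0 : (0 : ℝ) < U := by exact_mod_cast hU
  have hpos : 0 ≤ 1600 * (log x) ^ 4 * (√x * R ^ 2 + R * (x / √U) + x) := by positivity
  by_cases hz : M ≤ U ∨ K ≤ U
  · refine le_trans (le_of_eq ?_) hpos
    refine sum_eq_zero fun r _ => ?_
    rw [sum_eq_zero, mul_zero]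
    intro f _
    rw [hbox, sum_eq_zero, norm_zero]
    intro m hm
    refine sum_eq_zero fun n hn => ?_
    rcases hz with hz | hz
    · have : α m = 0 := by
        simp only [hα]; rw [hg m ((mem_Icc.mp hm).2.trans hz)]; simp
      simp [this]
    · rw [hh n ((mem_Icc.mp hn).2.trans hz)]; simp
  · push Not at hz
    have hb := bv_bilin hx (fun m => (α m : ℂ)) (fun n => (h n : ℂ)) M K R
    simp only [← hbox] at hb
    refine hb.trans ?_
    set y : ℝ := x / 2 ^ j with hy
    have hKy : (K : ℝ) ≤ y := Nat.floor_le (by positivity)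
    have hy0 : 0 < y := by positivity
    have hMy : (M : ℝ) * y = 2 * x := by
      rw [hM, hy]; push_cast; field_simp; ring
    have hMx : (M : ℝ) ≤ 2 * x := by
      rw [hM]; push_cast; rw [pow_succ]; linarith
    have hM1 : (1 : ℝ) ≤ M := by
      have : 1 ≤ M := Nat.one_le_two_pow
      exact_mod_cast this
    have hlogM : log M ≤ 2 * log x := by
      refine (log_le_log (by linarith) hMx).trans ?_
      rw [log_mul (by norm_num) hx0.ne']
      linarith [log_two_lt_d9]
    have hK1 : (1 : ℝ) ≤ K := by
      have : 1 ≤ K := by omega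
      exact_mod_cast this
    have hlogK : log K ≤ log x := by
      refine log_le_log (by linarith) (hKy.trans ?_)
      exact div_le_self hx0.le (one_le_pow₀ (by norm_num))
    have s1 : ∑ m ∈ Icc 1 M, ‖(α m : ℂ)‖ ^ 2 ≤ 12 * M * log x := by
      calc _ ≤ ∑ m ∈ Icc 1 M, (vonMangoldt m) ^ 2 := by
            refine sum_le_sum fun m _ => ?_
            refine pow_le_pow_left₀ (norm_nonneg _) ?_ 2
            rw [norm_real, norm_eq_abs]
            simp only [hα]
            split_ifs
            · exact hg1 m
            · simp [vonMangoldt_nonneg]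
        _ ≤ 6 * M * log M := bv_Lam_sq M
        _ ≤ 6 * M * (2 * log x) := by gcongr
        _ = _ := by ring
    have s2 : ∑ n ∈ Icc 1 K, ‖(h n : ℂ)‖ ^ 2 ≤ 16 * y * (log x) ^ 4 := by
      calc _ ≤ ∑ n ∈ Icc 1 K, (n.divisors.card : ℝ) ^ 2 := by
            refine sum_le_sum fun m _ => ?_
            refine pow_le_pow_left₀ (norm_nonneg _) ?_ 2
            rw [norm_real, norm_eq_abs]
            exact hh1 m
        _ ≤ K * (1 + log K) ^ 4 := bv_tau_sq K
        _ ≤ y * (2 * log x) ^ 4 := by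
            have : 0 ≤ log K := log_nonneg hK1
            gcongr
            linarith
        _ = _ := by ring
    have hUM : (U : ℝ) ≤ M := by exact_mod_cast hz.1.le
    have hUy : (U : ℝ) ≤ y := le_trans (by exact_mod_cast hz.2.le) hKy
    have key := bv_blk_arith (x := x) (L := log x) (R := R) (U := U) (M := M) (y := y) hx0 hL (by positivity) hU0 hUM hUy hMy
      (mul_le_mul_of_nonneg_left s1 (by positivity : (0 : ℝ) ≤ (R : ℝ) ^ 2 + 41 * M)) (le_trans (mul_le_mul_of_nonneg_left s2 (by positivity : (0 : ℝ) ≤ (R : ℝ) ^ 2 + 41 * K))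
        (mul_le_mul_of_nonneg_right (by linarith) (by positivity)))
    have he : exp 1 / 2 ≤ 1.4 := by linarith [exp_one_lt_d9]
    calc _ ≤ 1.4 * log x * (1140 * (log x) ^ 3 * (√x * R ^ 2 + R * (x / √U) + x)) := by
          refine mul_le_mul ?_ key (by positivity) (by positivity)
          exact mul_le_mul_of_nonneg_right he (by linarith)
      _ = 1596 * ((log x) ^ 4 * (√x * R ^ 2 + R * (x / √U) + x)) := by ring
      _ ≤ 1600 * ((log x) ^ 4 * (√x * R ^ 2 + R * (x / √U) + x)) := by gcongr; norm_num
      _ = _ := by ring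

lemma bv_typeII {x : ℝ} (hx : exp 1 ≤ x) {g h : ArithmeticFunction ℝ} {U : ℕ} (hU : 1 ≤ U)
    (hg : ∀ n, n ≤ U → g n = 0) (hh : ∀ n, n ≤ U → h n = 0) (hg1 : ∀ n, |g n| ≤ vonMangoldt n)
    (hh1 : ∀ n, |h n| ≤ (n.divisors.card : ℝ)) (R : ℕ) :
    ∑ r ∈ Icc 1 R, (r : ℝ) / r.totient * ∑ f ∈ bvPr r, ‖bvT (g * h) f x‖ ≤
      4800 * (log x) ^ 5 * (√x * R ^ 2 + R * (x / √U) + x) := by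
  have hx0 : 0 < x := (exp_pos 1).trans_le hx
  have hL : 1 ≤ log x := by rwa [le_log_iff_exp_le hx0]
  have hx1 : 1 ≤ x := by linarith [add_one_le_exp 1]
  have hN0 : ⌊x⌋₊ ≠ 0 := (Nat.floor_pos.mpr hx1).ne'
  set J := Nat.log 2 ⌊x⌋₊ + 1 with hJ
  have hsplit : ∀ r, ∀ f ∈ bvPr r, ‖bvT (g * h) f x‖ ≤ ∑ j ∈ range J, ‖∑ m ∈ Icc 1 ⌊x⌋₊, ∑ n ∈ Icc 1 ⌊x⌋₊, (((if Nat.log 2 m = j then g m else 0 : ℝ) : ℂ) * f m) * ((h n : ℂ) * f n) * (bvl (x / (m * n)) : ℂ)‖ := by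
    intro r f hf
    refine le_trans (le_of_eq ?_) (norm_sum_le _ _)
    rw [bvT_mul g h (bvPr_mul hf) hx0]
    congr 1
    symm
    rw [sum_comm]
    refine sum_congr rfl fun m hm => ?_
    rw [sum_comm]
    refine sum_congr rfl fun n hn => ?_
    simp only [← sum_mul]
    congr 3
    rw [← Complex.ofReal_sum, Finset.sum_ite_eq, if_pos]
    rw [Finset.mem_range, hJ]
    exact Nat.lt_succ_of_le (Nat.log_mono_right (mem_Icc.mp hm).2)
  have hpow : ∀ j ∈ range J, (2 : ℝ) ^ j ≤ x := by
    intro j hj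
    have : 2 ^ j ≤ ⌊x⌋₊ := Nat.pow_le_of_le_log hN0 (by rw [Finset.mem_range] at hj; omega)
    have h2 : ((2 ^ j : ℕ) : ℝ) ≤ ⌊x⌋₊ := by exact_mod_cast this
    push_cast at h2
    exact h2.trans (Nat.floor_le hx0.le)
  have hJL : (J : ℝ) ≤ 3 * log x := by
    have h1 := hpow (Nat.log 2 ⌊x⌋₊) (by simp [hJ])
    have h2 := log_le_log (by positivity) h1
    rw [log_pow] at h2
    rw [hJ]; push_cast
    have := log_two_gt_d9
    have h3 : (0 : ℝ) ≤ (Nat.log 2 ⌊x⌋₊ : ℝ) := by positivity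
    nlinarith
  have hpos : 0 ≤ (√x * R ^ 2 + R * (x / √U) + x) := by positivity
  calc _ ≤ ∑ r ∈ Icc 1 R, (r : ℝ) / r.totient * ∑ f ∈ bvPr r, ∑ j ∈ range J, ‖∑ m ∈ Icc 1 ⌊x⌋₊, ∑ n ∈ Icc 1 ⌊x⌋₊, (((if Nat.log 2 m = j then g m else 0 : ℝ) : ℂ) * f m) * ((h n : ℂ) * f n) * (bvl (x / (m * n)) : ℂ)‖ := by
        refine sum_le_sum fun r _ => ?_
        refine mul_le_mul_of_nonneg_left ?_ (by positivity)
        exact sum_le_sum fun f hf => hsplit r f hf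
    _ = ∑ j ∈ range J, ∑ r ∈ Icc 1 R, (r : ℝ) / r.totient * ∑ f ∈ bvPr r, ‖∑ m ∈ Icc 1 ⌊x⌋₊, ∑ n ∈ Icc 1 ⌊x⌋₊, (((if Nat.log 2 m = j then g m else 0 : ℝ) : ℂ) * f m) * ((h n : ℂ) * f n) * (bvl (x / (m * n)) : ℂ)‖ := by
        symm
        rw [sum_comm]
        refine sum_congr rfl fun r _ => ?_
        rw [← mul_sum, sum_comm]
    _ ≤ ∑ j ∈ range J, 1600 * (log x) ^ 4 * (√x * R ^ 2 + R * (x / √U) + x) :=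
        sum_le_sum fun j hj => bv_typeII_blk hx hU hg hh hg1 hh1 R j (hpow j hj)
    _ = J * (1600 * (log x) ^ 4 * (√x * R ^ 2 + R * (x / √U) + x)) := by simp
    _ ≤ (3 * log x) * (1600 * (log x) ^ 4 * (√x * R ^ 2 + R * (x / √U) + x)) := by gcongr
    _ = _ := by ring

lemma bv_psum {g : ℕ → ℝ} (hg : ∀ n, 0 ≤ g n) {a b c : ℝ} (ha : 0 ≤ a) (hb : 0 ≤ b) (hc : 0 ≤ c)
    (h : ∀ j : ℕ, ∑ r ∈ Icc 1 j, g r ≤ a * j ^ 2 + b * j + c) (P Q : ℕ) :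
    ∑ r ∈ Ioc P Q, g r / r ≤ 2 * a * Q + b * (2 + log Q) + c / (P + 1) := by
  have hlog : 0 ≤ log Q := log_natCast_nonneg Q
  rcases lt_or_ge Q P with hQP | hPQ
  · rw [Finset.Ioc_eq_empty (by omega), Finset.sum_empty]; positivity
  have key : ∑ r ∈ Ioc P Q, g r / r ≤ (∑ r ∈ Icc 1 Q, g r) / (Q + 1) + a * Q + b * (∑ r ∈ Icc 1 Q, (1 / r : ℝ)) + c * (1 / (P + 1) - 1 / (Q + 1)) := by
    induction Q, hPQ using Nat.le_induction with
    | base =>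
      simp only [Finset.Ioc_self, Finset.sum_empty, sub_self, mul_zero, add_zero]
      have h1 : 0 ≤ ∑ r ∈ Icc 1 P, g r := sum_nonneg fun _ _ => hg _
      have h2 : 0 ≤ ∑ r ∈ Icc 1 P, (1 / r : ℝ) := sum_nonneg fun _ _ => by positivity
      positivity
    | succ n hn ih =>
      have ih := ih (log_natCast_nonneg n)
      rw [Finset.sum_Ioc_succ_top (by omega), sum_Icc_succ_top (by omega) (f := fun r : ℕ => (1 / r : ℝ))]
      have hG := h (n + 1)
      have hG' := sum_Icc_succ_top (show 1 ≤ n + 1 by omega) g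
      set G := ∑ r ∈ Icc 1 n, g r
      set G1 := ∑ r ∈ Icc 1 (n + 1), g r
      have e : g (n + 1) = G1 - G := by linarith
      rw [e]
      push_cast at hG ⊢
      have hn0 : (0 : ℝ) ≤ n := by positivity
      have e2 : G1 / (n + 1 + 1) + G1 / ((n + 1) * (n + 1 + 1)) = G1 / ((n : ℝ) + 1) := by field_simp
      have e3 : G1 / (((n : ℝ) + 1) * (n + 1 + 1)) ≤ a + b * (1 / (n + 1)) + c * (1 / (n + 1) - 1 / (n + 1 + 1)) := by
        rw [div_le_iff₀ (by positivity)]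
        refine hG.trans ?_
        have : (a + b * (1 / (n + 1)) + c * (1 / (n + 1) - 1 / (n + 1 + 1))) * (((n : ℝ) + 1) * (n + 1 + 1)) = a * ((n + 1) * (n + 1 + 1)) + b * (n + 1 + 1) + c := by
          field_simp; ring
        rw [this]
        nlinarith [mul_nonneg ha hn0]
      have e4 : (G1 - G) / ((n : ℝ) + 1) = G1 / (n + 1) - G / (n + 1) := by ring
      rw [e4, mul_add b]
      linarith
  refine key.trans ?_
  have h1 := h Q
  have hH := bv_harm Q
  have hQ0 : (0 : ℝ) ≤ Q := by positivity
  have h2 : (∑ r ∈ Icc 1 Q, g r) / (Q + 1) ≤ a * Q + b + c * (1 / (Q + 1)) := by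
    rw [div_le_iff₀ (by positivity)]
    refine h1.trans ?_
    have : (a * Q + b + c * (1 / (Q + 1))) * ((Q : ℝ) + 1) = a * Q * (Q + 1) + b * (Q + 1) + c := by field_simp
    rw [this]
    nlinarith [mul_nonneg ha hQ0]
  have h3 := mul_le_mul_of_nonneg_left hH hb
  have e : c / ((P : ℝ) + 1) = c * (1 / (P + 1)) := by ring
  rw [e]
  linarith

lemma bvPr_card (r : ℕ) : (bvPr r).card ≤ r.totient := by
  rcases Nat.eq_zero_or_pos r with rfl | hr
  · simp [bvPr]
  · haveI : NeZero r := ⟨hr.ne'⟩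
    have h := bvPr_sum (r := r) (fun _ => (1 : ℝ))
    simp only [sum_const, nsmul_eq_mul, mul_one] at h
    have h' := Nat.cast_injective h
    rw [h', ← DirichletCharacter.card_eq_totient_of_hasEnoughRootsOfUnity ℂ r, Nat.card_eq_fintype_card]
    exact Finset.card_le_univ _

lemma bvPr_norm {r : ℕ} {f : ℕ → ℂ} (hf : f ∈ bvPr r) (n : ℕ) : ‖f n‖ ≤ 1 := by
  rcases Nat.eq_zero_or_pos r with rfl | hr
  · simp [bvPr] at hf
  · haveI : NeZero r := ⟨hr.ne'⟩
    obtain ⟨χ, _, rfl⟩ := bvPr_mem.mp hf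
    exact χ.norm_le_one _

lemma bvPr_partial {r : ℕ} (hr : 2 ≤ r) {f : ℕ → ℂ} (hf : f ∈ bvPr r) (n : ℕ) : ‖∑ k ∈ Icc 1 n, f k‖ ≤ 2 * r := by
  haveI : NeZero r := ⟨by omega⟩
  obtain ⟨χ, hχ, rfl⟩ := bvPr_mem.mp hf
  have hne : χ ≠ 1 := by
    rintro rfl
    have h1 : (1 : DirichletCharacter ℂ r).conductor = r := hχ
    rw [DirichletCharacter.conductor_one] at h1
    omega
  have := bv_char_partial χ n
  rw [bvc_ne hne] at this
  simpa using this

lemma bv_mid {x : ℝ} (hx : exp 1 ≤ x) {U P Q : ℕ} (hU : 1 ≤ U) (hP : 1 ≤ P) (hQ : (Q : ℝ) ≤ x) :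
    ∑ r ∈ Ioc P Q, (1 / (r.totient : ℝ)) * ∑ f ∈ bvPr r, ‖bvT vonMangoldt f x‖ ≤
      15000 * (log x) ^ 6 * (√x * Q + x / √U + x / P + Q ^ 2 * U ^ 2) := by
  have hx0 : 0 < x := (exp_pos 1).trans_le hx
  have hL : 1 ≤ log x := by rwa [le_log_iff_exp_le hx0]
  have hx1 : 1 ≤ x := by linarith [add_one_le_exp 1]
  set μ' : ArithmeticFunction ℝ := ((ArithmeticFunction.moebius : ArithmeticFunction ℤ) : ArithmeticFunction ℝ) with hμ
  set g : ArithmeticFunction ℝ := vonMangoldt - bvTr vonMangoldt U with hg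
  set m2 : ArithmeticFunction ℝ := μ' - bvTr μ' U with hm2
  set h : ArithmeticFunction ℝ := m2 * (ArithmeticFunction.zeta : ArithmeticFunction ℝ) with hh
  have g1 : ∀ n, g n = if n ≤ U then 0 else vonMangoldt n := by
    intro n
    rw [hg, sub_eq_add_neg, ArithmeticFunction.add_apply, ArithmeticFunction.neg_apply, bvTr_apply]
    split_ifs <;> simp
  have m1 : ∀ n, m2 n = if n ≤ U then 0 else μ' n := by
    intro n
    rw [hm2, sub_eq_add_neg, ArithmeticFunction.add_apply, ArithmeticFunction.neg_apply, bvTr_apply]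
    split_ifs <;> simp
  have m1' : ∀ n, |m2 n| ≤ 1 := by
    intro n
    rw [m1]
    split_ifs
    · simp
    · rw [hμ, ArithmeticFunction.intCoe_apply]; exact_mod_cast ArithmeticFunction.abs_moebius_le_one
  have hz1 : ∀ n, |(ArithmeticFunction.zeta : ArithmeticFunction ℝ) n| ≤ 1 := by
    intro n
    rw [ArithmeticFunction.natCoe_apply, ArithmeticFunction.zeta_apply]
    split_ifs <;> simp
  have hh0 : ∀ n, n ≤ U → h n = 0 := by
    intro n hn
    rw [hh, ArithmeticFunction.mul_apply]
    refine sum_eq_zero fun p hp => ?_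
    have hp' := Nat.mem_divisorsAntidiagonal.mp hp
    have : p.1 ≤ n := Nat.le_of_dvd (Nat.pos_of_ne_zero hp'.2) (Dvd.intro _ hp'.1)
    rw [m1, if_pos (this.trans hn), zero_mul]
  have hh1 : ∀ n, |h n| ≤ (n.divisors.card : ℝ) := by
    intro n
    rw [hh, ArithmeticFunction.mul_apply]
    refine (abs_sum_le_sum_abs _ _).trans ?_
    have : ∀ p ∈ n.divisorsAntidiagonal, |m2 p.1 * (ArithmeticFunction.zeta : ArithmeticFunction ℝ) p.2| ≤ 1 := by
      intro p _
      rw [abs_mul]; exact mul_le_one₀ (m1' _) (abs_nonneg _) (hz1 _)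
    refine (sum_le_card_nsmul _ _ _ this).trans (le_of_eq ?_)
    rw [nsmul_eq_mul, mul_one, ← Nat.map_div_right_divisors, card_map]
  have tII := bv_typeII hx hU (g := g) (h := h) (fun n hn => by rw [g1, if_pos hn]) hh0 (fun n => by
    rw [g1]; split_ifs
    · simp [vonMangoldt_nonneg]
    · rw [abs_of_nonneg vonMangoldt_nonneg]) hh1
  have hps := bv_psum (g := fun r => (r : ℝ) / r.totient * ∑ f ∈ bvPr r, ‖bvT (g * h) f x‖) (fun r => by positivity)
    (a := 4800 * (log x) ^ 5 * √x) (b := 4800 * (log x) ^ 5 * (x / √U)) (c := 4800 * (log x) ^ 5 * x) (by positivity) (by positivity) (by positivity)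
    (fun j => (tII j).trans (le_of_eq (by ring))) P Q
  have hI : ∀ r ∈ Ioc P Q, (1 / (r.totient : ℝ)) * ∑ f ∈ bvPr r, ‖bvT vonMangoldt f x‖ ≤
      8 * Q * U ^ 2 * (log x) ^ 2 + ((r : ℝ) / r.totient * ∑ f ∈ bvPr r, ‖bvT (g * h) f x‖) / r := by
    intro r hr
    rw [mem_Ioc] at hr
    have hr2 : 2 ≤ r := by omega
    have hrQ : (r : ℝ) ≤ Q := by exact_mod_cast hr.2
    have hr0 : (0 : ℝ) < r := by exact_mod_cast (by omega : 0 < r)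
    have hφ : (0 : ℝ) < r.totient := by exact_mod_cast Nat.totient_pos.mpr (by omega)
    have b1 : ∑ f ∈ bvPr r, ‖bvT vonMangoldt f x‖ ≤ ∑ f ∈ bvPr r, (4 * (2 * r) * U ^ 2 * (log x) ^ 2 + ‖bvT (g * h) f x‖) := by
      refine sum_le_sum fun f hf => ?_
      exact bv_typeI hx (C := 2 * r) (by have : (2 : ℝ) ≤ r := by exact_mod_cast hr2
                                         linarith) (bvPr_mul hf) (bvPr_norm hf) (bvPr_partial hr2 hf) hU
    rw [sum_add_distrib, sum_const, nsmul_eq_mul] at b1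
    have hcard : ((bvPr r).card : ℝ) ≤ r.totient := by exact_mod_cast bvPr_card r
    calc _ ≤ (1 / (r.totient : ℝ)) * (r.totient * (4 * (2 * Q) * U ^ 2 * (log x) ^ 2) + ∑ f ∈ bvPr r, ‖bvT (g * h) f x‖) := by
          refine mul_le_mul_of_nonneg_left (b1.trans ?_) (by positivity)
          gcongr
      _ = _ := by field_simp; ring
  refine (sum_le_sum hI).trans ?_
  rw [sum_add_distrib, sum_const, nsmul_eq_mul]
  have hlogQ : 2 + log Q ≤ 3 * log x := by
    rcases Nat.eq_zero_or_pos Q with rfl | hQ0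
    · simp; linarith
    · have := log_le_log (by exact_mod_cast hQ0) hQ
      linarith
  have hU0 : (0 : ℝ) < U := by exact_mod_cast hU
  have hP0 : (0 : ℝ) < P := by exact_mod_cast hP
  set L := log x
  have hcQ : ((Ioc P Q).card : ℝ) ≤ Q := by
    rw [Nat.card_Ioc]; exact_mod_cast Nat.sub_le _ _
  have q1 : ((Ioc P Q).card : ℝ) * (8 * Q * U ^ 2 * L ^ 2) ≤ 8 * (L ^ 6 * (Q ^ 2 * U ^ 2)) := by
    have hLL : L ^ 2 ≤ L ^ 6 := pow_le_pow_right₀ hL (by norm_num)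
    calc _ ≤ (Q : ℝ) * (8 * Q * U ^ 2 * L ^ 6) := by gcongr
      _ = _ := by ring
  have hL56 : L ^ 5 ≤ L ^ 6 := pow_le_pow_right₀ hL (by norm_num)
  have q2 : 2 * (4800 * L ^ 5 * √x) * Q ≤ 9600 * (L ^ 6 * (√x * Q)) := by
    calc _ ≤ 2 * (4800 * L ^ 6 * √x) * Q := by gcongr
      _ = _ := by ring
  have q3 : 4800 * L ^ 5 * (x / √U) * (2 + log Q) ≤ 14400 * (L ^ 6 * (x / √U)) := by
    calc _ ≤ 4800 * L ^ 5 * (x / √U) * (3 * L) := by gcongr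
      _ = _ := by ring
  have q4 : 4800 * L ^ 5 * x / (P + 1) ≤ 4800 * (L ^ 6 * (x / P)) := by
    calc _ ≤ 4800 * L ^ 6 * x / P := by gcongr; linarith
      _ = _ := by ring
  have p1 : 0 ≤ L ^ 6 * (Q ^ 2 * U ^ 2 : ℝ) := by positivity
  have p2 : 0 ≤ L ^ 6 * (√x * Q) := by positivity
  have p3 : 0 ≤ L ^ 6 * (x / √U) := by positivity
  have p4 : 0 ≤ L ^ 6 * (x / P) := by positivity
  calc _ ≤ 8 * (L ^ 6 * (Q ^ 2 * U ^ 2 : ℝ)) + (9600 * (L ^ 6 * (√x * Q)) + 14400 * (L ^ 6 * (x / √U)) + 4800 * (L ^ 6 * (x / P))) := by linarith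
    _ ≤ 15000 * (L ^ 6 * (Q ^ 2 * U ^ 2 : ℝ)) + (15000 * (L ^ 6 * (√x * Q)) + 15000 * (L ^ 6 * (x / √U)) + 15000 * (L ^ 6 * (x / P))) := by linarith
    _ = _ := by ring

lemma bv_vM_pp {N p : ℕ} (hN : 1 ≤ N) (hp : p.Prime) : ∑ k ∈ Icc 1 N, (if p ^ k ≤ N then log p else 0) ≤ log N := by
  rw [← sum_filter, sum_const, nsmul_eq_mul]
  have hc : (Finset.filter (fun k => p ^ k ≤ N) (Icc 1 N)).card ≤ Nat.log p N := by
    refine (Finset.card_le_card (t := Icc 1 (Nat.log p N)) fun k hk => ?_).trans (by simp)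
    simp only [mem_filter, mem_Icc] at hk ⊢
    exact ⟨hk.1.1, Nat.le_log_of_pow_le hp.one_lt hk.2⟩
  have h1 : p ^ Nat.log p N ≤ N := Nat.pow_log_le_self p (by omega)
  have hp1 : (1 : ℝ) ≤ p := by exact_mod_cast hp.one_lt.le
  calc _ ≤ (Nat.log p N : ℝ) * log p := by
        refine mul_le_mul_of_nonneg_right (by exact_mod_cast hc) (log_nonneg hp1)
    _ = log ((p : ℝ) ^ Nat.log p N) := by rw [log_pow]
    _ ≤ log N := log_le_log (by positivity) (by exact_mod_cast h1)

lemma bv_vM_noncop {N q : ℕ} (hN : 1 ≤ N) (hq : 1 ≤ q) :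
    ∑ n ∈ Icc 1 N, (if Nat.Coprime n q then 0 else vonMangoldt n) ≤ 2 * log q * log N := by
  have h1 : ∀ n ∈ Icc 1 N, (if Nat.Coprime n q then 0 else vonMangoldt n) ≤
      ∑ p ∈ q.primeFactors, ∑ k ∈ Icc 1 N, (if n = p ^ k then (if p ^ k ≤ N then log p else 0) else 0) := by
    intro n hn
    have hnn : ∀ p ∈ q.primeFactors, ∀ k ∈ Icc 1 N, (0 : ℝ) ≤ (if n = p ^ k then (if p ^ k ≤ N then log p else 0) else 0) := by
      intro p hp k _
      split_ifs <;> first | exact log_natCast_nonneg p | exact le_rfl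
    have hnn2 := sum_nonneg fun p hp => sum_nonneg (hnn p hp)
    rw [mem_Icc] at hn
    split_ifs with hc
    · exact hnn2
    · by_cases hpp : IsPrimePow n
      · obtain ⟨p, k, hp, hk, rfl⟩ := (isPrimePow_nat_iff n).mp hpp
        rw [ArithmeticFunction.vonMangoldt_apply_pow hk.ne', ArithmeticFunction.vonMangoldt_apply_prime hp]
        have hpq : p ∈ q.primeFactors := by
          rw [Nat.mem_primeFactors]
          refine ⟨hp, ?_, by omega⟩
          by_contra hd
          exact hc (((Nat.Prime.coprime_iff_not_dvd hp).mpr hd).pow_left k)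
        have hkN : k ∈ Icc 1 N := mem_Icc.mpr ⟨hk, (Nat.lt_pow_self hp.one_lt).le.trans hn.2⟩
        refine le_trans ?_ (single_le_sum (fun p hp => sum_nonneg (hnn p hp)) hpq)
        refine le_trans ?_ (single_le_sum (hnn p hpq) hkN)
        rw [if_pos rfl, if_pos hn.2]
      · rw [ArithmeticFunction.vonMangoldt_apply, if_neg hpp]; exact hnn2
  refine (sum_le_sum h1).trans ?_
  rw [sum_comm]
  have h2 : ∀ p ∈ q.primeFactors, ∑ n ∈ Icc 1 N, ∑ k ∈ Icc 1 N, (if n = p ^ k then (if p ^ k ≤ N then log p else 0) else 0) ≤ log N := by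
    intro p hp
    refine le_trans ?_ (bv_vM_pp hN (Nat.prime_of_mem_primeFactors hp))
    rw [sum_comm]
    refine sum_le_sum fun k _ => ?_
    rw [sum_ite_eq']
    split_ifs <;> first | exact le_rfl | exact log_natCast_nonneg p
  refine (sum_le_card_nsmul _ _ _ h2).trans ?_
  rw [nsmul_eq_mul]
  refine mul_le_mul_of_nonneg_right ?_ (log_natCast_nonneg N)
  have h3 : 2 ^ q.primeFactors.card ≤ q := by
    calc 2 ^ q.primeFactors.card ≤ ∏ p ∈ q.primeFactors, p := Finset.pow_card_le_prod _ _ _ fun p hp => (Nat.prime_of_mem_primeFactors hp).two_le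
      _ ≤ q := Nat.le_of_dvd hq (Nat.prod_primeFactors_dvd q)
  have h4 : ((2 : ℝ)) ^ q.primeFactors.card ≤ q := by exact_mod_cast h3
  have h5 := log_le_log (by positivity) h4
  rw [log_pow] at h5
  have := log_two_gt_d9
  have h6 : (0 : ℝ) ≤ q.primeFactors.card := by positivity
  nlinarith

lemma bvT_diff {q : ℕ} {y : ℝ} (hq : 1 ≤ q) (hy : exp 1 ≤ y) (hqy : (q : ℝ) ≤ y) {f g : ℕ → ℂ} (hfg : ∀ n, Nat.Coprime n q → f n = g n)
    (hf : ∀ n, ¬ Nat.Coprime n q → f n = 0) (hg : ∀ n, ‖g n‖ ≤ 1) :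
    ‖bvT vonMangoldt f y‖ ≤ ‖bvT vonMangoldt g y‖ + 2 * (log y) ^ 3 ∧
    ‖bvT vonMangoldt f y - bvT vonMangoldt g y‖ ≤ 2 * (log y) ^ 3 := by
  have hx0 : 0 < y := (exp_pos 1).trans_le hy
  have hL : 1 ≤ log y := by rwa [le_log_iff_exp_le hx0]
  have hx1 : 1 ≤ y := by linarith [add_one_le_exp 1]
  have key : ‖bvT vonMangoldt f y - bvT vonMangoldt g y‖ ≤ 2 * (log y) ^ 3 := by
    rw [bvT, bvT, ← sum_sub_distrib]
    refine (norm_sum_le _ _).trans ?_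
    have h1 : ∀ n ∈ Icc 1 ⌊y⌋₊, ‖(vonMangoldt n : ℂ) * f n * (bvl (y / n) : ℂ) - (vonMangoldt n : ℂ) * g n * (bvl (y / n) : ℂ)‖ ≤
        (if Nat.Coprime n q then 0 else vonMangoldt n) * log y := by
      intro n hn
      rw [mem_Icc] at hn
      split_ifs with hc
      · rw [hfg n hc]; simp
      · rw [hf n hc, mul_zero, zero_mul, zero_sub, norm_neg, norm_mul, norm_mul, norm_real, norm_real, norm_eq_abs, norm_eq_abs,
          abs_of_nonneg vonMangoldt_nonneg, abs_of_nonneg (bvl_nonneg _)]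
        refine mul_le_mul (mul_le_of_le_one_right vonMangoldt_nonneg (hg n)) (bvl_le hx1 hn.1) (bvl_nonneg _) vonMangoldt_nonneg
    refine (sum_le_sum h1).trans ?_
    rw [← sum_mul]
    have hN : 1 ≤ ⌊y⌋₊ := Nat.le_floor (by simpa using hx1)
    have h2 := bv_vM_noncop hN hq
    have h3 : log q ≤ log y := log_le_log (by exact_mod_cast hq) hqy
    have h4 : log (⌊y⌋₊ : ℝ) ≤ log y := log_le_log (by exact_mod_cast hN) (Nat.floor_le hx0.le)
    have h5 := log_natCast_nonneg q
    have h6 := log_natCast_nonneg ⌊y⌋₊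
    calc _ ≤ (2 * log q * log (⌊y⌋₊ : ℝ)) * log y := by gcongr
      _ ≤ (2 * log y * log y) * log y := by gcongr
      _ = _ := by ring
  refine ⟨?_, key⟩
  have := norm_le_norm_add_norm_sub' (bvT vonMangoldt f y) (bvT vonMangoldt g y)
  linarith

noncomputable def bvW (w : ℕ → ℝ) (y : ℝ) : ℝ := ∑ n ∈ Icc 1 ⌊y⌋₊, w n * bvl (y / n)

lemma bvW_sandwich {w : ℕ → ℝ} (hw : ∀ n, 0 ≤ w n) {y d : ℝ} (hy : 0 < y) (hd : 0 ≤ d) :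
    d * ∑ n ∈ Icc 1 ⌊y⌋₊, w n ≤ bvW w (y * exp d) - bvW w y ∧
    bvW w (y * exp d) - bvW w y ≤ d * ∑ n ∈ Icc 1 ⌊y * exp d⌋₊, w n := by
  have he : 1 ≤ exp d := one_le_exp hd
  have hle : y ≤ y * exp d := le_mul_of_one_le_right hy.le he
  have hsub : Icc 1 ⌊y⌋₊ ⊆ Icc 1 ⌊y * exp d⌋₊ := Icc_subset_Icc_right (Nat.floor_le_floor hle)
  have e1 : bvW w y = ∑ n ∈ Icc 1 ⌊y * exp d⌋₊, w n * bvl (y / n) := by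
    refine sum_subset hsub fun n hn hn' => ?_
    simp only [mem_Icc] at hn hn'
    have : y < n := (Nat.floor_lt hy.le).mp (by omega)
    rw [bvl_zero (by positivity) ((div_le_one (hy.trans this)).mpr this.le), mul_zero]
  have hlo : ∀ n ∈ Icc 1 ⌊y * exp d⌋₊, bvl (y / n) ≤ bvl (y * exp d / n) ∧ bvl (y * exp d / n) ≤ bvl (y / n) + d := by
    intro n hn
    have hn0 : (0 : ℝ) < n := by exact_mod_cast (mem_Icc.mp hn).1
    refine ⟨bvl_mono (by positivity) (by gcongr), ?_⟩
    have : log (y * exp d / n) = log (y / n) + d := by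
      rw [show y * exp d / n = (y / n) * exp d by ring, log_mul (by positivity) (by positivity), log_exp]
    rw [bvl, this]
    refine max_le (by linarith [le_max_left (log (y / n)) 0, show bvl (y / n) = max (log (y / n)) 0 from rfl]) (by linarith [bvl_nonneg (y / n)])
  have heq : ∀ n ∈ Icc 1 ⌊y⌋₊, bvl (y * exp d / n) - bvl (y / n) = d := by
    intro n hn
    obtain ⟨h1, h2⟩ := mem_Icc.mp hn
    have hn0 : (0 : ℝ) < n := by exact_mod_cast h1
    have hny : (n : ℝ) ≤ y := (Nat.le_floor_iff hy.le).mp h2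
    rw [bvl_eq ((one_le_div hn0).mpr hny), bvl_eq ((one_le_div hn0).mpr (hny.trans hle)),
      show y * exp d / n = (y / n) * exp d by ring, log_mul (by positivity) (by positivity), log_exp]
    ring
  have e2 : bvW w (y * exp d) - bvW w y = ∑ n ∈ Icc 1 ⌊y * exp d⌋₊, w n * (bvl (y * exp d / n) - bvl (y / n)) := by
    rw [e1, bvW, ← sum_sub_distrib]
    exact sum_congr rfl fun n _ => by ring
  rw [e2]
  constructor
  · calc _ = ∑ n ∈ Icc 1 ⌊y⌋₊, w n * (bvl (y * exp d / n) - bvl (y / n)) := by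
          rw [mul_sum]
          exact sum_congr rfl fun n hn => by rw [heq n hn]; ring
      _ ≤ _ := sum_le_sum_of_subset_of_nonneg hsub fun n hn _ => mul_nonneg (hw n) (by linarith [(hlo n hn).1])
  · rw [mul_sum]
    refine sum_le_sum fun n hn => ?_
    rw [mul_comm d]
    exact mul_le_mul_of_nonneg_left (by linarith [(hlo n hn).2]) (hw n)

noncomputable def bvPf {q : ℕ} (χ : DirichletCharacter ℂ q) : ℕ → ℂ := fun n => χ.primitiveCharacter (n : ZMod χ.conductor)

lemma bvPf_cop {q : ℕ} (χ : DirichletCharacter ℂ q) {n : ℕ} (h : Nat.Coprime n q) : χ (n : ZMod q) = bvPf χ n := by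
  have h1 := changeLevel_eq_cast_of_dvd' χ.primitiveCharacter χ.conductor_dvd_level (a := (n : ℤ)) (Nat.isCoprime_iff_coprime.mpr h)
  rw [χ.changeLevel_primitiveCharacter] at h1
  simpa [bvPf] using h1

lemma bv_noncop {q : ℕ} (χ : DirichletCharacter ℂ q) {n : ℕ} (h : ¬ Nat.Coprime n q) : χ (n : ZMod q) = 0 :=
  MulChar.map_nonunit _ (by rwa [ZMod.isUnit_iff_coprime])

lemma bvPf_inj {q : ℕ} [NeZero q] {χ ψ : DirichletCharacter ℂ q} (h : bvPf χ = bvPf ψ) : χ = ψ := by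
  refine bv_char_inj (funext fun n => ?_)
  by_cases hc : Nat.Coprime n q
  · rw [bvPf_cop χ hc, bvPf_cop ψ hc, h]
  · rw [bv_noncop χ hc, bv_noncop ψ hc]

lemma bvPf_mem {q : ℕ} [NeZero q] (χ : DirichletCharacter ℂ q) : bvPf χ ∈ bvPr χ.conductor := by
  haveI : NeZero χ.conductor := ⟨fun h => NeZero.ne q (by simpa [h] using χ.conductor_dvd_level)⟩
  exact bvPr_mem.mpr ⟨χ.primitiveCharacter, χ.primitiveCharacter_isPrimitive, rfl⟩

lemma bv_sum_prim {q : ℕ} [NeZero q] (G : (ℕ → ℂ) → ℝ) (hG : ∀ f, 0 ≤ G f) :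
    ∑ χ : DirichletCharacter ℂ q with χ ≠ 1, G (bvPf χ) ≤ ∑ r ∈ q.divisors.erase 1, ∑ f ∈ bvPr r, G f := by
  classical
  rw [Finset.sum_sigma']
  have hinj : ∀ χ ψ : DirichletCharacter ℂ q, (⟨χ.conductor, bvPf χ⟩ : (_ : ℕ) × (ℕ → ℂ)) = ⟨ψ.conductor, bvPf ψ⟩ → χ = ψ := by
    intro χ ψ h
    have h2 : bvPf χ = bvPf ψ := congrArg (fun p : (_ : ℕ) × (ℕ → ℂ) => p.2) h
    exact bvPf_inj h2
  have e : ∑ χ : DirichletCharacter ℂ q with χ ≠ 1, G (bvPf χ) = ∑ p ∈ (Finset.univ.filter fun χ : DirichletCharacter ℂ q => χ ≠ 1).image (fun χ => (⟨χ.conductor, bvPf χ⟩ : (_ : ℕ) × (ℕ → ℂ))), G p.2 := by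
    rw [Finset.sum_image fun χ _ ψ _ h => hinj χ ψ h]
  rw [e]
  refine sum_le_sum_of_subset_of_nonneg (fun p hp => ?_) fun p _ _ => hG _
  obtain ⟨χ, hχ, rfl⟩ := Finset.mem_image.mp hp
  rw [Finset.mem_sigma]
  refine ⟨?_, bvPf_mem χ⟩
  rw [mem_erase, Nat.mem_divisors]
  refine ⟨fun h => (mem_filter.mp hχ).2 (DirichletCharacter.eq_one_iff_conductor_eq_one.mpr h), χ.conductor_dvd_level, NeZero.ne q⟩

lemma bv_decomp {q a : ℕ} {y : ℝ} (hq : 1 ≤ q) (ha : Nat.Coprime a q) (hy : exp 1 ≤ y) (hqy : (q : ℝ) ≤ y) :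
    |bvW (fun n => if n % q = a % q then vonMangoldt n else 0) y - bvW (fun _ => 1) y / q.totient| ≤
      (1 / (q.totient : ℝ)) * (‖bvT vonMangoldt (fun _ => 1) y - (bvW (fun _ => 1) y : ℂ)‖ + ∑ r ∈ q.divisors.erase 1, ∑ f ∈ bvPr r, ‖bvT vonMangoldt f y‖) + 2 * (log y) ^ 3 := by
  classical
  haveI : NeZero q := ⟨by omega⟩
  have hau : IsUnit (a : ZMod q) := (ZMod.isUnit_iff_coprime a q).mpr ha
  have hφ : (0 : ℝ) < q.totient := by exact_mod_cast Nat.totient_pos.mpr hq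
  set W := bvW (fun n => if n % q = a % q then vonMangoldt n else 0) y with hW
  set S := bvW (fun _ => 1) y with hS
  have e1 : ((q.totient : ℝ) * W : ℂ) = ∑ χ : DirichletCharacter ℂ q, χ (a : ZMod q)⁻¹ * bvT vonMangoldt (fun n => χ n) y := by
    simp only [bvT, mul_sum]
    rw [sum_comm, hW, bvW]
    push_cast
    rw [mul_sum]
    refine sum_congr rfl fun n _ => ?_
    have h1 := DirichletCharacter.sum_char_inv_mul_char_eq ℂ hau (n : ZMod q)
    have h2 : ∑ χ : DirichletCharacter ℂ q, χ (a : ZMod q)⁻¹ * ((vonMangoldt n : ℂ) * χ n * (bvl (y / n) : ℂ)) = (∑ χ : DirichletCharacter ℂ q, χ (a : ZMod q)⁻¹ * χ n) * ((vonMangoldt n : ℂ) * (bvl (y / n) : ℂ)) := by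
      rw [sum_mul]; exact sum_congr rfl fun _ _ => by ring
    rw [h2, h1]
    have hiff := ZMod.natCast_eq_natCast_iff' a n q
    by_cases hc : n % q = a % q
    · rw [if_pos hc, if_pos (hiff.mpr hc.symm)]
    · rw [if_neg hc, if_neg (fun h => hc (hiff.mp h).symm)]; simp
  have hainv : ∀ χ : DirichletCharacter ℂ q, ‖χ (a : ZMod q)⁻¹‖ ≤ 1 := fun χ => χ.norm_le_one _
  have hone : (1 : DirichletCharacter ℂ q) (a : ZMod q)⁻¹ = 1 := by
    refine MulChar.one_apply (IsUnit.of_mul_eq_one (a : ZMod q) ?_)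
    exact ZMod.inv_mul_of_unit _ hau
  have e2 : ((q.totient : ℝ) * W - S : ℂ) = (bvT vonMangoldt (fun n => (1 : DirichletCharacter ℂ q) n) y - S) + ∑ χ : DirichletCharacter ℂ q with χ ≠ 1, χ (a : ZMod q)⁻¹ * bvT vonMangoldt (fun n => χ n) y := by
    rw [e1, ← Finset.sum_filter_add_sum_filter_not Finset.univ (fun χ : DirichletCharacter ℂ q => χ = 1)]
    rw [Finset.filter_eq', if_pos (mem_univ _), Finset.sum_singleton, hone]
    ring
  have b1 := (bvT_diff hq hy hqy (f := fun n => (1 : DirichletCharacter ℂ q) n) (g := fun _ => 1) (fun n hn => by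
    rw [MulChar.one_apply ((ZMod.isUnit_iff_coprime n q).mpr hn)]) (fun n hn => bv_noncop _ hn) (fun n => by simp)).2
  have b2 : ∀ χ : DirichletCharacter ℂ q, ‖bvT vonMangoldt (fun n => χ n) y‖ ≤ ‖bvT vonMangoldt (bvPf χ) y‖ + 2 * (log y) ^ 3 := fun χ =>
    (bvT_diff hq hy hqy (f := fun n => χ n) (g := bvPf χ) (fun n hn => bvPf_cop χ hn) (fun n hn => bv_noncop _ hn) (fun n => χ.primitiveCharacter.norm_le_one _)).1
  have hL0 : 0 ≤ 2 * (log y) ^ 3 := le_trans (norm_nonneg _) b1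
  have b3 : ‖∑ χ : DirichletCharacter ℂ q with χ ≠ 1, χ (a : ZMod q)⁻¹ * bvT vonMangoldt (fun n => χ n) y‖ ≤
      ∑ χ : DirichletCharacter ℂ q with χ ≠ 1, (‖bvT vonMangoldt (bvPf χ) y‖ + 2 * (log y) ^ 3) := by
    refine (norm_sum_le _ _).trans (sum_le_sum fun χ _ => ?_)
    rw [norm_mul]
    exact (mul_le_of_le_one_left (norm_nonneg _) (hainv χ)).trans (b2 χ)
  rw [sum_add_distrib, sum_const, nsmul_eq_mul] at b3
  have hcard : (((Finset.univ.filter fun χ : DirichletCharacter ℂ q => χ ≠ 1).card : ℝ)) + 1 = q.totient := by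
    have h1 : (Finset.univ.filter fun χ : DirichletCharacter ℂ q => χ ≠ 1) = Finset.univ.erase 1 := by
      ext χ; simp
    have h2 := DirichletCharacter.card_eq_totient_of_hasEnoughRootsOfUnity ℂ q
    rw [Nat.card_eq_fintype_card] at h2
    rw [h1, Finset.card_erase_of_mem (mem_univ _), Finset.card_univ, h2]
    have := Nat.totient_pos.mpr hq
    rw [Nat.cast_sub (by omega)]; simp
  have b4 := bv_sum_prim (q := q) (fun f => ‖bvT vonMangoldt f y‖) fun f => norm_nonneg _
  set T1 := bvT vonMangoldt (fun _ => 1) y with hT1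
  set c : ℝ := ((Finset.univ.filter fun χ : DirichletCharacter ℂ q => χ ≠ 1).card : ℝ)
  have fin : ‖((q.totient : ℝ) * W - S : ℂ)‖ ≤ (‖T1 - (S : ℂ)‖ + ∑ r ∈ q.divisors.erase 1, ∑ f ∈ bvPr r, ‖bvT vonMangoldt f y‖) + q.totient * (2 * (log y) ^ 3) := by
    rw [e2]
    refine (norm_add_le _ _).trans ?_
    have b5 : ‖bvT vonMangoldt (fun n => (1 : DirichletCharacter ℂ q) n) y - (S : ℂ)‖ ≤ 2 * (log y) ^ 3 + ‖T1 - (S : ℂ)‖ := by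
      refine le_trans ?_ (add_le_add_left b1 _)
      refine le_trans (le_of_eq ?_) (norm_add_le _ _)
      congr 1; ring
    rw [← hcard]
    linarith
  have e3 : ((q.totient : ℝ) * W - S : ℂ) = (((q.totient : ℝ) * (W - S / q.totient) : ℝ) : ℂ) := by
    rw [mul_sub, mul_div_cancel₀ _ hφ.ne']; push_cast; ring
  rw [e3, norm_real, norm_eq_abs, abs_mul, abs_of_pos hφ] at fin
  rw [one_div_mul_eq_div, ← mul_le_mul_iff_right₀ hφ]
  refine fin.trans (le_of_eq ?_)
  field_simp

lemma bv_phi_tau {m : ℕ} (hm : 1 ≤ m) : (1 / (m.totient : ℝ)) ≤ m.divisors.card / m := by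
  have h : m ≤ m.divisors.card * m.totient := by
    calc m = ∑ d ∈ m.divisors, d.totient := (Nat.sum_totient m).symm
      _ ≤ m.divisors.card • m.totient := sum_le_card_nsmul _ _ _ fun d hd =>
          Nat.le_of_dvd (Nat.totient_pos.mpr hm) (Nat.totient_dvd_of_dvd (Nat.dvd_of_mem_divisors hd))
      _ = _ := by simp
  have hφ : (0 : ℝ) < m.totient := by exact_mod_cast Nat.totient_pos.mpr hm
  have hm0 : (0 : ℝ) < m := by exact_mod_cast hm
  rw [div_le_div_iff₀ hφ hm0, one_mul]
  exact_mod_cast h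

lemma bv_phi_sum (Q : ℕ) : ∑ m ∈ Icc 1 Q, (1 / (m.totient : ℝ)) ≤ (1 + log Q) ^ 2 :=
  (sum_le_sum fun _ hm => bv_phi_tau (mem_Icc.mp hm).1).trans (bv_tau_div Q)

lemma bv_swap_sum (Q : ℕ) (H : ℕ → ℝ) (hH : ∀ r, 0 ≤ H r) :
    ∑ q ∈ Icc 1 Q, (1 / (q.totient : ℝ)) * ∑ r ∈ q.divisors.erase 1, H r ≤ (1 + log Q) ^ 2 * ∑ r ∈ Ioc 1 Q, (1 / (r.totient : ℝ)) * H r := by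
  have h1 : ∀ q ∈ Icc 1 Q, (1 / (q.totient : ℝ)) * ∑ r ∈ q.divisors.erase 1, H r ≤
      ∑ r ∈ Ioc 1 Q, ∑ m ∈ Icc 1 Q, (if q = r * m then (1 / (r.totient : ℝ)) * H r * (1 / (m.totient : ℝ)) else 0) := by
    intro q hq
    rw [mem_Icc] at hq
    have hnn : ∀ r m : ℕ, (0 : ℝ) ≤ (if q = r * m then (1 / (r.totient : ℝ)) * H r * (1 / (m.totient : ℝ)) else 0) := by
      intro r m
      have := hH r
      split_ifs <;> positivity
    rw [mul_sum]
    have hsub : q.divisors.erase 1 ⊆ Ioc 1 Q := by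
      intro r hr
      rw [mem_erase, Nat.mem_divisors] at hr
      have h2 := Nat.le_of_dvd hq.1 hr.2.1
      have h3 := Nat.pos_of_dvd_of_pos hr.2.1 hq.1
      rw [mem_Ioc]; omega
    refine le_trans (sum_le_sum fun r hr => ?_) (sum_le_sum_of_subset_of_nonneg hsub fun r _ _ => sum_nonneg fun m _ => hnn r m)
    have hrQ := mem_Ioc.mp (hsub hr)
    rw [mem_erase, Nat.mem_divisors] at hr
    obtain ⟨m, rfl⟩ := hr.2.1
    have hm1 : 1 ≤ m := Nat.pos_of_ne_zero (by rintro rfl; simp at hq)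
    have hmQ : m ∈ Icc 1 Q := mem_Icc.mpr ⟨hm1, (Nat.le_mul_of_pos_left m (by omega)).trans hq.2⟩
    refine le_trans ?_ (single_le_sum (fun m _ => hnn r m) hmQ)
    rw [if_pos rfl]
    have p1 : (0 : ℝ) < r.totient := by exact_mod_cast Nat.totient_pos.mpr (by omega)
    have p2 : (0 : ℝ) < m.totient := by exact_mod_cast Nat.totient_pos.mpr hm1
    have p3 : (r.totient : ℝ) * m.totient ≤ (r * m).totient := by exact_mod_cast Nat.totient_super_multiplicative r m
    have := hH r
    calc _ ≤ 1 / ((r.totient : ℝ) * m.totient) * H r := by gcongr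
      _ = _ := by field_simp
  refine (sum_le_sum h1).trans ?_
  rw [sum_comm, mul_sum]
  refine sum_le_sum fun r hr => ?_
  rw [sum_comm]
  have h0 : 0 ≤ (1 / (r.totient : ℝ)) * H r := mul_nonneg (by positivity) (hH r)
  calc _ ≤ ∑ m ∈ Icc 1 Q, (1 / (r.totient : ℝ)) * H r * (1 / (m.totient : ℝ)) := by
        refine sum_le_sum fun m _ => ?_
        rw [sum_ite_eq']
        split_ifs
        · exact le_rfl
        · positivity
    _ = (∑ m ∈ Icc 1 Q, (1 / (m.totient : ℝ))) * ((1 / (r.totient : ℝ)) * H r) := by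
        rw [sum_mul]; exact sum_congr rfl fun _ _ => by ring
    _ ≤ _ := mul_le_mul_of_nonneg_right (bv_phi_sum Q) h0

lemma bv_mid_Z {y Z : ℝ} (hy : exp 1 ≤ y) (hZ0 : 0 < Z) (hZ1 : Z ≤ 1) {Q : ℕ} (hQ : (Q : ℝ) ≤ √y * Z ^ 3) :
    ∃ P : ℕ, 1 ≤ P ∧ (P : ℝ) ≤ Z⁻¹ ∧ ∑ r ∈ Ioc P Q, (1 / (r.totient : ℝ)) * ∑ f ∈ bvPr r, ‖bvT vonMangoldt f y‖ ≤ 120000 * (log y) ^ 6 * (y * Z) := by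
  have hx0 : 0 < y := (exp_pos 1).trans_le hy
  have hx1 : 1 ≤ y := by linarith [add_one_le_exp 1]
  have hL : 1 ≤ log y := by rwa [le_log_iff_exp_le hx0]
  have hs : √y ≤ y := sqrt_le_iff.mpr ⟨hx0.le, by nlinarith⟩
  have hZ3 : Z ^ 3 ≤ Z := by
    calc Z ^ 3 ≤ Z ^ 1 := pow_le_pow_of_le_one hZ0.le hZ1 (by norm_num)
      _ = Z := pow_one Z
  have hZi : 1 ≤ Z⁻¹ := (one_le_inv₀ hZ0).mpr hZ1
  have hP1 : 1 ≤ ⌊Z⁻¹⌋₊ := Nat.le_floor (by simpa using hZi)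
  have hU1 : 1 ≤ ⌈(Z⁻¹) ^ 2⌉₊ := Nat.one_le_ceil_iff.mpr (by positivity)
  have hQy : (Q : ℝ) ≤ y := by
    calc (Q : ℝ) ≤ √y * Z ^ 3 := hQ
      _ ≤ y * 1 := by gcongr; exact hZ3.trans hZ1
      _ = y := mul_one y
  have hPlo : Z⁻¹ / 2 ≤ (⌊Z⁻¹⌋₊ : ℝ) := by
    have h1 := Nat.lt_floor_add_one (Z⁻¹)
    have h2 : (1 : ℝ) ≤ (⌊Z⁻¹⌋₊ : ℝ) := by exact_mod_cast hP1
    linarith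
  have hUlo : (Z⁻¹) ^ 2 ≤ (⌈(Z⁻¹) ^ 2⌉₊ : ℝ) := Nat.le_ceil _
  have hUhi : (⌈(Z⁻¹) ^ 2⌉₊ : ℝ) ≤ 2 * (Z⁻¹) ^ 2 := by
    have h1 := Nat.ceil_lt_add_one (show 0 ≤ (Z⁻¹) ^ 2 by positivity)
    have : 1 ≤ (Z⁻¹) ^ 2 := one_le_pow₀ hZi
    linarith
  refine ⟨⌊Z⁻¹⌋₊, hP1, Nat.floor_le (by positivity), ?_⟩
  refine (bv_mid hy hU1 hP1 hQy).trans ?_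
  set P : ℝ := (⌊Z⁻¹⌋₊ : ℝ)
  set U : ℝ := (⌈(Z⁻¹) ^ 2⌉₊ : ℝ)
  have t1 : √y * Q ≤ y * Z := by
    calc √y * Q ≤ √y * (√y * Z ^ 3) := by gcongr
      _ = (√y * √y) * Z ^ 3 := by ring
      _ ≤ y * Z := by rw [mul_self_sqrt hx0.le]; gcongr
  have t2 : y / √U ≤ y * Z := by
    have : Z⁻¹ ≤ √U := le_sqrt_of_sq_le hUlo
    calc y / √U ≤ y / Z⁻¹ := by gcongr
      _ = y * Z := by rw [div_inv_eq_mul]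
  have t3 : y / P ≤ 2 * (y * Z) := by
    calc y / P ≤ y / (Z⁻¹ / 2) := by gcongr
      _ = _ := by field_simp
  have t4 : (Q : ℝ) ^ 2 * U ^ 2 ≤ 4 * (y * Z) := by
    calc (Q : ℝ) ^ 2 * U ^ 2 ≤ (√y * Z ^ 3) ^ 2 * (2 * (Z⁻¹) ^ 2) ^ 2 := by gcongr
      _ = 4 * ((√y) ^ 2 * Z ^ 2) := by field_simp; ring
      _ ≤ 4 * (y * Z) := by
          rw [sq_sqrt hx0.le]
          gcongr
          nlinarith
  calc _ ≤ 15000 * (log y) ^ 6 * (y * Z + y * Z + 2 * (y * Z) + 4 * (y * Z)) := by gcongr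
    _ = _ := by ring

lemma bv_T_bound {A : ℝ} (hA : 0 < A) : ∃ C : ℝ, 0 ≤ C ∧ ∀ y, exp 1 ≤ y → ∀ Q : ℕ, (Q : ℝ) ≤ √y * (log y) ^ (-(3 * (A + 8))) →
    ∀ a : ℕ → ℕ, (∀ q, Nat.Coprime (a q) q) →
    ∑ q ∈ Icc 1 Q, |bvW (fun n => if n % q = a q % q then vonMangoldt n else 0) y - bvW (fun _ => 1) y / q.totient| ≤ C * y * (log y) ^ (-A) := by
  obtain ⟨C1, hC1, h1⟩ := bv_sw_chi (A := 2 * (A + 8)) (by linarith)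
  obtain ⟨C2, hC2, h2⟩ := bv_sw_one (A := A + 8) (by linarith)
  refine ⟨4 * C2 + 4 * C1 + 480002, by positivity, fun y hy Q hQ a ha => ?_⟩
  have hx0 : 0 < y := (exp_pos 1).trans_le hy
  have hx1 : 1 ≤ y := by linarith [add_one_le_exp 1]
  have hL : 1 ≤ log y := by rwa [le_log_iff_exp_le hx0]
  have hs : √y ≤ y := sqrt_le_iff.mpr ⟨hx0.le, by nlinarith⟩
  have h1 := h1 y hy
  have h2 := h2 y hy
  set L := log y with hLd
  have hL0 : 0 < L := by linarith
  set Z : ℝ := L ^ (-(A + 8)) with hZ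
  have hZ0 : 0 < Z := rpow_pos_of_pos hL0 _
  have hZ1 : Z ≤ 1 := rpow_le_one_of_one_le_of_nonpos hL (by linarith)
  have hZ3 : L ^ (-(3 * (A + 8))) = Z ^ 3 := by
    rw [hZ, ← rpow_natCast, ← rpow_mul hL0.le]; congr 1; push_cast; ring
  have hZ2 : L ^ (-(2 * (A + 8))) = Z ^ 2 := by
    rw [hZ, ← rpow_natCast, ← rpow_mul hL0.le]; congr 1; push_cast; ring
  have hZi : L ^ (2 * (A + 8)) = (Z⁻¹) ^ 2 := by
    rw [hZ, ← rpow_neg hL0.le, ← rpow_natCast, ← rpow_mul hL0.le]; congr 1; push_cast; ring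
  have hZA : L ^ (-A) = L ^ 8 * Z := by
    rw [hZ, ← rpow_natCast, ← rpow_add hL0]; congr 1; push_cast; ring
  have hZinv1 : 1 ≤ Z⁻¹ := (one_le_inv₀ hZ0).mpr hZ1
  rw [hZ3] at hQ
  rw [hZA]
  rw [hZ2, hZi] at h1
  obtain ⟨P, hP1, hPZ, hmid⟩ := bv_mid_Z hy hZ0 hZ1 hQ
  have hbl : ∀ n ∈ Icc 1 ⌊y⌋₊, bvl (y / n) = log (y / n) := by
    intro n hn
    obtain ⟨g1, g2⟩ := mem_Icc.mp hn
    have hn0 : (0 : ℝ) < n := by exact_mod_cast g1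
    exact bvl_eq ((one_le_div hn0).mpr ((Nat.le_floor_iff hx0.le).mp g2))
  set E := ‖bvT vonMangoldt (fun _ => 1) y - (bvW (fun _ => 1) y : ℂ)‖ with hE
  have hE1 : E ≤ C2 * y * Z := by
    refine le_trans (le_of_eq ?_) h2
    rw [hE, bvT, bvW]
    push_cast
    rw [← sum_sub_distrib]
    congr 1
    refine sum_congr rfl fun n hn => ?_
    rw [hbl n hn]; push_cast; ring
  set H : ℕ → ℝ := fun r => ∑ f ∈ bvPr r, ‖bvT vonMangoldt f y‖ with hH
  have hH0 : ∀ r, 0 ≤ H r := fun r => sum_nonneg fun _ _ => norm_nonneg _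
  have hsmall : ∀ r ∈ Ioc 1 P, (1 / (r.totient : ℝ)) * H r ≤ C1 * y * Z ^ 2 := by
    intro r hr
    rw [mem_Ioc] at hr
    haveI : NeZero r := ⟨by omega⟩
    have hφ : (0 : ℝ) < r.totient := by exact_mod_cast Nat.totient_pos.mpr (by omega)
    have hb : ∀ f ∈ bvPr r, ‖bvT vonMangoldt f y‖ ≤ C1 * y * Z ^ 2 := by
      intro f hf
      obtain ⟨χ, hχ, rfl⟩ := bvPr_mem.mp hf
      have hne : χ ≠ 1 := by
        rintro rfl
        have e1 : (1 : DirichletCharacter ℂ r).conductor = r := hχ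
        rw [DirichletCharacter.conductor_one] at e1
        omega
      have hrL : (r : ℝ) ≤ (Z⁻¹) ^ 2 := by
        have : (r : ℝ) ≤ P := by exact_mod_cast hr.2
        nlinarith
      refine le_trans (le_of_eq ?_) (h1 r χ hχ hne hrL)
      rw [bvT]
      congr 1
      refine sum_congr rfl fun n hn => ?_
      rw [hbl n hn]; ring
    have hcard : ((bvPr r).card : ℝ) ≤ r.totient := by exact_mod_cast bvPr_card r
    have hsum := sum_le_card_nsmul _ _ _ hb
    rw [nsmul_eq_mul] at hsum
    calc _ ≤ (1 / (r.totient : ℝ)) * (r.totient * (C1 * y * Z ^ 2)) := by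
          refine mul_le_mul_of_nonneg_left (hsum.trans ?_) (by positivity)
          gcongr
      _ = _ := by field_simp
  have hr : ∑ r ∈ Ioc 1 Q, (1 / (r.totient : ℝ)) * H r ≤ C1 * y * Z + 120000 * L ^ 6 * (y * Z) := by
    have hnn : ∀ r, 0 ≤ (1 / (r.totient : ℝ)) * H r := fun r => mul_nonneg (by positivity) (hH0 r)
    have hsub : Ioc 1 Q ⊆ Ioc 1 P ∪ Ioc P Q := by
      intro r; simp only [Finset.mem_union, mem_Ioc]; omega
    refine (sum_le_sum_of_subset_of_nonneg hsub fun r _ _ => hnn r).trans ?_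
    have hdis : Disjoint (Ioc 1 P) (Ioc P Q) := by
      rw [Finset.disjoint_left]; intro r; simp only [mem_Ioc]; omega
    rw [sum_union hdis]
    refine add_le_add ?_ hmid
    refine (sum_le_card_nsmul _ _ _ hsmall).trans ?_
    rw [nsmul_eq_mul, Nat.card_Ioc]
    have : ((P - 1 : ℕ) : ℝ) ≤ Z⁻¹ := le_trans (by exact_mod_cast Nat.sub_le _ _) hPZ
    calc _ ≤ Z⁻¹ * (C1 * y * Z ^ 2) := by gcongr
      _ = _ := by field_simp
  have hQyZ : (Q : ℝ) ≤ y * Z := by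
    refine hQ.trans ?_
    have : Z ^ 3 ≤ Z := by
      calc Z ^ 3 ≤ Z ^ 1 := pow_le_pow_of_le_one hZ0.le hZ1 (by norm_num)
        _ = Z := pow_one Z
    gcongr
  have hQy : (Q : ℝ) ≤ y := hQyZ.trans (mul_le_of_le_one_right hx0.le hZ1)
  have hlogQ : (1 + log Q) ^ 2 ≤ 4 * L ^ 2 := by
    have e0 := log_natCast_nonneg Q
    have e1 : log Q ≤ L := by
      rcases Nat.eq_zero_or_pos Q with rfl | hQ0
      · simp; exact hL0.le
      · exact log_le_log (by exact_mod_cast hQ0) hQy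
    calc _ ≤ (L + L) ^ 2 := by gcongr
      _ = _ := by ring
  have hE0 : 0 ≤ E := norm_nonneg _
  have step : ∑ q ∈ Icc 1 Q, |bvW (fun n => if n % q = a q % q then vonMangoldt n else 0) y - bvW (fun _ => 1) y / q.totient| ≤
      ∑ q ∈ Icc 1 Q, ((1 / (q.totient : ℝ)) * E + (1 / (q.totient : ℝ)) * ∑ r ∈ q.divisors.erase 1, H r + 2 * L ^ 3) := by
    refine sum_le_sum fun q hq => ?_
    obtain ⟨g1, g2⟩ := mem_Icc.mp hq
    have hqy : (q : ℝ) ≤ y := le_trans (by exact_mod_cast g2) hQy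
    refine (bv_decomp g1 (ha q) hy hqy).trans (le_of_eq ?_)
    rw [mul_add]
  refine step.trans ?_
  rw [sum_add_distrib, sum_add_distrib, ← sum_mul, sum_const, nsmul_eq_mul, Nat.card_Icc, Nat.add_sub_cancel]
  have s1 : (∑ q ∈ Icc 1 Q, (1 / (q.totient : ℝ))) * E ≤ 4 * C2 * (L ^ 8 * (y * Z)) := by
    have hLL : L ^ 2 ≤ L ^ 8 := pow_le_pow_right₀ hL (by norm_num)
    calc _ ≤ (4 * L ^ 2) * (C2 * y * Z) := mul_le_mul ((bv_phi_sum Q).trans hlogQ) hE1 hE0 (by positivity)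
      _ ≤ (4 * L ^ 8) * (C2 * y * Z) := by gcongr
      _ = _ := by ring
  have s2 : ∑ q ∈ Icc 1 Q, (1 / (q.totient : ℝ)) * ∑ r ∈ q.divisors.erase 1, H r ≤ (4 * C1 + 480000) * (L ^ 8 * (y * Z)) := by
    have hLL : L ^ 2 ≤ L ^ 8 := pow_le_pow_right₀ hL (by norm_num)
    calc _ ≤ (1 + log Q) ^ 2 * ∑ r ∈ Ioc 1 Q, (1 / (r.totient : ℝ)) * H r := bv_swap_sum Q H hH0
      _ ≤ (4 * L ^ 2) * (C1 * y * Z + 120000 * L ^ 6 * (y * Z)) := by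
          refine mul_le_mul hlogQ hr ?_ (by positivity)
          exact sum_nonneg fun r _ => mul_nonneg (by positivity) (hH0 r)
      _ = 4 * C1 * (L ^ 2 * (y * Z)) + 480000 * (L ^ 8 * (y * Z)) := by ring
      _ ≤ 4 * C1 * (L ^ 8 * (y * Z)) + 480000 * (L ^ 8 * (y * Z)) := by gcongr
      _ = _ := by ring
  have s3 : (Q : ℝ) * (2 * L ^ 3) ≤ 2 * (L ^ 8 * (y * Z)) := by
    have hLL : L ^ 3 ≤ L ^ 8 := pow_le_pow_right₀ hL (by norm_num)
    calc _ ≤ (y * Z) * (2 * L ^ 8) := by gcongr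
      _ = _ := by ring
  calc _ ≤ 4 * C2 * (L ^ 8 * (y * Z)) + (4 * C1 + 480000) * (L ^ 8 * (y * Z)) + 2 * (L ^ 8 * (y * Z)) := by linarith
    _ = _ := by ring

noncomputable def bvw (q a n : ℕ) : ℝ := if n % q = a % q then vonMangoldt n else 0

noncomputable def bvEr (q a : ℕ) (y : ℝ) : ℝ := |bvW (bvw q a) y - bvW (fun _ => 1) y / q.totient|

lemma bv_theta_psi {x : ℝ} (hx : 1 ≤ x) (q a : ℕ) : |chebyTheta x q a - ∑ n ∈ Icc 1 ⌊x⌋₊, bvw q a n| ≤ 2 * √x * log x := by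
  have h0 := Chebyshev.psi_sub_theta_le hx
  rw [Chebyshev.psi_sub_theta_eq_sum_not_prime] at h0
  refine le_trans ?_ h0
  have e : chebyTheta x q a = ∑ n ∈ Icc 1 ⌊x⌋₊, if n.Prime then bvw q a n else 0 := by
    rw [chebyTheta, sum_filter]
    symm
    refine (sum_subset (fun n hn => Finset.mem_Iic.mpr (mem_Icc.mp hn).2) fun n hn hn' => ?_).trans (sum_congr rfl fun n _ => ?_)
    · rw [Finset.mem_Iic] at hn
      rw [mem_Icc] at hn'
      have : n = 0 := by omega
      subst this; simp [Nat.not_prime_zero]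
    · by_cases hp : n.Prime
      · rw [if_pos hp, bvw, ArithmeticFunction.vonMangoldt_apply_prime hp]
        simp [hp]
      · simp [hp]
  rw [e, ← sum_sub_distrib, sum_filter]
  refine (abs_sum_le_sum_abs _ _).trans ?_
  change _ ≤ ∑ n ∈ Icc 1 ⌊x⌋₊, _
  refine sum_le_sum fun n _ => ?_
  by_cases hp : n.Prime
  · simp [hp]
  · rw [if_neg hp, if_pos hp, zero_sub, abs_neg, bvw]
    split_ifs
    · rw [abs_of_nonneg vonMangoldt_nonneg]
    · simp [vonMangoldt_nonneg]

lemma bv_point {x d : ℝ} (hx : 1 ≤ x) (hd : 0 < d) (hd1 : d ≤ 1) {q : ℕ} (hq : 1 ≤ q) (a : ℕ) :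
    |∑ n ∈ Icc 1 ⌊x⌋₊, bvw q a n - x / q.totient| ≤ (1 / (q.totient : ℝ)) * (2 * d * x + 1) + (bvEr q a x + bvEr q a (x * exp d) + bvEr q a (x * exp (-d))) / d := by
  have hw : ∀ n, 0 ≤ bvw q a n := by
    intro n; unfold bvw; split_ifs
    · exact vonMangoldt_nonneg
    · exact le_rfl
  have hx0 : 0 < x := by linarith
  have hφ : (0 : ℝ) < q.totient := by exact_mod_cast Nat.totient_pos.mpr hq
  have em : x * exp (-d) * exp d = x := by rw [mul_assoc, ← exp_add]; simp
  have a1 := (bvW_sandwich hw hx0 hd.le).1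
  have a2 := (bvW_sandwich hw (y := x * exp (-d)) (by positivity) hd.le).2
  have b1 := (bvW_sandwich (w := fun _ => 1) (fun _ => zero_le_one) hx0 hd.le).2
  have b2 := (bvW_sandwich (w := fun _ => 1) (fun _ => zero_le_one) (y := x * exp (-d)) (by positivity) hd.le).1
  rw [em] at a2 b2
  simp only [sum_const, Nat.card_Icc, Nat.add_sub_cancel, nsmul_eq_mul, mul_one] at b1 b2
  have f1 : (⌊x * exp d⌋₊ : ℝ) ≤ x * exp d := Nat.floor_le (by positivity)
  have f2 : x * exp (-d) - 1 ≤ (⌊x * exp (-d)⌋₊ : ℝ) := (Nat.sub_one_lt_floor _).le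
  have g1 : exp d ≤ 1 + 2 * d := by
    have := abs_exp_sub_one_le (x := d) (by rw [abs_of_pos hd]; exact hd1)
    rw [abs_of_pos hd] at this
    linarith [le_abs_self (exp d - 1)]
  have g2 : 1 - d ≤ exp (-d) := by linarith [add_one_le_exp (-d)]
  have c0 : |bvW (bvw q a) x - bvW (fun _ => 1) x / q.totient| = bvEr q a x := rfl
  have c1 : |bvW (bvw q a) (x * exp d) - bvW (fun _ => 1) (x * exp d) / q.totient| = bvEr q a (x * exp d) := rfl
  have c2 : |bvW (bvw q a) (x * exp (-d)) - bvW (fun _ => 1) (x * exp (-d)) / q.totient| = bvEr q a (x * exp (-d)) := rfl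
  have d0 := abs_le.mp c0.le
  have d1 := abs_le.mp c1.le
  have d2 := abs_le.mp c2.le
  have n0 : 0 ≤ bvEr q a x := abs_nonneg _
  have n1 : 0 ≤ bvEr q a (x * exp d) := abs_nonneg _
  have n2 : 0 ≤ bvEr q a (x * exp (-d)) := abs_nonneg _
  set ps := ∑ n ∈ Icc 1 ⌊x⌋₊, bvw q a n
  have u1 : d * ps ≤ (d * (x * (1 + 2 * d))) / q.totient + (bvEr q a x + bvEr q a (x * exp d)) := by
    have : (bvW (fun _ => 1) (x * exp d) - bvW (fun _ => 1) x) / q.totient ≤ (d * (x * (1 + 2 * d))) / q.totient := by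
      gcongr
      refine b1.trans (mul_le_mul_of_nonneg_left (f1.trans (by gcongr)) hd.le)
    rw [sub_div] at this
    linarith
  have u2 : (d * (x * (1 - d) - 1)) / q.totient - (bvEr q a x + bvEr q a (x * exp (-d))) ≤ d * ps := by
    have : (d * (x * (1 - d) - 1)) / q.totient ≤ (bvW (fun _ => 1) x - bvW (fun _ => 1) (x * exp (-d))) / q.totient := by
      gcongr
      refine le_trans (mul_le_mul_of_nonneg_left ?_ hd.le) b2
      have : x * (1 - d) ≤ x * exp (-d) := by gcongr
      linarith
    rw [sub_div] at this
    linarith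
  set E0 := bvEr q a x
  set E1 := bvEr q a (x * exp d)
  set E2 := bvEr q a (x * exp (-d))
  have hi : 0 < 1 / (q.totient : ℝ) := by positivity
  set φi := 1 / (q.totient : ℝ) with hφi
  have e1 : ∀ z : ℝ, z / q.totient = φi * z := fun z => by rw [hφi]; ring
  rw [e1] at u1 u2 ⊢
  have v1 : ps ≤ φi * (x * (1 + 2 * d)) + (E0 + E1) / d := by
    rw [← mul_le_mul_iff_right₀ hd]
    refine u1.trans (le_of_eq ?_)
    field_simp
  have v2 : φi * (x * (1 - d) - 1) - (E0 + E2) / d ≤ ps := by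
    rw [← mul_le_mul_iff_right₀ hd]
    refine le_trans (le_of_eq ?_) u2
    field_simp
  have w1 : (E0 + E1 + E2) / d = (E0 + E1) / d + E2 / d := by ring
  have w2 : (E0 + E1 + E2) / d = (E0 + E2) / d + E1 / d := by ring
  have w3 : 0 ≤ E1 / d := by positivity
  have w4 : 0 ≤ E2 / d := by positivity
  have w5 : 0 ≤ φi * (d * x) := by positivity
  rw [abs_le]
  constructor
  · rw [w2]; linarith
  · rw [w1]; linarith

lemma bv_xshift {k x y : ℝ} (hk : 0 ≤ k) (hx0 : 0 < x) (hL2 : 2 ≤ log x) (hLk : 2 ^ (k + 1) ≤ log x) (h1 : x * exp (-1) ≤ y) (h2 : y ≤ x * exp 1) :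
    exp 1 ≤ y ∧ √x * (log x) ^ (-(k + 1)) ≤ √y * (log y) ^ (-k) ∧ ∀ A : ℝ, 0 < A → y * (log y) ^ (-A) ≤ 3 * 2 ^ A * (x * (log x) ^ (-A)) := by
  have hy0 : 0 < y := lt_of_lt_of_le (by positivity) h1
  have l1 : log x - 1 ≤ log y := by
    have := log_le_log (by positivity) h1
    rwa [log_mul hx0.ne' (by positivity), log_exp, ← sub_eq_add_neg] at this
  have l2 : log y ≤ log x + 1 := by
    have := log_le_log hy0 h2
    rwa [log_mul hx0.ne' (by positivity), log_exp] at this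
  set L := log x
  set M := log y with hM
  have hL0 : 0 < L := by linarith
  have hM0 : 0 < M := by linarith
  refine ⟨?_, ?_, ?_⟩
  · rw [← le_log_iff_exp_le hy0]; linarith
  · have hs : √x / 2 ≤ √y := by
      rw [div_le_iff₀ (by norm_num : (0 : ℝ) < 2), ← sqrt_sq (show (0 : ℝ) ≤ 2 by norm_num), ← sqrt_mul hy0.le]
      refine sqrt_le_sqrt ?_
      rw [exp_neg, ← div_eq_mul_inv, div_le_iff₀ (exp_pos 1)] at h1
      have := exp_one_lt_d9
      nlinarith
    have hp : (2 * L) ^ (-k) ≤ M ^ (-k) := rpow_le_rpow_of_nonpos hM0 (by linarith) (by linarith)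
    rw [mul_rpow (by norm_num) hL0.le] at hp
    have e1 : L ^ (-(k + 1)) = L ^ (-k) * L⁻¹ := by
      rw [neg_add, rpow_add hL0, rpow_neg_one]
    have e2 : L⁻¹ ≤ (1 / 2) * 2 ^ (-k) := by
      have : (1 / 2 : ℝ) * 2 ^ (-k) = (2 ^ (k + 1))⁻¹ := by
        rw [rpow_add (by norm_num), rpow_neg (by norm_num), rpow_one, mul_inv]; ring
      rw [this]
      exact inv_anti₀ (by positivity) hLk
    calc √x * L ^ (-(k + 1)) = √x * L ^ (-k) * L⁻¹ := by rw [e1]; ring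
      _ ≤ √x * L ^ (-k) * ((1 / 2) * 2 ^ (-k)) := by gcongr
      _ = (√x / 2) * (2 ^ (-k) * L ^ (-k)) := by ring
      _ ≤ √y * M ^ (-k) := by gcongr
  · intro A hA
    have hp : M ^ (-A) ≤ (L / 2) ^ (-A) := rpow_le_rpow_of_nonpos (by linarith) (by linarith) (by linarith)
    rw [div_rpow hL0.le (by norm_num), rpow_neg (by norm_num : (0 : ℝ) ≤ 2), div_inv_eq_mul] at hp
    have hy3 : y ≤ 3 * x := by nlinarith [exp_one_lt_d9]
    calc y * M ^ (-A) ≤ (3 * x) * (L ^ (-A) * 2 ^ A) := by gcongr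
      _ = _ := by ring

/-- (Bombieri–Vinogradov theorem) For every `A > 0` there are `B = B(A) > 0` and `C_A > 0`
such that, with `Q = x^{1/2} (log x)^{-B}`, for all sufficiently large `x`,
`∑_{q ≤ Q} max_{(a,q)=1} |θ(x; q, a) − x/φ(q)| ≤ C_A · x / (log x)^A`.
(The maximum over residues `a` coprime to `q` is expressed by quantifying over all
choice functions `a : ℕ → ℕ` selecting a coprime residue for each modulus.) -/
theorem bombieri_vinogradov :
    ∀ A > (0 : ℝ), ∃ B > (0 : ℝ), ∃ C > (0 : ℝ), ∀ᶠ x : ℝ in atTop,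
      ∀ a : ℕ → ℕ, (∀ q, Nat.Coprime (a q) q) →
        ∑ q ∈ Finset.Icc 1 ⌊x ^ ((1 : ℝ) / 2) * (Real.log x) ^ (-B)⌋₊,
          |chebyTheta x q (a q) - x / (Nat.totient q)| ≤ C * x / (Real.log x) ^ A := by
  intro A hA
  obtain ⟨C0, hC0, hT⟩ := bv_T_bound (A := 2 * A + 2) (by linarith)
  set k : ℝ := 3 * (2 * A + 2 + 8) with hk
  set D : ℝ := C0 * (3 * 2 ^ (2 * A + 2)) with hD
  have hD0 : 0 ≤ D := by positivity
  refine ⟨k + 1, by rw [hk]; linarith, 14 + 3 * D, by linarith, ?_⟩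
  have ev1 : ∀ᶠ x : ℝ in atTop, (max 2 (2 ^ (k + 1)) : ℝ) ≤ log x := tendsto_log_atTop.eventually_ge_atTop _
  have ev2 : ∀ᶠ x : ℝ in atTop, ‖log x ^ (A + 2)‖ ≤ 1 * ‖x ^ (1 : ℝ)‖ := (isLittleO_log_rpow_rpow_atTop (A + 2) zero_lt_one).bound zero_lt_one
  filter_upwards [ev1, ev2, eventually_ge_atTop 1] with x hxL hx2 hx1 a ha
  have hx0 : 0 < x := by linarith
  have hL2 : 2 ≤ log x := (le_max_left _ _).trans hxL
  have hLk : 2 ^ (k + 1) ≤ log x := (le_max_right _ _).trans hxL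
  have hL0 : 0 < log x := by linarith
  have hL1 : 1 ≤ log x := by linarith
  have hsh := fun y => bv_xshift (y := y) (show 0 ≤ k by rw [hk]; linarith) hx0 hL2 hLk
  rw [rpow_one, one_mul, norm_of_nonneg (by positivity), norm_of_nonneg hx0.le] at hx2
  have hsq : x ^ ((1 : ℝ) / 2) = √x := (sqrt_eq_rpow x).symm
  rw [hsq]
  set L := log x with hLd
  set Q := ⌊√x * L ^ (-(k + 1))⌋₊ with hQd
  have hQ : (Q : ℝ) ≤ √x * L ^ (-(k + 1)) := Nat.floor_le (by positivity)
  set d : ℝ := L ^ (-(A + 2)) with hd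
  have hd0 : 0 < d := by positivity
  have hd1 : d ≤ 1 := rpow_le_one_of_one_le_of_nonpos hL1 (by linarith)
  have hE : ∀ y, x * exp (-1) ≤ y → y ≤ x * exp 1 → ∑ q ∈ Icc 1 Q, bvEr q (a q) y ≤ D * (x * L ^ (-(2 * A + 2))) := by
    intro y h1 h2
    obtain ⟨s1, s2, s3⟩ := hsh y h1 h2
    refine (hT y s1 Q (hQ.trans s2) a ha).trans ?_
    calc C0 * y * log y ^ (-(2 * A + 2)) = C0 * (y * log y ^ (-(2 * A + 2))) := by ring
      _ ≤ C0 * (3 * 2 ^ (2 * A + 2) * (x * L ^ (-(2 * A + 2)))) := mul_le_mul_of_nonneg_left (s3 _ (by linarith)) hC0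
      _ = _ := by rw [hD]; ring
  have i0 := hE x (mul_le_of_le_one_right hx0.le (by rw [exp_le_one_iff]; norm_num)) (le_mul_of_one_le_right hx0.le (one_le_exp (by norm_num)))
  have i1 := hE (x * exp d) (by gcongr; linarith) (by gcongr)
  have i2 := hE (x * exp (-d)) (by gcongr) (by gcongr; linarith)
  have hstep : ∑ q ∈ Icc 1 Q, |chebyTheta x q (a q) - x / (Nat.totient q)| ≤
      ∑ q ∈ Icc 1 Q, (2 * √x * L + ((1 / (q.totient : ℝ)) * (2 * d * x + 1) + (bvEr q (a q) x + bvEr q (a q) (x * exp d) + bvEr q (a q) (x * exp (-d))) / d)) := by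
    refine sum_le_sum fun q hq => ?_
    have t1 := bv_theta_psi hx1 q (a q)
    have t2 := bv_point hx1 hd0 hd1 (mem_Icc.mp hq).1 (a q)
    exact (abs_sub_le _ _ _).trans (add_le_add t1 t2)
  refine hstep.trans ?_
  rw [sum_add_distrib, sum_add_distrib, sum_const, nsmul_eq_mul, Nat.card_Icc, Nat.add_sub_cancel, ← sum_mul, ← Finset.sum_div,
    sum_add_distrib, sum_add_distrib]
  have eA : ∀ c : ℝ, c * x / L ^ A = c * (x * L ^ (-A)) := fun c => by rw [rpow_neg hL0.le]; ring
  rw [eA]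
  have hsx : √x * √x = x := mul_self_sqrt hx0.le
  have hs1 : √x ≤ x := sqrt_le_iff.mpr ⟨hx0.le, by nlinarith⟩
  have r1 : (Q : ℝ) * (2 * √x * L) ≤ 2 * (x * L ^ (-A)) := by
    have e1 : L ^ (-(k + 1)) * L ≤ L ^ (-A) := by
      have : L ^ (-(k + 1)) * L = L ^ (-k) := by
        rw [neg_add, rpow_add hL0, rpow_neg_one, mul_assoc, inv_mul_cancel₀ hL0.ne', mul_one]
      rw [this]
      exact rpow_le_rpow_of_exponent_le hL1 (by rw [hk]; linarith)
    calc (Q : ℝ) * (2 * √x * L) ≤ (√x * L ^ (-(k + 1))) * (2 * √x * L) := by gcongr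
      _ = 2 * ((√x * √x) * (L ^ (-(k + 1)) * L)) := by ring
      _ ≤ 2 * (x * L ^ (-A)) := by rw [hsx]; gcongr
  have hQx : (Q : ℝ) ≤ x := by
    calc (Q : ℝ) ≤ √x * L ^ (-(k + 1)) := hQ
      _ ≤ x * 1 := by
          gcongr
          exact rpow_le_one_of_one_le_of_nonpos hL1 (by rw [hk]; linarith)
      _ = x := mul_one x
  have hphi : ∑ q ∈ Icc 1 Q, (1 / (q.totient : ℝ)) ≤ 4 * L ^ 2 := by
    refine (bv_phi_sum Q).trans ?_
    have e0 := log_natCast_nonneg Q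
    have e1 : log Q ≤ L := by
      rcases Nat.eq_zero_or_pos Q with h | hQ0
      · rw [h]; simp; exact hL0.le
      · exact log_le_log (by exact_mod_cast hQ0) hQx
    calc _ ≤ (L + L) ^ 2 := by gcongr
      _ = _ := by ring
  have eLd : L ^ 2 * d = L ^ (-A) := by
    rw [hd, ← rpow_natCast, ← rpow_add hL0]; congr 1; push_cast; ring
  have hLx : L ^ 2 ≤ x * L ^ (-A) := by
    have : L ^ (A + 2) * L ^ (-A) = L ^ 2 := by
      rw [← rpow_natCast, ← rpow_add hL0]; congr 1; push_cast; ring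
    rw [← this]; gcongr
  have r2 : (∑ q ∈ Icc 1 Q, (1 / (q.totient : ℝ))) * (2 * d * x + 1) ≤ 12 * (x * L ^ (-A)) := by
    calc _ ≤ 4 * L ^ 2 * (2 * d * x + 1) := by gcongr
      _ = 8 * (x * (L ^ 2 * d)) + 4 * L ^ 2 := by ring
      _ ≤ 8 * (x * L ^ (-A)) + 4 * (x * L ^ (-A)) := by rw [eLd]; linarith
      _ = _ := by ring
  have eLd2 : L ^ (-(2 * A + 2)) = L ^ (-A) * d := by
    rw [hd, ← rpow_add hL0]; congr 1; ring
  rw [eLd2] at i0 i1 i2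
  have r3 : (∑ q ∈ Icc 1 Q, bvEr q (a q) x + ∑ q ∈ Icc 1 Q, bvEr q (a q) (x * exp d) + ∑ q ∈ Icc 1 Q, bvEr q (a q) (x * exp (-d))) / d ≤ 3 * D * (x * L ^ (-A)) := by
    rw [div_le_iff₀ hd0]
    linarith
  linarith
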